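/- The one-sided limit C_{a,m} = lim_{u→(1/q)⁻} (1−qu)^{1/φ(m)} · ∏_{P ≡ a mod m} (1−u^{deg P})^{−1} exists (the product over monic irreducible P ∈ 𝔽_q[T] congruent to a modulo m), and for every integer n ≥ 1 + 5(6·deg m + 30)·ln(6·deg m + 30) one has |S(n;a,m) / (binom(n + 1/φ(m) − 1, n) · qⁿ) − C_{a,m}| ≤ 48 · exp(3(deg m + 3)/√q) · (deg m + 3)/(√q · n). -/

import Mathlib

/-- Generalized binomial coefficient `binom(x, n) = x(x-1)⋯(x-n+1)/n!` for real `x`. -/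
noncomputable def rbinom (x : ℝ) (n : ℕ) : ℝ :=
  (∏ i ∈ Finset.range n, (x - (i : ℝ))) / (Nat.factorial n : ℝ)

open PowerSeries in
/-- The power series `x` has constant term one and logarithmic derivative `∑ g (i + 1) X ^ i`. -/
def LogRec {R : Type*} [CommRing R] (g : ℕ → R) (x : R⟦X⟧) : Prop :=
  PowerSeries.coeff 0 x = 1 ∧
    ∀ n : ℕ, ((n : R) + 1) * PowerSeries.coeff (n + 1) x =
      ∑ p ∈ Finset.HasAntidiagonal.antidiagonal n, g (p.1 + 1) * PowerSeries.coeff p.2 x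

namespace LogRec

open PowerSeries

theorem iff_derivative {R : Type*} [CommRing R] (g : ℕ → R) (x : R⟦X⟧) :
    LogRec g x ↔ coeff 0 x = 1 ∧
      d⁄dX R x = PowerSeries.mk (fun i => g (i + 1)) * x := by
  unfold LogRec
  refine and_congr_right fun _ => ?_
  rw [PowerSeries.ext_iff]
  refine forall_congr' fun n => ?_
  rw [PowerSeries.coeff_mul, PowerSeries.coeff_derivative, mul_comm]
  simp

theorem mul {R : Type*} [CommRing R] {g h : ℕ → R} {x y : R⟦X⟧} (hx : LogRec g x)
    (hy : LogRec h y) : LogRec (fun k => g k + h k) (x * y) := by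
  rw [iff_derivative] at *
  refine ⟨by simp [PowerSeries.coeff_mul, hx.1, hy.1], ?_⟩
  have : (PowerSeries.mk fun i => g (i + 1) + h (i + 1)) =
    PowerSeries.mk (fun i => g (i + 1)) + PowerSeries.mk (fun i => h (i + 1)) := by
    ext; simp
  rw [this, Derivation.leibniz, hx.2, hy.2]
  simp only [smul_eq_mul]
  ring

theorem congr {R : Type*} [CommRing R] {g h : ℕ → R} {x : R⟦X⟧} (hx : LogRec g x)
    (hgh : ∀ k, g (k + 1) = h (k + 1)) : LogRec h x := by
  refine ⟨hx.1, fun n => ?_⟩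
  rw [hx.2]
  simp [hgh]

theorem one {R : Type*} [CommRing R] : LogRec (fun _ => (0 : R)) (1 : R⟦X⟧) := by
  rw [iff_derivative]
  constructor
  · simp
  · have : (PowerSeries.mk fun _ : ℕ => (0 : R)) = 0 := by ext; simp
    rw [this]; simp

theorem pow {R : Type*} [CommRing R] {g : ℕ → R} {x : R⟦X⟧} (hx : LogRec g x) (c : ℕ) :
    LogRec (fun k => c * g k) (x ^ c) := by
  induction c with
  | zero => simpa using one
  | succ c ih =>
    rw [pow_succ]
    exact (ih.mul hx).congr fun k => by push_cast; ring

theorem inv {K : Type*} [Field K] {g : ℕ → K} {x : K⟦X⟧} (hx : LogRec g x) :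
    LogRec (fun k => - g k) x⁻¹ := by
  rw [iff_derivative] at *
  have h0 : constantCoeff x = 1 := by simpa using hx.1
  refine ⟨by simp [h0], ?_⟩
  have : (PowerSeries.mk fun i => - g (i + 1)) = - PowerSeries.mk (fun i => g (i + 1)) := by
    ext; simp
  have h1 : x⁻¹ * x = 1 := PowerSeries.inv_mul_cancel _ (by simp [h0])
  rw [PowerSeries.derivative_inv', hx.2, this]
  linear_combination (-(PowerSeries.mk fun i => g (i + 1)) * x⁻¹) * h1

theorem abs_coeff_le {e w : ℕ → ℝ} {x y : ℝ⟦X⟧} (hx : LogRec e x) (hy : LogRec w y)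
    (h : ∀ k, |e (k + 1)| ≤ w (k + 1)) (n : ℕ) : |coeff n x| ≤ coeff n y := by
  induction n using Nat.strong_induction_on with
  | _ n ih =>
    cases n with
    | zero => rw [hx.1, hy.1]; simp
    | succ n =>
      have h' : (0 : ℝ) < ((n : ℝ) + 1) := by positivity
      have : ((n : ℝ) + 1) * |coeff (n + 1) x| ≤ ((n : ℝ) + 1) * coeff (n + 1) y := by
        rw [← abs_of_pos h', ← abs_mul, abs_of_pos h', hx.2, hy.2]
        refine (Finset.abs_sum_le_sum_abs _ _).trans (Finset.sum_le_sum fun p hp => ?_)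
        rw [abs_mul]
        have := Finset.HasAntidiagonal.mem_antidiagonal.1 hp
        exact mul_le_mul (h _) (ih p.2 (by omega)) (abs_nonneg _) ((abs_nonneg _).trans (h _))
      exact le_of_mul_le_mul_left this h'

theorem geom {R : Type*} [CommRing R] (y : R) :
    LogRec (fun k => y ^ k) (PowerSeries.mk fun n => y ^ n) := by
  refine ⟨by simp, fun n => ?_⟩
  simp only [PowerSeries.coeff_mk]
  rw [Finset.sum_congr rfl (g := fun _ => y ^ (n + 1))]
  · simp
  · intro p hp
    rw [← pow_add]
    congr 1
    have := Finset.HasAntidiagonal.mem_antidiagonal.1 hp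
    omega

theorem coeff_geom_pow (y : ℝ) (c n : ℕ) :
    coeff n ((PowerSeries.mk fun n => y ^ n) ^ (c + 1) : ℝ⟦X⟧) = (c + n).choose c * y ^ n := by
  have : (PowerSeries.mk fun n => y ^ n : ℝ⟦X⟧) = rescale y (PowerSeries.mk 1) := by
    ext; simp
  rw [this, ← map_pow, PowerSeries.mk_one_pow_eq_mk_choose_add]
  simp [mul_comm]

end LogRec

theorem hasDerivAt_tsum_pow (a : ℕ → ℝ) (ρ : ℝ) (hρ : 0 < ρ)
    (ha : Summable fun n : ℕ => (n : ℝ) * |a n| * ρ ^ (n - 1)) (x : ℝ) (hx : |x| < ρ) :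
    HasDerivAt (fun z => ∑' n, a n * z ^ n) (∑' n, a n * (n * x ^ (n - 1))) x := by
  refine hasDerivAt_tsum_of_isPreconnected (t := Metric.ball 0 ρ) (y₀ := 0)
    (g := fun n z => a n * z ^ n) (g' := fun n z => a n * (n * z ^ (n - 1)))
    ha Metric.isOpen_ball (convex_ball _ _).isPreconnected ?_ ?_ (by simpa using hρ) ?_
    (by simpa using hx)
  · intro n z _
    exact (hasDerivAt_pow n z).const_mul (a n)
  · intro n z hz
    have hz' : |z| ≤ ρ := by simpa using (Metric.mem_ball.1 hz).le
    rw [Real.norm_eq_abs, abs_mul, abs_mul, abs_pow, Nat.abs_cast]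
    calc |a n| * (n * |z| ^ (n - 1)) ≤ |a n| * (n * ρ ^ (n - 1)) := by gcongr
      _ = _ := by ring
  · refine summable_of_ne_finset_zero (s := {0}) fun n hn => ?_
    have : n ≠ 0 := by simpa using hn
    simp [this]

open PowerSeries in
/-- Summing a series with prescribed logarithmic derivative. -/
theorem LogRec.tsum_eq_exp {e : ℕ → ℝ} {f : ℝ⟦X⟧} (hf : LogRec e f) (ρ : ℝ) (hρ : 1 < ρ)
    (he : Summable fun n => |e (n + 1)| * ρ ^ n)
    (hfs : Summable fun n : ℕ => (n : ℝ) * |coeff n f| * ρ ^ (n - 1)) :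
    ∑' n, coeff n f = Real.exp (∑' n, e (n + 1) / ((n : ℝ) + 1)) := by
  have hρ0 : 0 < ρ := by linarith
  set a : ℕ → ℝ := fun n => coeff n f with ha
  set b : ℕ → ℝ := fun n => e n / n with hb
  have hb0 : b 0 = 0 := by simp [hb]
  have hbs : Summable fun n : ℕ => (n : ℝ) * |b n| * ρ ^ (n - 1) := by
    rw [← summable_nat_add_iff 1]
    refine he.congr fun n => ?_
    have : ((n : ℝ) + 1) ≠ 0 := by positivity
    simp only [hb, abs_div, Nat.cast_add, Nat.cast_one, Nat.add_sub_cancel]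
    rw [abs_of_pos (by positivity : (0:ℝ) < (n : ℝ) + 1)]
    field_simp
  have key : ∀ x : ℝ, |x| < ρ → (∑' n, a n * (n * x ^ (n - 1))) =
      (∑' n, b n * (n * x ^ (n - 1))) * ∑' n, a n * x ^ n := by
    intro x hx
    have s1 : Summable fun n => ‖e (n + 1) * x ^ n‖ := by
      refine Summable.of_nonneg_of_le (fun _ => norm_nonneg _) (fun n => ?_) he
      rw [norm_mul, norm_pow, Real.norm_eq_abs, Real.norm_eq_abs]
      gcongr
    have s0 : Summable fun n => ‖a (n + 1) * ((n + 1 : ℕ) * x ^ n)‖ := by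
      refine Summable.of_nonneg_of_le (fun _ => norm_nonneg _) (fun n => ?_)
        ((summable_nat_add_iff 1).2 hfs)
      rw [norm_mul, norm_mul, norm_pow, Real.norm_eq_abs, Real.norm_eq_abs, Real.norm_eq_abs,
        Nat.abs_cast, Nat.add_sub_cancel]
      calc _ ≤ |a (n + 1)| * (↑(n + 1) * ρ ^ n) := by gcongr
        _ = _ := by ring
    have s2 : Summable fun n => ‖a n * x ^ n‖ := by
      rw [← summable_nat_add_iff 1]
      refine Summable.of_nonneg_of_le (fun _ => norm_nonneg _) (fun n => ?_) (s0.mul_left ρ)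
      rw [norm_mul, norm_mul, norm_mul, pow_succ, norm_mul]
      have h1 : ‖x‖ ≤ ρ := by simpa using hx.le
      have h2 : (1 : ℝ) ≤ ‖((n + 1 : ℕ) : ℝ)‖ := by
        rw [Real.norm_eq_abs, Nat.abs_cast]; simp
      calc ‖a (n + 1)‖ * (‖x ^ n‖ * ‖x‖) = ‖x‖ * (‖a (n + 1)‖ * (1 * ‖x ^ n‖)) := by ring
        _ ≤ _ := by gcongr
    have e1 : ∑' n, a n * (n * x ^ (n - 1)) = ∑' n, a (n + 1) * ((n + 1 : ℕ) * x ^ n) := by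
      rw [tsum_eq_zero_add']
      · simp
      · simpa using s0.of_norm
    have e2 : ∑' n, b n * (n * x ^ (n - 1)) = ∑' n, e (n + 1) * x ^ n := by
      rw [tsum_eq_zero_add']
      · simp only [hb0, zero_mul, zero_add, Nat.add_sub_cancel]
        refine tsum_congr fun n => ?_
        have : ((n : ℝ) + 1) ≠ 0 := by positivity
        simp only [hb]; push_cast
        field_simp
      · refine s1.of_norm.congr fun n => ?_
        have : ((n : ℝ) + 1) ≠ 0 := by positivity
        simp only [hb, Nat.add_sub_cancel]; push_cast
        field_simp
    rw [e1, e2, tsum_mul_tsum_eq_tsum_sum_antidiagonal_of_summable_norm s1 s2]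
    refine tsum_congr fun n => ?_
    have := hf.2 n
    calc a (n + 1) * ((n + 1 : ℕ) * x ^ n) = ((n : ℝ) + 1) * coeff (n + 1) f * x ^ n := by
          simp only [ha]; push_cast; ring
      _ = _ := by
        rw [this, Finset.sum_mul]
        refine Finset.sum_congr rfl fun p hp => ?_
        rw [← Finset.HasAntidiagonal.mem_antidiagonal.1 hp, pow_add]
        ring
  set A : ℝ → ℝ := fun z => ∑' n, a n * z ^ n with hA
  set B : ℝ → ℝ := fun z => ∑' n, b n * z ^ n with hB
  have hd : ∀ x ∈ Set.Icc (0 : ℝ) 1, HasDerivAt (fun z => A z * Real.exp (- B z)) 0 x := by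
    intro x hx
    have hx' : |x| < ρ := by rw [abs_of_nonneg hx.1]; linarith [hx.2]
    have h1 := hasDerivAt_tsum_pow a ρ hρ0 hfs x hx'
    have h2 := hasDerivAt_tsum_pow b ρ hρ0 hbs x hx'
    refine (h1.mul (h2.neg.exp)).congr_deriv ?_
    rw [key x hx']
    simp only [Pi.neg_apply]
    ring
  have hc : A 1 * Real.exp (- B 1) = A 0 * Real.exp (- B 0) :=
    constant_of_has_deriv_right_zero (f := fun z => A z * Real.exp (- B z)) (a := 0) (b := 1)
      (fun x hx => (hd x hx).continuousAt.continuousWithinAt)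
      (fun x hx => (hd x ⟨hx.1, hx.2.le⟩).hasDerivWithinAt) 1 (by simp)
  have hA0 : A 0 = 1 := by
    simp only [hA]
    rw [tsum_eq_single 0 (by intro n hn; simp [hn])]
    simpa [ha] using hf.1
  have hB0 : B 0 = 0 := by
    simp only [hB]
    rw [tsum_eq_single 0 (by intro n hn; simp [hn])]
    simp [hb0]
  have hB1 : B 1 = ∑' n, e (n + 1) / ((n : ℝ) + 1) := by
    simp only [hB, one_pow, mul_one]
    rw [tsum_eq_zero_add']
    · simp [hb]
    · refine Summable.of_norm (Summable.of_nonneg_of_le (fun _ => norm_nonneg _) (fun n => ?_) he)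
      simp only [hb, norm_div, Real.norm_eq_abs, Nat.abs_cast]
      have h1 : (1 : ℝ) ≤ ((n + 1 : ℕ) : ℝ) := by simp
      calc |e (n + 1)| / ((n + 1 : ℕ) : ℝ) ≤ |e (n + 1)| := div_le_self (abs_nonneg _) h1
        _ ≤ |e (n + 1)| * ρ ^ n := le_mul_of_one_le_right (abs_nonneg _) (one_le_pow₀ hρ.le)
  rw [hA0, hB0, hB1] at hc
  have hA1 : A 1 = ∑' n, coeff n f := by simp [hA, ha]
  rw [← hA1]
  rw [Real.exp_neg] at hc
  have := Real.exp_pos (∑' n, e (n + 1) / ((n : ℝ) + 1))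
  field_simp at hc
  simpa using hc

/-- `binom (n + θ - 1) n`, the coefficient of `X ^ n` in `(1 - X) ^ (-θ)`. -/
noncomputable def risingBinom (θ : ℝ) (n : ℕ) : ℝ :=
  ∏ i ∈ Finset.range n, ((i : ℝ) + θ) / ((i : ℝ) + 1)

theorem risingBinom_succ (θ : ℝ) (n : ℕ) :
    ((n : ℝ) + 1) * risingBinom θ (n + 1) = ((n : ℝ) + θ) * risingBinom θ n := by
  rw [risingBinom, Finset.prod_range_succ, ← risingBinom]
  have : ((n : ℝ) + 1) ≠ 0 := by positivity
  field_simp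

theorem risingBinom_pos {θ : ℝ} (hθ : 0 < θ) (n : ℕ) : 0 < risingBinom θ n :=
  Finset.prod_pos fun i _ => by positivity

theorem logRec_risingBinom (θ : ℝ) :
    LogRec (fun _ => θ) (PowerSeries.mk (risingBinom θ)) := by
  refine ⟨by simp [risingBinom], fun n => ?_⟩
  simp only [PowerSeries.coeff_mk]
  rw [risingBinom_succ]
  rw [Finset.Nat.sum_antidiagonal_eq_sum_range_succ_mk]
  rw [Finset.sum_flip (f := fun k => θ * risingBinom θ k)]
  induction n with
  | zero => simp [risingBinom]
  | succ n ih =>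
    rw [Finset.sum_range_succ, ← ih]
    have := risingBinom_succ θ n
    push_cast
    linear_combination this

theorem risingBinom_anti {θ : ℝ} (hθ : 0 < θ) (hθ1 : θ ≤ 1) : Antitone (risingBinom θ) := by
  refine antitone_nat_of_succ_le fun n => ?_
  have h := risingBinom_succ θ n
  have h1 := risingBinom_pos hθ n
  have h2 : (0 : ℝ) < (n : ℝ) + 1 := by positivity
  nlinarith

theorem mul_risingBinom_mono {θ : ℝ} (hθ : 0 < θ) :
    Monotone (fun n : ℕ => (n : ℝ) * risingBinom θ n) := by
  refine monotone_nat_of_le_succ fun n => ?_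
  have h := risingBinom_succ θ n
  have h1 := risingBinom_pos hθ n
  push_cast
  nlinarith

theorem le_mul_risingBinom {θ : ℝ} (hθ : 0 < θ) {n : ℕ} (hn : 1 ≤ n) :
    θ ≤ n * risingBinom θ n := by
  have := mul_risingBinom_mono hθ hn
  simpa [risingBinom] using this

theorem hasSum_choose_geom {y : ℝ} (hy0 : 0 ≤ y) (hy : y < 1) (k : ℕ) :
    HasSum (fun j : ℕ => ((k + j).choose k : ℝ) * y ^ j) (1 / (1 - y) ^ (k + 1)) := by
  simpa [add_comm] using hasSum_choose_mul_geometric_of_norm_lt_one k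
    (r := y) (by rwa [Real.norm_of_nonneg hy0])

theorem hasSum_mul_choose_geom {y : ℝ} (hy0 : 0 ≤ y) (hy : y < 1) (k : ℕ) :
    HasSum (fun j : ℕ => (j : ℝ) * ((k + j).choose k : ℝ) * y ^ j)
      ((k + 1) * y / (1 - y) ^ (k + 2)) := by
  rw [← hasSum_nat_add_iff' 1]
  simp only [Finset.range_one, Finset.sum_singleton, Nat.cast_zero, zero_mul, sub_zero]
  have := (hasSum_choose_geom hy0 hy (k + 1)).mul_left (((k : ℝ) + 1) * y)
  have hfun : (fun j : ℕ => ((j + 1 : ℕ) : ℝ) * (Nat.choose (k + (j + 1)) k : ℝ) * y ^ (j + 1)) =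
      fun j : ℕ => ((k : ℝ) + 1) * y * ((Nat.choose (k + 1 + j) (k + 1) : ℝ) * y ^ j) := by
    ext j
    have h := Nat.choose_succ_right_eq (k + 1 + j) k
    rw [show k + 1 + j - k = j + 1 by omega] at h
    have h' : (Nat.choose (k + 1 + j) (k + 1) : ℝ) * (k + 1) =
        (Nat.choose (k + 1 + j) k : ℝ) * (j + 1) := by
      exact_mod_cast h
    rw [show k + (j + 1) = k + 1 + j by ring]
    push_cast
    rw [pow_succ]
    linear_combination (-y ^ j * y) * h'
  rw [hfun, show ((k : ℝ) + 1) * y / (1 - y) ^ (k + 2) =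
    ((k : ℝ) + 1) * y * (1 / (1 - y) ^ (k + 1 + 1)) by rw [mul_one_div]]
  exact this

theorem hasSum_mul_mul_choose_geom {y : ℝ} (hy0 : 0 ≤ y) (hy : y < 1) (k : ℕ) :
    HasSum (fun j : ℕ => (j : ℝ) * (j + 1) * ((k + j).choose k : ℝ) * y ^ j)
      ((k + 1) * (k + 2) * y ^ 2 / (1 - y) ^ (k + 3) + 2 * (k + 1) * y / (1 - y) ^ (k + 2)) := by
  rw [← hasSum_nat_add_iff' 1]
  simp only [Finset.range_one, Finset.sum_singleton, Nat.cast_zero, zero_mul, sub_zero]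
  have := ((hasSum_mul_choose_geom hy0 hy (k + 1)).add
    ((hasSum_choose_geom hy0 hy (k + 1)).mul_left 2)).mul_left (((k : ℝ) + 1) * y)
  have hfun : (fun j : ℕ => ((j + 1 : ℕ) : ℝ) * (((j + 1 : ℕ) : ℝ) + 1) *
        (Nat.choose (k + (j + 1)) k : ℝ) * y ^ (j + 1)) =
      fun j : ℕ => ((k : ℝ) + 1) * y * ((j : ℝ) * (Nat.choose (k + 1 + j) (k + 1) : ℝ) * y ^ j +
        2 * ((Nat.choose (k + 1 + j) (k + 1) : ℝ) * y ^ j)) := by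
    ext j
    have h := Nat.choose_succ_right_eq (k + 1 + j) k
    rw [show k + 1 + j - k = j + 1 by omega] at h
    have h' : (Nat.choose (k + 1 + j) (k + 1) : ℝ) * (k + 1) =
        (Nat.choose (k + 1 + j) k : ℝ) * (j + 1) := by
      exact_mod_cast h
    rw [show k + (j + 1) = k + 1 + j by ring]
    push_cast
    rw [pow_succ]
    linear_combination (-y ^ j * y * (j + 2)) * h'
  have hval : ((k : ℝ) + 1) * (k + 2) * y ^ 2 / (1 - y) ^ (k + 3) +
      2 * (k + 1) * y / (1 - y) ^ (k + 2) =
      ((k : ℝ) + 1) * y * ((((k + 1 : ℕ) : ℝ) + 1) * y / (1 - y) ^ (k + 1 + 2) +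
        2 * (1 / (1 - y) ^ (k + 1 + 1))) := by
    rw [show k + 1 + 2 = k + 3 by ring, show k + 1 + 1 = k + 2 by ring]
    push_cast
    ring
  rw [hfun, hval]
  exact this

open PowerSeries in
theorem LogRec.error_bound {θ y : ℝ} (hθ : 0 < θ) (hθ1 : θ ≤ 1) (hy0 : 0 < y) (hy : y < 1)
    (c : ℕ) {e : ℕ → ℝ} (he : ∀ k, |e (k + 1)| ≤ (c + 1) * y ^ (k + 1)) {s : ℝ⟦X⟧}
    (hs : LogRec (fun k => θ + e k) s) {n : ℕ} (hn : 1 ≤ n) :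
    |coeff n s / risingBinom θ n - Real.exp (∑' n, e (n + 1) / ((n : ℝ) + 1))| ≤
      ((c + 1) * (c + 2) * y ^ 2 / (1 - y) ^ (c + 3) + 2 * (c + 1) * y / (1 - y) ^ (c + 2)) / n
        + (c + n).choose c * y ^ n * (n / θ) := by
  set b : ℝ⟦X⟧ := PowerSeries.mk (risingBinom θ) with hb
  have hbr := logRec_risingBinom θ
  set f : ℝ⟦X⟧ := s * b⁻¹ with hf
  have hfr : LogRec e f := (hs.mul hbr.inv).congr fun k => by ring
  have hb1 : b⁻¹ * b = 1 :=
    PowerSeries.inv_mul_cancel _ (by simp [hb, risingBinom])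
  have hsf : s = f * b := by rw [hf, mul_assoc, hb1, mul_one]
  set w : ℕ → ℝ := fun j => (c + j).choose c * y ^ j with hw
  have hw0 : ∀ j, 0 ≤ w j := fun j => by simp only [hw]; positivity
  have hfw : ∀ j, |coeff j f| ≤ w j := fun j => by
    have := hfr.abs_coeff_le ((LogRec.geom y).pow (c + 1)) (fun k => by push_cast; exact he k) j
    rwa [LogRec.coeff_geom_pow] at this
  obtain ⟨ρ, hρ1, hρy⟩ : ∃ ρ, 1 < ρ ∧ ρ < 1 / y :=
    exists_between (by rw [lt_div_iff₀ hy0]; linarith)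
  have hρ0 : 0 < ρ := by linarith
  have hρy' : y * ρ < 1 := by rw [lt_div_iff₀ hy0] at hρy; linarith
  have hC := hfr.tsum_eq_exp ρ hρ1
    (by
      refine Summable.of_nonneg_of_le (fun n => by positivity) (fun n => ?_)
        ((summable_geometric_of_lt_one (by positivity) hρy').mul_left (((c : ℝ) + 1) * y))
      calc |e (n + 1)| * ρ ^ n ≤ ((c + 1) * y ^ (n + 1)) * ρ ^ n := by gcongr; exact he n
        _ = _ := by rw [mul_pow]; ring)
    (by
      refine Summable.of_nonneg_of_le (fun n => by positivity) (fun n => ?_)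
        (hasSum_mul_choose_geom (by positivity : 0 ≤ y * ρ) hρy' c).summable
      calc (n : ℝ) * |coeff n f| * ρ ^ (n - 1) ≤ n * w n * ρ ^ n := by
            gcongr
            · exact hfw n
            · exact hρ1.le
            · omega
        _ = _ := by simp only [hw]; rw [mul_pow]; ring)
  rw [← hC]
  have hn0 : (0 : ℝ) < n := by exact_mod_cast hn
  set B := risingBinom θ with hB
  have hBp : ∀ j, 0 < B j := risingBinom_pos hθ
  have hBanti := risingBinom_anti hθ hθ1
  set D : ℕ → ℝ := fun j => if j ≤ n then coeff j f * (B (n - j) / B n) else 0 with hD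
  have hDs : HasSum D (coeff n s / B n) := by
    have : coeff n s / B n = ∑ j ∈ Finset.range (n + 1), D j := by
      rw [hsf, PowerSeries.coeff_mul, Finset.Nat.sum_antidiagonal_eq_sum_range_succ_mk,
        Finset.sum_div]
      refine Finset.sum_congr rfl fun j hj => ?_
      have : j ≤ n := by simpa [Nat.lt_succ_iff] using hj
      simp [hD, this, hb, mul_div_assoc]
    rw [this]
    refine hasSum_sum_of_ne_finset_zero fun j hj => ?_
    have : ¬ j ≤ n := by simpa [Nat.lt_succ_iff] using hj
    simp [hD, this]
  have hws : Summable w := (hasSum_choose_geom hy0.le hy c).summable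
  have hfs : Summable fun j => coeff j f :=
    Summable.of_norm (Summable.of_nonneg_of_le (fun _ => norm_nonneg _) hfw hws)
  have h2 := (hDs.sub hfs.hasSum)
  rw [← h2.tsum_eq]
  have h3 : HasSum (fun j : ℕ => ((j : ℝ) * (j + 1) * (Nat.choose (c + j) c : ℝ) * y ^ j) / n +
      if j = n then w n * (n / θ) else 0) _ :=
    ((hasSum_mul_mul_choose_geom hy0.le hy c).div_const (n : ℝ)).add
      (hasSum_ite_eq n (w n * (n / θ)))
  rw [← Real.norm_eq_abs]
  refine tsum_of_norm_bounded h3 fun j => ?_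
  have hv : ((j : ℝ) * (j + 1) * (Nat.choose (c + j) c : ℝ) * y ^ j) / n =
      (j * (j + 1) / n) * w j := by simp only [hw]; ring
  rw [hv, Real.norm_eq_abs]
  rcases lt_trichotomy j n with h | h | h
  · have hle : j ≤ n := h.le
    simp only [hD, hle, if_true, h.ne, if_false, add_zero]
    rw [show coeff j f * (B (n - j) / B n) - coeff j f = (B (n - j) / B n - 1) * coeff j f by ring,
      abs_mul]
    refine mul_le_mul ?_ (hfw j) (abs_nonneg _) (by positivity)
    have h4 : 1 ≤ B (n - j) / B n := by
      rw [le_div_iff₀ (hBp n), one_mul]; exact hBanti (Nat.sub_le _ _)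
    rw [abs_of_nonneg (by linarith)]
    have h5 : ((n - j : ℕ) : ℝ) * B (n - j) ≤ n * B n :=
      mul_risingBinom_mono hθ (Nat.sub_le n j)
    rw [Nat.cast_sub hle] at h5
    have h6 : (1 : ℝ) ≤ n - j := by
      have : (j : ℝ) + 1 ≤ n := by exact_mod_cast h
      linarith
    have h7 : B (n - j) / B n ≤ n / (n - j) := by
      rw [div_le_div_iff₀ (hBp n) (by linarith)]
      linarith
    have h8 : (n : ℝ) / (n - j) ≤ 1 + j * (j + 1) / n := by
      have : (1 : ℝ) + j * (j + 1) / n = (n + j * (j + 1)) / n := by field_simp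
      rw [this, div_le_div_iff₀ (by linarith) hn0]
      have hj : (0 : ℝ) ≤ j := by positivity
      nlinarith [mul_nonneg (mul_nonneg hj hj) (by linarith : (0 : ℝ) ≤ n - j - 1),
        mul_nonneg hj (by linarith : (0 : ℝ) ≤ n - j - 1)]
    linarith
  · subst h
    simp only [hD, le_refl, if_true, Nat.sub_self]
    have hB0 : B 0 = 1 := by simp [hB, risingBinom]
    rw [hB0, show coeff j f * (1 / B j) - coeff j f = (1 / B j - 1) * coeff j f by ring, abs_mul]
    have h4 : 1 ≤ 1 / B j := by
      rw [le_div_iff₀ (hBp j), one_mul, ← hB0]; exact hBanti (Nat.zero_le _)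
    rw [abs_of_nonneg (by linarith)]
    have h5 : 1 / B j ≤ j / θ := by
      rw [div_le_div_iff₀ (hBp j) hθ]
      linarith [le_mul_risingBinom hθ hn]
    have h6 : (1 / B j - 1) * |coeff j f| ≤ (j / θ) * w j :=
      mul_le_mul (by linarith) (hfw j) (abs_nonneg _) (by positivity)
    have h7 : 0 ≤ (j * (j + 1) / j : ℝ) * w j := mul_nonneg (by positivity) (hw0 j)
    linarith
  · have hle : ¬ j ≤ n := by omega
    simp only [hD, hle, if_false, zero_sub, abs_neg, h.ne', add_zero]
    refine (hfw j).trans (le_mul_of_one_le_left (hw0 j) ?_)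
    rw [le_div_iff₀ hn0, one_mul]
    have : (n : ℝ) ≤ j := by exact_mod_cast h.le
    have hj : (0 : ℝ) ≤ j := by positivity
    nlinarith

theorem inv_one_sub_le_exp {y : ℝ} (hy0 : 0 ≤ y) (hy : 2 * y ^ 2 ≤ 1) :
    (1 - y)⁻¹ ≤ Real.exp (2 * y) := by
  have hy1 : y < 1 := by nlinarith
  rw [inv_le_iff_one_le_mul₀ (by linarith)]
  have h := Real.quadratic_le_exp_of_nonneg (by linarith : 0 ≤ 2 * y)
  have h1 : 1 ≤ (1 + 2 * y + (2 * y) ^ 2 / 2) * (1 - y) := by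
    nlinarith [mul_nonneg hy0 (by linarith : 0 ≤ 1 - 2 * y ^ 2)]
  exact h1.trans (mul_le_mul_of_nonneg_right h (by linarith))

theorem choose_mul_pow_le {s : ℝ} (hs0 : 0 < s) (hs : s < 1) (c n : ℕ) :
    ((c + n).choose c : ℝ) * s ^ n ≤ 1 / (1 - s) ^ (c + 1) :=
  le_hasSum (hasSum_choose_geom hs0.le hs c) n fun j _ => by positivity

theorem main_term_le {y : ℝ} (hy0 : 0 < y) (hy : 2 * y ^ 2 ≤ 1) (c : ℕ) :
    (c + 1) * (c + 2) * y ^ 2 / (1 - y) ^ (c + 3) + 2 * (c + 1) * y / (1 - y) ^ (c + 2) ≤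
      40 * Real.exp (3 * ((c + 2) * y)) * ((c + 2) * y) := by
  have hy1 : y ≤ 0.7072 := by nlinarith
  have hz : (0 : ℝ) < 1 - y := by linarith
  set z := (1 - y)⁻¹ with hzd
  have hz0 : 0 < z := by positivity
  have hz1 : z ≤ 3.42 := by
    rw [hzd, inv_le_comm₀ hz (by norm_num)]
    norm_num at hy1 ⊢
    linarith
  have hzc : z ^ (c + 1) ≤ Real.exp (2 * ((c + 1) * y)) := by
    calc z ^ (c + 1) ≤ Real.exp (2 * y) ^ (c + 1) :=
          pow_le_pow_left₀ hz0.le (inv_one_sub_le_exp hy0.le hy) _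
      _ = _ := by rw [← Real.exp_nat_mul]; push_cast; ring_nf
  set x : ℝ := (c + 2) * y with hx
  have hx0 : 0 < x := by positivity
  have hE : Real.exp (2 * ((c + 1) * y)) ≤ Real.exp (2 * x) := by
    apply Real.exp_le_exp.2
    rw [hx]; nlinarith
  have h1 : (c + 1) * (c + 2) * y ^ 2 / (1 - y) ^ (c + 3) + 2 * (c + 1) * y / (1 - y) ^ (c + 2) =
      z ^ (c + 1) * (((c + 1) * y) * (x * z ^ 2 + 2 * z)) := by
    rw [hzd, hx]
    simp only [inv_pow, div_eq_mul_inv, pow_add]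
    field_simp
  rw [h1]
  have h2 : x * z ^ 2 + 2 * z ≤ 40 * Real.exp x := by
    have := Real.add_one_le_exp x
    have hz2 : z ^ 2 ≤ 12 := by nlinarith
    nlinarith
  have h3 : ((c : ℝ) + 1) * y ≤ x := by rw [hx]; nlinarith
  calc z ^ (c + 1) * (((c + 1) * y) * (x * z ^ 2 + 2 * z))
      ≤ Real.exp (2 * x) * (x * (40 * Real.exp x)) := by
        gcongr
        exact hzc.trans hE
    _ = 40 * (Real.exp (2 * x) * Real.exp x) * x := by ring
    _ = _ := by rw [← Real.exp_add]; ring_nf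

theorem tail_term_le {s : ℝ} (hs0 : 0 < s) (hs : s ^ 4 ≤ 1 / 2) (d n : ℕ)
    (hn : 90 * d + 451 ≤ n) :
    ((d + 1 + n).choose (d + 1) : ℝ) * (s ^ 2) ^ n * (n * (s⁻¹ ^ 4) ^ d) ≤ 32 * s ^ 2 / n := by
  have hs1 : s ≤ 0.841 := by
    by_contra h
    push Not at h
    have : (0.841 : ℝ) ^ 4 < s ^ 4 := pow_lt_pow_left₀ h (by norm_num) (by norm_num)
    norm_num at this
    linarith
  have hs11 : s ^ 11 ≤ 1 - s := by
    have : s ^ 11 ≤ (0.841 : ℝ) ^ 11 := pow_le_pow_left₀ hs0.le hs1 11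
    norm_num at this hs1 ⊢
    linarith
  have hse : s ≤ Real.exp (-(1 / 6)) := by
    have := Real.add_one_le_exp (-(1/6) / 2 : ℝ)
    have h2 : Real.exp (-(1/6) : ℝ) = Real.exp (-(1/6) / 2 : ℝ) ^ 2 := by
      rw [← Real.exp_nat_mul]; norm_num
    rw [h2]
    have h3 : ((11 : ℝ) / 12) ^ 2 ≤ Real.exp (-(1/6) / 2 : ℝ) ^ 2 := by
      apply pow_le_pow_left₀ (by norm_num); linarith
    norm_num at h3 hs1 ⊢
    have h4 := Real.add_one_le_exp (-(1/6) / 8 : ℝ)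
    have h5 : Real.exp (-(1/6) / 2 : ℝ) = Real.exp (-(1/6) / 8 : ℝ) ^ 4 := by
      rw [← Real.exp_nat_mul]; norm_num
    have h6 : ((47 : ℝ) / 48) ^ 8 ≤ (Real.exp (-(1/6) / 8 : ℝ)) ^ 8 := by
      apply pow_le_pow_left₀ (by norm_num); linarith
    have h7 : Real.exp (-(1/6) / 2 : ℝ) ^ 2 = (Real.exp (-(1/6) / 8 : ℝ)) ^ 8 := by
      rw [h5]; ring
    norm_num at h6 h7
    linarith
  obtain ⟨M, hM⟩ : ∃ M, n = M + (15 * d + 24) := ⟨n - (15 * d + 24), by omega⟩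
  have hMn : 5 * n ≤ 6 * M := by omega
  have hn0 : (0 : ℝ) < n := by
    have : 0 < n := by omega
    exact_mod_cast this
  have h1 : ((d + 1 + n).choose (d + 1) : ℝ) * s ^ n ≤ (s⁻¹ ^ 11) ^ (d + 2) := by
    refine (choose_mul_pow_le hs0 (by norm_num at hs1; linarith) (d + 1) n).trans ?_
    rw [one_div, ← inv_pow]
    refine pow_le_pow_left₀ (by norm_num at hs1 ⊢; linarith) ?_ _
    rw [inv_pow]
    exact inv_anti₀ (by positivity) hs11
  have h2 : s ^ M ≤ Real.exp (-((M : ℝ) / 6)) := by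
    calc s ^ M ≤ Real.exp (-(1 / 6)) ^ M := pow_le_pow_left₀ hs0.le hse _
      _ = _ := by rw [← Real.exp_nat_mul]; ring_nf
  have h3 : (n : ℝ) ^ 2 * s ^ M ≤ 32 := by
    have h4 : ((M : ℝ) / 6) ^ 3 / 6 ≤ Real.exp ((M : ℝ) / 6) := by
      have := Real.pow_div_factorial_le_exp ((M : ℝ) / 6) (by positivity) 3
      simpa [Nat.factorial] using this
    have h5 : (5 / 6 * (n : ℝ)) ≤ M := by
      have : (5 : ℝ) * n ≤ 6 * M := by exact_mod_cast hMn
      linarith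
    have h6 : (5 / 6 * (n : ℝ)) ^ 3 ≤ (M : ℝ) ^ 3 := pow_le_pow_left₀ (by positivity) h5 3
    have h7 : (451 : ℝ) ≤ n := by
      have : 451 ≤ n := by omega
      exact_mod_cast this
    have h8 : (n : ℝ) ^ 2 ≤ 32 * Real.exp ((M : ℝ) / 6) := by
      have : (n : ℝ) ^ 2 * 451 ≤ n ^ 3 := by nlinarith
      nlinarith
    calc (n : ℝ) ^ 2 * s ^ M ≤ (32 * Real.exp ((M : ℝ) / 6)) * Real.exp (-((M : ℝ) / 6)) := by
          gcongr
      _ = 32 := by rw [mul_assoc, ← Real.exp_add]; simp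
  rw [le_div_iff₀ hn0]
  calc ((d + 1 + n).choose (d + 1) : ℝ) * (s ^ 2) ^ n * (n * (s⁻¹ ^ 4) ^ d) * n
      = (((d + 1 + n).choose (d + 1) : ℝ) * s ^ n) * (s ^ n * (n ^ 2 * (s⁻¹ ^ 4) ^ d)) := by
        rw [← pow_mul, mul_comm 2 n, pow_mul]; ring
    _ ≤ (s⁻¹ ^ 11) ^ (d + 2) * (s ^ n * (n ^ 2 * (s⁻¹ ^ 4) ^ d)) := by gcongr
    _ = (n ^ 2 * s ^ M) * s ^ 2 := by
        rw [show s ^ n = s ^ M * s ^ (15 * d + 24) by rw [hM, pow_add]]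
        have : (s⁻¹ ^ 11) ^ (d + 2) * (s⁻¹ ^ 4) ^ d * s ^ (15 * d + 24) = s ^ 2 := by
          rw [← pow_mul, ← pow_mul, ← pow_add, inv_pow, inv_mul_eq_div, div_eq_iff (by positivity),
            ← pow_add]
          congr 1; ring
        linear_combination (n ^ 2 * s ^ M) * this
    _ ≤ 32 * s ^ 2 := by gcongr

theorem numeric_bound (q d n : ℕ) (hq : 2 ≤ q) (hd : 1 ≤ d) (φ : ℝ)
    (hφ : φ ≤ (q : ℝ) ^ d)
    (hn : (n : ℝ) ≥ 1 + 5 * (6 * (d : ℝ) + 30) * Real.log (6 * (d : ℝ) + 30)) {y : ℝ}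
    (hy : y = 1 / Real.sqrt q) :
    ((((d + 1 : ℕ) : ℝ) + 1) * (((d + 1 : ℕ) : ℝ) + 2) * y ^ 2 / (1 - y) ^ (d + 1 + 3) +
        2 * (((d + 1 : ℕ) : ℝ) + 1) * y / (1 - y) ^ (d + 1 + 2)) / n +
      (Nat.choose (d + 1 + n) (d + 1) : ℝ) * y ^ n * (n / (1 / φ)) ≤
    48 * Real.exp (3 * ((d : ℝ) + 3) / Real.sqrt q) * ((d : ℝ) + 3) / (Real.sqrt q * n) := by
  have hq0 : (0 : ℝ) < q := by exact_mod_cast (by omega : 0 < q)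
  have hq2 : (2 : ℝ) ≤ q := by exact_mod_cast hq
  have hsq : 0 < Real.sqrt q := Real.sqrt_pos.2 hq0
  have hy0 : 0 < y := by rw [hy]; positivity
  have hyq : y ^ 2 = 1 / q := by rw [hy, div_pow, Real.sq_sqrt hq0.le]; simp
  have hy2 : 2 * y ^ 2 ≤ 1 := by
    rw [hyq, mul_one_div, div_le_one hq0]; exact hq2
  have hlog : (3 : ℝ) ≤ Real.log (6 * (d : ℝ) + 30) := by
    rw [Real.le_log_iff_exp_le (by positivity)]
    have h := Real.exp_one_lt_d9
    have h1 : Real.exp 3 = Real.exp 1 ^ 3 := by rw [← Real.exp_nat_mul]; norm_num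
    have h2 : Real.exp 1 ^ 3 ≤ (3 : ℝ) ^ 3 :=
      pow_le_pow_left₀ (Real.exp_pos _).le (by linarith) 3
    have : (0 : ℝ) ≤ d := by positivity
    linarith
  have hnn : 90 * d + 451 ≤ n := by
    have : (90 * (d : ℝ) + 451) ≤ n := by
      have h0 : (0 : ℝ) ≤ d := by positivity
      nlinarith
    exact_mod_cast this
  have hn0 : (0 : ℝ) < n := by exact_mod_cast (by omega : 0 < n)
  set s := Real.sqrt y with hs
  have hs0 : 0 < s := Real.sqrt_pos.2 hy0
  have hs2 : s ^ 2 = y := Real.sq_sqrt hy0.le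
  have hs4 : s ^ 4 = 1 / q := by rw [← hyq, ← hs2]; ring
  have hsi : s⁻¹ ^ 4 = q := by rw [inv_pow, hs4]; simp
  have hT := tail_term_le hs0 (by rw [hs4, div_le_div_iff₀ hq0 two_pos]; linarith) d n hnn
  rw [hsi, hs2] at hT
  have hM := main_term_le hy0 hy2 (d + 1)
  set x : ℝ := (((d + 1 : ℕ) : ℝ) + 2) * y with hx
  have hxe : x = ((d : ℝ) + 3) / Real.sqrt q := by
    rw [hx, hy]; push_cast; ring
  have hx4 : 4 * y ≤ x := by
    rw [hx]; push_cast
    have : (1 : ℝ) ≤ d := by exact_mod_cast hd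
    nlinarith
  have hT' : (Nat.choose (d + 1 + n) (d + 1) : ℝ) * y ^ n * (n / (1 / φ)) ≤
      8 * Real.exp (3 * x) * x / n := by
    have h1 : (Nat.choose (d + 1 + n) (d + 1) : ℝ) * y ^ n * (n / (1 / φ)) ≤ 32 * y / n := by
      refine le_trans ?_ hT
      rw [div_div_eq_mul_div, div_one]
      gcongr
    refine h1.trans ?_
    refine div_le_div_of_nonneg_right ?_ hn0.le
    have : 1 ≤ Real.exp (3 * x) := Real.one_le_exp (by linarith)
    nlinarith
  have hM' := div_le_div_of_nonneg_right hM hn0.le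
  refine (add_le_add hM' hT').trans (le_of_eq ?_)
  rw [mul_div_assoc 3, ← hxe, hxe]
  field_simp
  ring

/-- The equivalence between multiples `(k + 1)` of degrees and degree-power pairs. -/
def sigmaDvdEquiv {ι : Type*} (deg : ι → ℕ) (hdeg : ∀ P, 0 < deg P) :
    (Σ _ : ι, ℕ) ≃ Σ k : ℕ, {P : ι // deg P ∣ k + 1} where
  toFun p := ⟨deg p.1 * (p.2 + 1) - 1, p.1, by
    rw [Nat.sub_add_cancel (Nat.mul_pos (hdeg _) p.2.succ_pos)]; exact dvd_mul_right _ _⟩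
  invFun p := ⟨p.2.1, (p.1 + 1) / deg p.2.1 - 1⟩
  left_inv p := by
    have h : 1 ≤ deg p.1 * (p.2 + 1) := Nat.mul_pos (hdeg _) p.2.succ_pos
    have := Nat.mul_div_cancel_left (p.2 + 1) (hdeg p.1)
    ext
    · rfl
    · simp [Nat.sub_add_cancel h, this]
  right_inv p := by
    obtain ⟨k, P, c, hc⟩ := p
    have hc0 : 1 ≤ c := Nat.pos_of_ne_zero (by rintro rfl; simp at hc)
    have h1 : (k + 1) / deg P = c := by rw [hc, Nat.mul_div_cancel_left c (hdeg P)]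
    have h2 : deg P * ((k + 1) / deg P - 1 + 1) - 1 = k := by
      rw [h1, Nat.sub_add_cancel hc0, ← hc]; simp
    simp only
    refine Sigma.ext h2 ?_
    rw [Subtype.heq_iff_coe_eq]
    intro x
    simp only [h2]

theorem hasProd_inv_one_sub_pow {ι : Type*} (deg : ι → ℕ) (hdeg : ∀ P, 0 < deg P) (B : ℕ → ℝ)
    (hB : ∀ k, HasSum (fun P : {P : ι // deg P ∣ k + 1} => (deg P : ℝ)) (B (k + 1))) {u : ℝ}
    (hu0 : 0 < u) (hu1 : u < 1)
    (hs : Summable fun k : ℕ => B (k + 1) * u ^ (k + 1) / ((k : ℝ) + 1)) :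
    HasProd (fun P => (1 - u ^ deg P)⁻¹)
      (Real.exp (∑' k : ℕ, B (k + 1) * u ^ (k + 1) / ((k : ℝ) + 1))) := by
  set g : (Σ k : ℕ, {P : ι // deg P ∣ k + 1}) → ℝ :=
    fun p => (deg p.2.1 : ℝ) * (u ^ (p.1 + 1) / ((p.1 : ℝ) + 1)) with hg
  have hg0 : ∀ p, 0 ≤ g p := fun p => by positivity
  have hfib : ∀ k : ℕ, HasSum (fun P : {P : ι // deg P ∣ k + 1} => g ⟨k, P⟩)
      (B (k + 1) * u ^ (k + 1) / ((k : ℝ) + 1)) := fun k => by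
    rw [mul_div_assoc]
    exact (hB k).mul_right _
  have hgs : Summable g := by
    rw [summable_sigma_of_nonneg hg0]
    exact ⟨fun k => (hfib k).summable, hs.congr fun k => ((hfib k).tsum_eq).symm⟩
  have h1 : HasSum g (∑' k : ℕ, B (k + 1) * u ^ (k + 1) / ((k : ℝ) + 1)) := by
    have := hgs.hasSum
    have h2 := this.sigma hfib
    rwa [← h2.tsum_eq] at this
  have h3 : HasSum (g ∘ sigmaDvdEquiv deg hdeg) _ := ((sigmaDvdEquiv deg hdeg).hasSum_iff).2 h1
  have h4 : ∀ P : ι, HasSum (fun j : ℕ => (g ∘ sigmaDvdEquiv deg hdeg) ⟨P, j⟩)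
      (-Real.log (1 - u ^ deg P)) := fun P => by
    have hx : |u ^ deg P| < 1 := by
      rw [abs_of_pos (by positivity)]
      exact pow_lt_one₀ hu0.le hu1 (hdeg P).ne'
    have := Real.hasSum_pow_div_log_of_abs_lt_one hx
    have hfun : (fun j : ℕ => (g ∘ sigmaDvdEquiv deg hdeg) ⟨P, j⟩) =
        fun j : ℕ => (u ^ deg P) ^ (j + 1) / ((j : ℝ) + 1) := by
      ext j
      have h : 1 ≤ deg P * (j + 1) := Nat.mul_pos (hdeg _) j.succ_pos
      have hd : (deg P : ℝ) ≠ 0 := by exact_mod_cast (hdeg P).ne'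
      simp only [hg, Function.comp, sigmaDvdEquiv, Equiv.coe_fn_mk]
      rw [Nat.sub_add_cancel h, Nat.cast_sub h, pow_mul]
      push_cast
      rw [sub_add_cancel]
      field_simp
    rw [hfun]
    exact this
  have h5 := (h3.sigma h4).rexp
  have hfun : (Real.exp ∘ fun P => -Real.log (1 - u ^ deg P)) = fun P => (1 - u ^ deg P)⁻¹ := by
    ext P
    have : u ^ deg P < 1 := pow_lt_one₀ hu0.le hu1 (hdeg P).ne'
    rw [Function.comp, Real.exp_neg, Real.exp_log (by linarith)]
  rw [← hfun]
  exact h5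

theorem tendsto_one_sub_rpow_mul_tprod {ι : Type*} (deg : ι → ℕ) (hdeg : ∀ P, 0 < deg P)
    (B : ℕ → ℝ)
    (hB : ∀ k, HasSum (fun P : {P : ι // deg P ∣ k + 1} => (deg P : ℝ)) (B (k + 1)))
    {q θ y C : ℝ} (hq : 1 < q) (hy0 : 0 < y) (hy1 : y < 1)
    (he : ∀ k, |B (k + 1) / q ^ (k + 1) - θ| ≤ C * y ^ (k + 1)) :
    Filter.Tendsto (fun u : ℝ => (1 - q * u) ^ θ * ∏' P : ι, (1 - u ^ deg P)⁻¹)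
      (nhdsWithin q⁻¹ (Set.Iio q⁻¹))
      (nhds (Real.exp (∑' k : ℕ, (B (k + 1) / q ^ (k + 1) - θ) / ((k : ℝ) + 1)))) := by
  have hq0 : 0 < q := by linarith
  set e : ℕ → ℝ := fun k => B (k + 1) / q ^ (k + 1) - θ with hee
  have hys : Summable fun k : ℕ => C * y ^ (k + 1) :=
    ((summable_geometric_of_lt_one hy0.le hy1).mul_left (C * y)).congr fun k => by ring
  have hbound : ∀ (k : ℕ) (x : ℝ), 0 ≤ x → x ≤ 1 →
      ‖e k * x ^ (k + 1) / ((k : ℝ) + 1)‖ ≤ C * y ^ (k + 1) := fun k x hx0 hx1 => by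
    rw [Real.norm_eq_abs, abs_div, abs_mul, abs_of_nonneg (by positivity : 0 ≤ x ^ (k + 1)),
      abs_of_pos (by positivity : (0 : ℝ) < (k : ℝ) + 1)]
    have h1 : |e k| * x ^ (k + 1) ≤ |e k| :=
      mul_le_of_le_one_right (abs_nonneg _) (pow_le_one₀ hx0 hx1)
    refine (div_le_self (by positivity) ?_).trans (h1.trans (he k))
    have : (0 : ℝ) ≤ k := by positivity
    linarith
  have hnear : ∀ᶠ u in nhdsWithin q⁻¹ (Set.Iio q⁻¹), 0 < u ∧ u < q⁻¹ := by
    filter_upwards [self_mem_nhdsWithin,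
      mem_nhdsWithin_of_mem_nhds (lt_mem_nhds (inv_pos.2 hq0))] with u h1 h2
    exact ⟨h2, h1⟩
  have hform : ∀ u, 0 < u → u < q⁻¹ → (1 - q * u) ^ θ * ∏' P : ι, (1 - u ^ deg P)⁻¹ =
      Real.exp (∑' k : ℕ, e k * (q * u) ^ (k + 1) / ((k : ℝ) + 1)) := fun u hu0 hu1 => by
    have hx0 : 0 < q * u := by positivity
    have hx1 : q * u < 1 := by
      rw [lt_inv_comm₀ hu0 hq0, ← one_div, lt_div_iff₀ hu0] at hu1; exact hu1
    have hu1' : u < 1 := hu1.trans (inv_lt_one_of_one_lt₀ hq)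
    have hes : Summable fun k : ℕ => e k * (q * u) ^ (k + 1) / ((k : ℝ) + 1) :=
      Summable.of_norm_bounded hys fun k => hbound k _ hx0.le hx1.le
    have hl : HasSum (fun k : ℕ => (q * u) ^ (k + 1) / ((k : ℝ) + 1))
        (-Real.log (1 - q * u)) :=
      Real.hasSum_pow_div_log_of_abs_lt_one (by rwa [abs_of_pos hx0])
    have hsum := hes.hasSum.add (hl.mul_left θ)
    have hfun : (fun k : ℕ => e k * (q * u) ^ (k + 1) / ((k : ℝ) + 1) +
        θ * ((q * u) ^ (k + 1) / ((k : ℝ) + 1))) =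
        fun k : ℕ => B (k + 1) * u ^ (k + 1) / ((k : ℝ) + 1) := by
      ext k
      simp only [hee]
      rw [mul_pow]
      have : q ^ (k + 1) ≠ 0 := by positivity
      field_simp
      ring
    rw [hfun] at hsum
    rw [(hasProd_inv_one_sub_pow deg hdeg B hB hu0 hu1' hsum.summable).tprod_eq, hsum.tsum_eq,
      Real.exp_add, Real.rpow_def_of_pos (by linarith)]
    rw [mul_comm, mul_assoc, ← Real.exp_add]
    simp [mul_comm]
  refine Filter.Tendsto.congr' (f₁ := fun u =>
    Real.exp (∑' k : ℕ, e k * (q * u) ^ (k + 1) / ((k : ℝ) + 1))) ?_ ?_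
  · filter_upwards [hnear] with u hu
    exact (hform u hu.1 hu.2).symm
  refine (Real.continuous_exp.tendsto _).comp ?_
  refine tendsto_tsum_of_dominated_convergence hys (fun k => ?_) ?_
  · have : Filter.Tendsto (fun u : ℝ => e k * (q * u) ^ (k + 1) / ((k : ℝ) + 1)) (nhds q⁻¹)
        (nhds (e k * (q * q⁻¹) ^ (k + 1) / ((k : ℝ) + 1))) :=
      Continuous.tendsto (by fun_prop) _
    rw [mul_inv_cancel₀ hq0.ne', one_pow, mul_one] at this
    exact this.mono_left nhdsWithin_le_nhds
  · filter_upwards [hnear] with u hu k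
    refine hbound k _ (by have := hu.1; positivity) ?_
    have := mul_le_mul_of_nonneg_left hu.2.le hq0.le
    rwa [mul_inv_cancel₀ hq0.ne'] at this

/-- Power sums with non-zero coefficients detect the size of their bases. -/
theorem norm_le_of_power_sum_bound (s : Finset ℂ) (c : ℂ → ℂ) (K : ℝ) {R : ℝ}
    (hR : 0 < R) (h : ∀ j : ℕ, 1 ≤ j → ‖∑ z ∈ s, c z * z ^ j‖ ≤ K * R ^ j) {z : ℂ} (hz : z ∈ s)
    (hcz : c z ≠ 0) : ‖z‖ ≤ R := by
  classical
  set P : Polynomial ℂ := ∏ w ∈ s.erase z, (Polynomial.X - Polynomial.C w) with hP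
  have hPz : P.eval z ≠ 0 := by
    rw [hP, Polynomial.eval_prod, Finset.prod_ne_zero_iff]
    intro w hw
    simp only [Polynomial.eval_sub, Polynomial.eval_X, Polynomial.eval_C]
    exact sub_ne_zero.2 (Finset.ne_of_mem_erase hw).symm
  have hPw : ∀ w ∈ s, w ≠ z → P.eval w = 0 := fun w hw hwz => by
    rw [hP, Polynomial.eval_prod]
    exact Finset.prod_eq_zero (Finset.mem_erase.2 ⟨hwz, hw⟩) (by simp)
  have key : ∀ j, ∑ k ∈ Finset.range (P.natDegree + 1),
      P.coeff k * ∑ w ∈ s, c w * w ^ (j + k) = c z * P.eval z * z ^ j := fun j => by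
    have h1 : ∀ w, ∑ k ∈ Finset.range (P.natDegree + 1), P.coeff k * (c w * w ^ (j + k)) =
        c w * P.eval w * w ^ j := fun w => by
      rw [Polynomial.eval_eq_sum_range, Finset.mul_sum, Finset.sum_mul]
      refine Finset.sum_congr rfl fun k _ => ?_
      rw [pow_add]; ring
    simp_rw [Finset.mul_sum]
    rw [Finset.sum_comm]
    simp_rw [h1]
    refine Finset.sum_eq_single_of_mem z hz fun w hw hwz => ?_
    rw [hPw w hw hwz]; ring
  set K' : ℝ := ∑ k ∈ Finset.range (P.natDegree + 1), ‖P.coeff k‖ * (K * R ^ k) with hK'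
  have hb : ∀ j : ℕ, 1 ≤ j → ‖c z * P.eval z‖ * ‖z‖ ^ j ≤ K' * R ^ j := fun j hj => by
    rw [← norm_pow, ← norm_mul, ← key j, hK', Finset.sum_mul]
    refine (norm_sum_le _ _).trans (Finset.sum_le_sum fun k _ => ?_)
    rw [norm_mul, mul_assoc, mul_assoc, ← pow_add]
    refine mul_le_mul_of_nonneg_left ?_ (norm_nonneg _)
    rw [add_comm k j]
    exact h _ (by omega)
  by_contra hcon
  push Not at hcon
  have hd : 0 < ‖c z * P.eval z‖ := norm_pos_iff.2 (mul_ne_zero hcz hPz)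
  have hx : 1 < ‖z‖ / R := by rwa [lt_div_iff₀ hR, one_mul]
  obtain ⟨j, hj⟩ := pow_unbounded_of_one_lt (K' / ‖c z * P.eval z‖) hx
  have hj' := hj.trans_le (pow_le_pow_right₀ hx.le (Nat.le_succ j))
  have := hb (j + 1) (by omega)
  rw [div_pow, div_lt_div_iff₀ hd (by positivity)] at hj'
  rw [Nat.succ_eq_add_one] at hj'
  linarith

/-- If negative power sums along multiples of `N` are `c q ^ (N j)` up to a square root error,
then every base has absolute value at most `√q`. -/
theorem norm_le_sqrt_of_power_sum (s : Multiset ℂ) {q : ℝ} (hq : 1 < q) {N : ℕ} (hN : 1 ≤ N)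
    (K : ℝ) {c : ℂ} (hc : ‖c‖ ≤ 1) (hc1 : c ≠ -1)
    (h : ∀ j : ℕ, 1 ≤ j →
      ‖-(s.map fun z => z ^ (N * j)).sum - c * (q : ℂ) ^ (N * j)‖ ≤ K * Real.sqrt q ^ (N * j))
    {z : ℂ} (hz : z ∈ s) : ‖z‖ ≤ Real.sqrt q := by
  classical
  have hq0 : 0 < q := by linarith
  set t : Multiset ℂ := s.map (· ^ N) with ht
  set X : ℂ := (q : ℂ) ^ N with hX
  have hzt : z ^ N ∈ t := Multiset.mem_map_of_mem _ hz
  set d : ℂ → ℂ := fun w => (t.count w : ℂ) + if w = X then c else 0 with hd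
  have hsum : ∀ j : ℕ, ∑ w ∈ insert X t.toFinset, d w * w ^ j =
      -(-(s.map fun z => z ^ (N * j)).sum - c * (q : ℂ) ^ (N * j)) := fun j => by
    simp only [hd, add_mul, Finset.sum_add_distrib, ite_mul, zero_mul]
    rw [Finset.sum_ite_eq' (insert X t.toFinset) X, if_pos (Finset.mem_insert_self _ _)]
    have h1 : ∑ w ∈ insert X t.toFinset, (t.count w : ℂ) * w ^ j = (t.map (· ^ j)).sum := by
      rw [Finset.sum_multiset_map_count]
      refine (Finset.sum_subset (Finset.subset_insert _ _) fun w _ hw => ?_).symm.trans ?_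
      · rw [Multiset.count_eq_zero_of_notMem (by simpa using hw)]; simp
      · exact Finset.sum_congr rfl fun w _ => by rw [nsmul_eq_mul]
    rw [h1, ht, Multiset.map_map]
    simp only [Function.comp_def, ← pow_mul, hX]
    ring
  have hdz : d (z ^ N) ≠ 0 := by
    have hcnt : 1 ≤ t.count (z ^ N) := Multiset.one_le_count_iff_mem.2 hzt
    simp only [hd]
    split_ifs with hw
    · intro h0
      have h1 : c = -(t.count (z ^ N) : ℂ) := by linear_combination h0
      rw [h1, norm_neg, Complex.norm_natCast] at hc
      have h2 : t.count (z ^ N) ≤ 1 := by exact_mod_cast hc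
      have h3 : t.count (z ^ N) = 1 := le_antisymm h2 hcnt
      rw [h3] at h1
      exact hc1 (by simpa using h1)
    · rw [add_zero]
      exact_mod_cast (by omega : t.count (z ^ N) ≠ 0)
  have hfin := norm_le_of_power_sum_bound (insert X t.toFinset) d K
    (R := Real.sqrt q ^ N) (pow_pos (Real.sqrt_pos.2 hq0) _) (fun j hj => by
      rw [hsum, norm_neg, ← pow_mul]; exact h j hj)
    (z := z ^ N) (Finset.mem_insert_of_mem (by simpa using hzt)) hdz
  rw [norm_pow] at hfin
  exact le_of_pow_le_pow_left₀ (by omega) (Real.sqrt_nonneg _) hfin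

section FunctionField

open Polynomial

section FixedPoints

variable (F k : Type*) [Field F] [Fintype F] [Field k] [Algebra F k]

/-- The points of `k` fixed by the `n`-th power of the Frobenius of `F`. -/
noncomputable def fixPts (n : ℕ) : Finset k :=
  open Classical in (X ^ (Fintype.card F ^ n) - X : k[X]).roots.toFinset

variable {F k}

theorem mem_fixPts {n : ℕ} (hn : n ≠ 0) {t : k} :
    t ∈ fixPts F k n ↔ t ^ (Fintype.card F ^ n) = t := by
  classical
  rw [fixPts, Multiset.mem_toFinset,
    mem_roots (FiniteField.X_pow_card_pow_sub_X_ne_zero k hn Fintype.one_lt_card)]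
  simp [IsRoot, sub_eq_zero]

variable (F k) in
theorem card_cast_eq_zero : (Fintype.card F : k) = 0 := by
  rw [← map_natCast (algebraMap F k), Nat.cast_card_eq_zero, map_zero]

theorem card_fixPts [IsAlgClosed k] {n : ℕ} (hn : n ≠ 0) :
    (fixPts F k n).card = Fintype.card F ^ n := by
  classical
  have hsep : (X ^ (Fintype.card F ^ n) - X : k[X]).Separable := by
    obtain ⟨p, hp⟩ := CharP.exists k
    refine galois_poly_separable p _ (dvd_pow ?_ hn)
    exact (CharP.cast_eq_zero_iff k p _).1 (card_cast_eq_zero F k)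
  rw [fixPts, Multiset.toFinset_card_of_nodup (nodup_roots hsep),
    ← (IsAlgClosed.splits _).natDegree_eq_card_roots,
    FiniteField.X_pow_card_pow_sub_X_natDegree_eq k hn Fintype.one_lt_card]

theorem mem_fixPts_iff_natDegree_dvd [Algebra.IsAlgebraic F k] {n : ℕ} (hn : n ≠ 0) {t : k} :
    t ∈ fixPts F k n ↔ (minpoly F t).natDegree ∣ n := by
  have ht : IsIntegral F t := Algebra.IsIntegral.isIntegral t
  rw [mem_fixPts hn, (minpoly.irreducible ht).natDegree_dvd_iff_dvd_X_pow_card_pow_sub_X,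
    minpoly.dvd_iff, Nat.card_eq_fintype_card]
  simp [sub_eq_zero]

theorem card_filter_minpoly_eq [IsAlgClosed k] [Algebra.IsAlgebraic F k] {P : F[X]}
    (hP : Irreducible P) (hPm : P.Monic) {n : ℕ} (hn : n ≠ 0) (hd : P.natDegree ∣ n)
    [DecidablePred fun t : k => minpoly F t = P] :
    ((fixPts F k n).filter fun t => minpoly F t = P).card = P.natDegree := by
  classical
  have hsep : P.Separable := PerfectField.separable_of_irreducible hP
  have h1 : ((fixPts F k n).filter fun t => minpoly F t = P) = (P.rootSet k).toFinset := by
    ext t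
    rw [Finset.mem_filter, Set.mem_toFinset, mem_rootSet_of_ne hP.ne_zero]
    constructor
    · rintro ⟨_, rfl⟩; exact minpoly.aeval _ _
    · intro h
      have := minpoly.eq_of_irreducible_of_monic hP h hPm
      rw [mem_fixPts_iff_natDegree_dvd hn, ← this]
      exact ⟨hd, rfl⟩
  rw [h1, Set.toFinset_card]
  exact card_rootSet_eq_natDegree hsep (IsAlgClosed.splits _)

end FixedPoints

section Monics

variable (F : Type*) [Field F] [Fintype F]

theorem finite_setOf_natDegree_le (n : ℕ) : {f : F[X] | f.natDegree ≤ n}.Finite := by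
  have : Finite (degreeLT F (n + 1)) := Finite.of_equiv _ (degreeLTEquiv F (n + 1)).symm.toEquiv
  refine Set.Finite.subset (Set.toFinite (degreeLT F (n + 1) : Set F[X])) fun f hf => ?_
  simp only [SetLike.mem_coe, mem_degreeLT]
  exact (degree_le_natDegree).trans_lt (by exact_mod_cast Nat.lt_succ_of_le hf)

/-- The monic polynomials of degree `n`. -/
noncomputable def monics (n : ℕ) : Finset F[X] :=
  ((finite_setOf_natDegree_le F n).subset (t := {f : F[X] | f.Monic ∧ f.natDegree = n})
    fun _ h => h.2.le).toFinset

/-- The monic irreducible polynomials of degree dividing `n`. -/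
noncomputable def primesDvd (n : ℕ) : Finset F[X] :=
  open Classical in (finite_setOf_natDegree_le F n).toFinset.filter
    fun P => P.Monic ∧ Irreducible P ∧ P.natDegree ∣ n

variable {F}

theorem mem_monics {n : ℕ} {f : F[X]} : f ∈ monics F n ↔ f.Monic ∧ f.natDegree = n := by
  simp [monics]

theorem mem_primesDvd {n : ℕ} (hn : n ≠ 0) {P : F[X]} :
    P ∈ primesDvd F n ↔ P.Monic ∧ Irreducible P ∧ P.natDegree ∣ n := by
  simp only [primesDvd, Finset.mem_filter, Set.Finite.mem_toFinset, Set.mem_ofPred_eq,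
    and_iff_right_iff_imp]
  exact fun h => Nat.le_of_dvd (Nat.pos_of_ne_zero hn) h.2.2

theorem sum_fixPts_minpoly {k : Type*} [Field k] [Algebra F k] [IsAlgClosed k]
    [Algebra.IsAlgebraic F k] {R : Type*} [CommRing R] (g : F[X] → R) {n : ℕ} (hn : n ≠ 0) :
    ∑ t ∈ fixPts F k n, g (minpoly F t) = ∑ P ∈ primesDvd F n, (P.natDegree : R) * g P := by
  classical
  rw [← Finset.sum_fiberwise_of_maps_to (s := fixPts F k n) (t := primesDvd F n)
    (g := fun t => minpoly F t)]
  · refine Finset.sum_congr rfl fun P hP => ?_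
    rw [mem_primesDvd hn] at hP
    rw [Finset.sum_congr rfl (g := fun _ => g P)]
    · rw [Finset.sum_const, card_filter_minpoly_eq hP.2.1 hP.1 hn hP.2.2, nsmul_eq_mul]
    · intro t ht
      rw [(Finset.mem_filter.1 ht).2]
  · intro t ht
    have hi : IsIntegral F t := Algebra.IsIntegral.isIntegral t
    rw [mem_primesDvd hn]
    exact ⟨minpoly.monic hi, minpoly.irreducible hi, (mem_fixPts_iff_natDegree_dvd hn).1 ht⟩

theorem sum_count_mul_natDegree {f : F[X]} [DecidableEq F] (hf : f.Monic) :
    ∑ P ∈ (UniqueFactorizationMonoid.normalizedFactors f).toFinset,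
      (UniqueFactorizationMonoid.normalizedFactors f).count P * P.natDegree = f.natDegree := by
  have h1 := UniqueFactorizationMonoid.prod_normalizedFactors_eq (a := f) hf.ne_zero
  rw [hf.normalize_eq_self] at h1
  conv_rhs => rw [← h1]
  rw [natDegree_multiset_prod _ (by
    intro h; exact (UniqueFactorizationMonoid.irreducible_of_normalized_factor _ h).ne_zero rfl),
    Finset.sum_multiset_map_count]
  simp

end Monics

section

variable {F : Type*} [Field F] [Fintype F] {R : Type*} [CommRing R]

/-- The sum of a multiplicative function over monic polynomials of degree `n`. -/
noncomputable def monicSum (c : F[X] →* R) (n : ℕ) : R := ∑ f ∈ monics F n, c f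

/-- The weighted sum of a multiplicative function over prime powers of degree `n`. -/
noncomputable def primePowerSum (c : F[X] →* R) (n : ℕ) : R :=
  ∑ P ∈ primesDvd F n, (P.natDegree : R) * c P ^ (n / P.natDegree)

theorem monics_zero : monics F 0 = {1} := by
  ext f
  rw [mem_monics, Finset.mem_singleton]
  constructor
  · rintro ⟨h1, h2⟩; exact h1.natDegree_eq_zero.1 h2
  · rintro rfl; exact ⟨monic_one, natDegree_one⟩

theorem le_count_normalizedFactors_iff [DecidableEq F] {P f : F[X]} (hP : Irreducible P)
    (hPm : P.Monic) (hf : f ≠ 0) {e : ℕ} :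
    e ≤ (UniqueFactorizationMonoid.normalizedFactors f).count P ↔ P ^ e ∣ f := by
  rw [← ENat.natCast_le_natCast, pow_dvd_iff_le_emultiplicity,
    UniqueFactorizationMonoid.emultiplicity_eq_count_normalizedFactors hP hf,
    hPm.normalize_eq_self]

theorem logRec_monicSum (c : F[X] →* R) :
    LogRec (primePowerSum c) (PowerSeries.mk (monicSum c)) := by
  classical
  refine ⟨by simp [monicSum, monics_zero], fun n => ?_⟩
  simp only [PowerSeries.coeff_mk]
  have hL : ((n : R) + 1) * monicSum c (n + 1) =
      ∑ f ∈ monics F (n + 1), ∑ P ∈ (UniqueFactorizationMonoid.normalizedFactors f).toFinset,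
        ∑ _e ∈ Finset.Icc 1 ((UniqueFactorizationMonoid.normalizedFactors f).count P),
          (P.natDegree : R) * c f := by
    rw [monicSum, Finset.mul_sum]
    refine Finset.sum_congr rfl fun f hf => ?_
    rw [mem_monics] at hf
    have h := sum_count_mul_natDegree hf.1
    rw [hf.2] at h
    have h' : ((n : R) + 1) = ((n + 1 : ℕ) : R) := by push_cast; rfl
    rw [h', ← h]
    push_cast
    rw [Finset.sum_mul]
    refine Finset.sum_congr rfl fun P _ => ?_
    rw [Finset.sum_const, Nat.card_Icc, nsmul_eq_mul, Nat.add_sub_cancel, mul_assoc]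
  have hR : ∑ p ∈ Finset.HasAntidiagonal.antidiagonal n,
      primePowerSum c (p.1 + 1) * monicSum c p.2 =
      ∑ p ∈ Finset.HasAntidiagonal.antidiagonal n, ∑ P ∈ primesDvd F (p.1 + 1),
        ∑ g ∈ monics F p.2,
          (P.natDegree : R) * c (P ^ ((p.1 + 1) / P.natDegree) * g) := by
    refine Finset.sum_congr rfl fun p _ => ?_
    rw [primePowerSum, monicSum, Finset.sum_mul_sum]
    refine Finset.sum_congr rfl fun P _ => Finset.sum_congr rfl fun g _ => ?_
    rw [map_mul, map_pow, mul_assoc]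
  rw [hL, hR]
  simp only [Finset.sum_sigma']
  symm
  refine Finset.sum_bij'
    (fun x _ => ⟨x.2.1 ^ ((x.1.1 + 1) / x.2.1.natDegree) * x.2.2,
      ⟨x.2.1, (x.1.1 + 1) / x.2.1.natDegree⟩⟩)
    (fun y _ => ⟨(y.2.2 * y.2.1.natDegree - 1, n + 1 - y.2.2 * y.2.1.natDegree),
      ⟨y.2.1, y.1 /ₘ (y.2.1 ^ y.2.2)⟩⟩) ?_ ?_ ?_ ?_ ?_
  · rintro ⟨⟨i, l⟩, ⟨P, g⟩⟩ hx
    simp only [Finset.mem_sigma, Finset.HasAntidiagonal.mem_antidiagonal, mem_monics,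
      mem_primesDvd (Nat.add_one_ne_zero _), Finset.mem_Icc, Multiset.mem_toFinset] at hx ⊢
    obtain ⟨hil, ⟨hPm, hPi, e, he⟩, hgm, hgd⟩ := hx
    have hPd : 0 < P.natDegree := hPi.natDegree_pos
    have he' : (i + 1) / P.natDegree = e := by rw [he, Nat.mul_div_cancel_left _ hPd]
    have he1 : 1 ≤ e := Nat.pos_of_ne_zero (by rintro rfl; simp at he)
    rw [he']
    have hm : (P ^ e * g).Monic := (hPm.pow e).mul hgm
    refine ⟨⟨hm, ?_⟩, ?_, he1, ?_⟩
    · rw [(hPm.pow e).natDegree_mul hgm, hPm.natDegree_pow, hgd]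
      rw [mul_comm] at he
      omega
    · rw [← Multiset.one_le_count_iff_mem, le_count_normalizedFactors_iff hPi hPm hm.ne_zero,
        pow_one]
      exact (dvd_pow_self P (by omega)).mul_right g
    · rw [le_count_normalizedFactors_iff hPi hPm hm.ne_zero]
      exact dvd_mul_right _ _
  · rintro ⟨f, ⟨P, e⟩⟩ hy
    simp only [Finset.mem_sigma, Finset.HasAntidiagonal.mem_antidiagonal, mem_monics,
      mem_primesDvd (Nat.add_one_ne_zero _), Finset.mem_Icc, Multiset.mem_toFinset] at hy ⊢
    obtain ⟨⟨hfm, hfd⟩, hP, he1, hec⟩ := hy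
    have hPi := UniqueFactorizationMonoid.irreducible_of_normalized_factor P hP
    have hPm : P.Monic := by
      have := UniqueFactorizationMonoid.normalize_normalized_factor P hP
      rw [← this]; exact monic_normalize hPi.ne_zero
    rw [le_count_normalizedFactors_iff hPi hPm hfm.ne_zero] at hec
    have hle : e * P.natDegree ≤ n + 1 := by
      rw [← hfd, ← hPm.natDegree_pow]; exact natDegree_le_of_dvd hec hfm.ne_zero
    have hpos : 1 ≤ e * P.natDegree := Nat.mul_pos he1 hPi.natDegree_pos
    obtain ⟨g, rfl⟩ := hec
    have hgm : g.Monic := (hPm.pow e).of_mul_monic_left hfm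
    rw [mul_divByMonic_cancel_left _ (hPm.pow e)]
    rw [(hPm.pow e).natDegree_mul hgm, hPm.natDegree_pow] at hfd
    refine ⟨by omega, ⟨hPm, hPi, ?_⟩, hgm, by omega⟩
    rw [Nat.sub_add_cancel hpos]
    exact dvd_mul_left _ _
  · rintro ⟨⟨i, l⟩, ⟨P, g⟩⟩ hx
    simp only [Finset.mem_sigma, Finset.HasAntidiagonal.mem_antidiagonal, mem_monics,
      mem_primesDvd (Nat.add_one_ne_zero _)] at hx
    obtain ⟨hil, ⟨hPm, hPi, hdvd⟩, hgm, hgd⟩ := hx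
    simp only
    rw [Nat.div_mul_cancel hdvd, mul_divByMonic_cancel_left _ (hPm.pow _),
      Nat.add_sub_cancel, show n + 1 - (i + 1) = l by omega]
  · rintro ⟨f, ⟨P, e⟩⟩ hy
    simp only [Finset.mem_sigma, mem_monics, Finset.mem_Icc, Multiset.mem_toFinset] at hy
    obtain ⟨⟨hfm, hfd⟩, hP, he1, hec⟩ := hy
    have hPi := UniqueFactorizationMonoid.irreducible_of_normalized_factor P hP
    have hPm : P.Monic := by
      have := UniqueFactorizationMonoid.normalize_normalized_factor P hP
      rw [← this]; exact monic_normalize hPi.ne_zero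
    rw [le_count_normalizedFactors_iff hPi hPm hfm.ne_zero] at hec
    have hpos : 1 ≤ e * P.natDegree := Nat.mul_pos he1 hPi.natDegree_pos
    obtain ⟨g, rfl⟩ := hec
    simp only
    rw [Nat.sub_add_cancel hpos, Nat.mul_div_cancel _ hPi.natDegree_pos,
      mul_divByMonic_cancel_left _ (hPm.pow _)]
  · rintro ⟨⟨i, l⟩, ⟨P, g⟩⟩ _
    rfl

end

theorem LogRec.ext_left {K : Type*} [Field K] {g h : ℕ → K} {x : PowerSeries K}
    (hg : LogRec g x) (hh : LogRec h x) (k : ℕ) : g (k + 1) = h (k + 1) := by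
  rw [LogRec.iff_derivative] at hg hh
  have hx : x ≠ 0 := by
    rintro rfl
    simpa using hg.1
  have := mul_right_cancel₀ hx (hg.2.symm.trans hh.2)
  simpa using congrArg (PowerSeries.coeff k) this

theorem LogRec.one_sub_C_mul_X {K : Type*} [Field K] (α : K) :
    LogRec (fun k => -α ^ k) (1 - PowerSeries.C α * PowerSeries.X) := by
  have h : (1 - PowerSeries.C α * PowerSeries.X) = (PowerSeries.mk fun n => α ^ n)⁻¹ := by
    rw [PowerSeries.eq_inv_iff_mul_eq_one (by simp)]
    ext n
    rw [sub_mul, one_mul, mul_assoc]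
    cases n with
    | zero => simp
    | succ n => simp [PowerSeries.coeff_succ_X_mul, pow_succ, mul_comm, PowerSeries.coeff_one]
  rw [h]
  exact (LogRec.geom α).inv

theorem LogRec.multiset_prod {K : Type*} [Field K] (s : Multiset K) :
    LogRec (fun k => -(s.map fun α => α ^ k).sum)
      (s.map fun α => 1 - PowerSeries.C α * PowerSeries.X).prod := by
  induction s using Multiset.induction_on with
  | empty => simpa using LogRec.one
  | cons α s ih =>
    rw [Multiset.map_cons, Multiset.prod_cons]
    refine ((LogRec.one_sub_C_mul_X α).mul ih).congr fun k => ?_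
    rw [Multiset.map_cons, Multiset.sum_cons]
    ring

/-- A complex polynomial with constant term one is a product of factors `1 - α X`. -/
theorem exists_prod_one_sub (L : ℂ[X]) (h0 : L.coeff 0 = 1) :
    ∃ s : Multiset ℂ, s.card = L.natDegree ∧ (L : PowerSeries ℂ) =
      (s.map fun α => 1 - PowerSeries.C α * PowerSeries.X).prod := by
  have hLn : L.natTrailingDegree = 0 := natTrailingDegree_eq_zero.2 (Or.inr (by simp [h0]))
  have hr : L.reverse.reverse = L := by
    ext n
    rw [coeff_reverse, reverse_natDegree, hLn, Nat.sub_zero, coeff_reverse, revAt_invol]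
  have hm : L.reverse.Monic := by
    rw [Monic, reverse_leadingCoeff, trailingCoeff, hLn, h0]
  have hd : L.reverse.natDegree = L.natDegree := by
    rw [reverse_natDegree, hLn, Nat.sub_zero]
  have hs := IsAlgClosed.splits L.reverse
  refine ⟨L.reverse.roots, by rw [← hd, hs.natDegree_eq_card_roots], ?_⟩
  have hp : L.reverse = (L.reverse.roots.map fun a => X - C a).prod :=
    hs.eq_prod_roots_of_monic hm
  have hrev : ∀ t : Multiset ℂ, ((t.map fun a => X - C a).prod : ℂ[X]).reverse =
      (t.map fun a => 1 - C a * X).prod := fun t => by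
    induction t using Multiset.induction_on with
    | empty => simpa using reverse_C (1 : ℂ)
    | cons a t ih =>
      rw [Multiset.map_cons, Multiset.prod_cons, reverse_mul_of_domain, ih, Multiset.map_cons,
        Multiset.prod_cons]
      congr 1
      ext n
      rw [coeff_reverse, natDegree_X_sub_C]
      match n with
      | 0 => simp [revAt_le]
      | 1 => simp [revAt_le, coeff_one]
      | n + 2 =>
        rw [revAt_eq_self_of_lt (by omega)]
        simp [coeff_X, coeff_one]
  conv_lhs => rw [← hr, hp, hrev]
  rw [← coeToPowerSeries.ringHom_apply, map_multiset_prod, Multiset.map_map]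
  congr 1
  refine Multiset.map_congr rfl fun a _ => ?_
  simp

section

variable {F : Type*} [Field F] [Fintype F] {m : F[X]}

/-- The completely multiplicative function attached to a character modulo `m`. -/
noncomputable def charFun (χ : MulChar (F[X] ⧸ Ideal.span {m}) ℂ) : F[X] →* ℂ :=
  χ.toMonoidHom.comp (Ideal.Quotient.mk (Ideal.span {m})).toMonoidHom

theorem charFun_apply (χ : MulChar (F[X] ⧸ Ideal.span {m}) ℂ) (f : F[X]) :
    charFun χ f = χ (Ideal.Quotient.mk _ f) := rfl

theorem finite_quotient (hm : m.Monic) : Finite (F[X] ⧸ Ideal.span {m}) := by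
  refine Set.finite_univ_iff.1 (((finite_setOf_natDegree_le F m.natDegree).image
    (Ideal.Quotient.mk (Ideal.span {m}))).subset fun x _ => ?_)
  obtain ⟨f, rfl⟩ := Ideal.Quotient.mk_surjective x
  refine ⟨f %ₘ m, natDegree_modByMonic_le _ hm, ?_⟩
  rw [Ideal.Quotient.eq, Ideal.mem_span_singleton]
  exact ⟨-(f /ₘ m), by linear_combination modByMonic_add_div f m⟩

theorem monicSum_charFun_eq_zero (hm : m.Monic)
    {χ : MulChar (F[X] ⧸ Ideal.span {m}) ℂ} (hχ : χ ≠ 1) {n : ℕ} (hn : m.natDegree ≤ n) :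
    monicSum (charFun χ) n = 0 := by
  have := finite_quotient hm
  have := Fintype.ofFinite (F[X] ⧸ Ideal.span {m})
  have key : ∀ x : F[X] ⧸ Ideal.span {m},
      monicSum (charFun χ) n = ∑ f ∈ monics F n, χ (Ideal.Quotient.mk _ f + x) := fun x => by
    obtain ⟨g, rfl⟩ := Ideal.Quotient.mk_surjective x
    have hr : (Ideal.Quotient.mk (Ideal.span {m})) (g %ₘ m) = Ideal.Quotient.mk _ g := by
      rw [Ideal.Quotient.eq, Ideal.mem_span_singleton]
      exact ⟨-(g /ₘ m), by linear_combination modByMonic_add_div g m⟩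
    have hlt : (g %ₘ m).degree < (n : WithBot ℕ) :=
      (degree_modByMonic_lt _ hm).trans_le
        (degree_le_natDegree.trans (by exact_mod_cast hn))
    have hlt' : (-(g %ₘ m)).degree < (n : WithBot ℕ) := by rwa [degree_neg]
    have hadd : ∀ (r f : F[X]), r.degree < (n : WithBot ℕ) → f ∈ monics F n →
        f + r ∈ monics F n := fun r f hr hf => by
      rw [mem_monics] at hf ⊢
      have h1 : r.degree < f.degree := by
        rwa [degree_eq_natDegree hf.1.ne_zero, hf.2]
      exact ⟨hf.1.add_of_left h1, by rw [natDegree_add_eq_left_of_degree_lt h1, hf.2]⟩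
    rw [monicSum]
    refine Finset.sum_bij' (fun f _ => f + -(g %ₘ m)) (fun f _ => f + g %ₘ m)
      (fun f hf => hadd _ _ hlt' hf) (fun f hf => hadd _ _ hlt hf) (fun f _ => by ring)
      (fun f _ => by ring) (fun f _ => ?_)
    rw [charFun_apply, ← hr, ← map_add, neg_add_cancel_right]
  have hsum : (Fintype.card (F[X] ⧸ Ideal.span {m}) : ℂ) * monicSum (charFun χ) n = 0 := by
    rw [← nsmul_eq_mul, ← Finset.card_univ, ← Finset.sum_const,
      Finset.sum_congr rfl fun x _ => key x, Finset.sum_comm]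
    refine Finset.sum_eq_zero fun f _ => ?_
    rw [← MulChar.sum_eq_zero_of_ne_one hχ]
    exact Fintype.sum_equiv (Equiv.addLeft (Ideal.Quotient.mk _ f)) _ _ fun x => rfl
  have hc : (Fintype.card (F[X] ⧸ Ideal.span {m}) : ℂ) ≠ 0 := by
    exact_mod_cast Fintype.card_ne_zero
  exact (mul_eq_zero.1 hsum).resolve_left hc

theorem exists_primePowerSum_eq (hm : m.Monic) (hdeg : 0 < m.natDegree)
    {χ : MulChar (F[X] ⧸ Ideal.span {m}) ℂ} (hχ : χ ≠ 1) :
    ∃ s : Multiset ℂ, s.card + 1 ≤ m.natDegree ∧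
      ∀ k, primePowerSum (charFun χ) (k + 1) = -(s.map fun α => α ^ (k + 1)).sum := by
  have hL := logRec_monicSum (charFun χ)
  set L : ℂ[X] := ∑ i ∈ Finset.range m.natDegree, monomial i (monicSum (charFun χ) i) with hLd
  have hco : ∀ n, L.coeff n = monicSum (charFun χ) n := fun n => by
    rw [hLd, finsetSum_coeff]
    simp only [coeff_monomial]
    rw [Finset.sum_ite_eq' (Finset.range m.natDegree) n]
    split_ifs with h
    · rfl
    · rw [monicSum_charFun_eq_zero hm hχ (by simpa using h)]
  have hLs : (L : PowerSeries ℂ) = PowerSeries.mk (monicSum (charFun χ)) := by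
    ext n; simp [hco]
  have h0 : L.coeff 0 = 1 := by rw [hco]; simpa using hL.1
  obtain ⟨s, hs, hprod⟩ := exists_prod_one_sub L h0
  have hLdeg : L.natDegree < m.natDegree := by
    have : L.natDegree ≤ m.natDegree - 1 := natDegree_sum_le_of_forall_le _ _ fun i hi =>
      (natDegree_monomial_le _).trans (by have := Finset.mem_range.1 hi; omega)
    omega
  refine ⟨s, by omega, fun k => ?_⟩
  rw [← hLs, hprod] at hL
  exact hL.ext_left (LogRec.multiset_prod s) k

end

section WeightedDegree

variable {k : Type*} [Field k]

/-- Polynomials in two variables of weighted degree at most `l`, where the inner variable has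
weight one and the outer variable has weight `w`. -/
def wdegLE (k : Type*) [Field k] (w l : ℕ) : Submodule k k[X][X] where
  carrier := {f | ∀ i j, l < w * i + j → (f.coeff i).coeff j = 0}
  zero_mem' := by intro i j _; simp
  add_mem' := by
    intro f g hf hg i j h
    rw [coeff_add, coeff_add, hf i j h, hg i j h, add_zero]
  smul_mem' := by
    intro c f hf i j h
    rw [coeff_smul, coeff_smul, hf i j h, smul_zero]

theorem wdegLE_mono {w l l' : ℕ} (h : l ≤ l') : wdegLE k w l ≤ wdegLE k w l' :=
  fun _ hf i j hij => hf i j (h.trans_lt hij)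

theorem mul_mem_wdegLE {w l l' : ℕ} {f g : k[X][X]} (hf : f ∈ wdegLE k w l)
    (hg : g ∈ wdegLE k w l') : f * g ∈ wdegLE k w (l + l') := by
  intro n j h
  rw [coeff_mul, finsetSum_coeff]
  refine Finset.sum_eq_zero fun p hp => ?_
  rw [coeff_mul]
  refine Finset.sum_eq_zero fun s hs => ?_
  rw [Finset.HasAntidiagonal.mem_antidiagonal] at hp hs
  by_cases h1 : l < w * p.1 + s.1
  · rw [hf _ _ h1, zero_mul]
  · rw [hg p.2 s.2, mul_zero]
    rw [← hp, ← hs, mul_add] at h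
    omega

theorem one_mem_wdegLE (w l : ℕ) : (1 : k[X][X]) ∈ wdegLE k w l := by
  intro i j h
  rw [coeff_one]
  split_ifs with hi
  · rw [coeff_one, if_neg]
    rintro rfl
    simp [hi] at h
  · simp

theorem pow_mem_wdegLE {w l : ℕ} {f : k[X][X]} (hf : f ∈ wdegLE k w l) (n : ℕ) :
    f ^ n ∈ wdegLE k w (n * l) := by
  induction n with
  | zero => simpa using one_mem_wdegLE w 0
  | succ n ih => rw [pow_succ, add_mul, one_mul]; exact mul_mem_wdegLE ih hf

theorem C_mem_wdegLE {w l : ℕ} {c : k[X]} (h : c.natDegree ≤ l) :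
    (C c : k[X][X]) ∈ wdegLE k w l := by
  intro i j hij
  rw [coeff_C]
  split_ifs with hi
  · subst hi
    exact coeff_eq_zero_of_natDegree_lt (by omega)
  · simp

theorem X_mem_wdegLE (w : ℕ) : (X : k[X][X]) ∈ wdegLE k w w := by
  intro i j hij
  rw [coeff_X]
  split_ifs with hi
  · subst hi
    rw [coeff_one, if_neg]
    rintro rfl
    omega
  · simp

theorem exists_mem_wdegLE (w : ℕ) (f : k[X][X]) : ∃ l, f ∈ wdegLE k w l := by
  induction f using Polynomial.induction_on' with
  | add f g hf hg =>
    obtain ⟨l, hl⟩ := hf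
    obtain ⟨l', hl'⟩ := hg
    exact ⟨l + l', add_mem (wdegLE_mono (by omega) hl) (wdegLE_mono (by omega) hl')⟩
  | monomial n c =>
    refine ⟨c.natDegree + n * w, ?_⟩
    rw [← C_mul_X_pow_eq_monomial]
    exact mul_mem_wdegLE (C_mem_wdegLE le_rfl) (pow_mem_wdegLE (X_mem_wdegLE w) n)

/-- A monic polynomial is homogeneous-like for a suitable weight. -/
theorem exists_weight {μ : k[X][X]} (hμ : μ.Monic) :
    ∃ w, μ ∈ wdegLE k w (w * μ.natDegree) := by
  obtain ⟨l, hl⟩ := exists_mem_wdegLE 0 μ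
  refine ⟨l, fun i j hij => ?_⟩
  rcases lt_trichotomy i μ.natDegree with h | h | h
  · refine hl i j ?_
    obtain ⟨e, he⟩ := Nat.exists_eq_add_of_lt h
    rw [he] at hij
    nlinarith [Nat.zero_le (l * e)]
  · subst h
    rw [hμ.coeff_natDegree, coeff_one, if_neg (by omega)]
  · rw [coeff_eq_zero_of_natDegree_lt h, coeff_zero]

theorem X_pow_modByMonic_mem_wdegLE {μ : k[X][X]} (hμ : μ.Monic) (hr : 0 < μ.natDegree) {w : ℕ}
    (hw : μ ∈ wdegLE k w (w * μ.natDegree)) (n : ℕ) :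
    (X ^ n : k[X][X]) %ₘ μ ∈ wdegLE k w (w * n) := by
  have hμ1 : μ ≠ 1 := by rintro rfl; simp at hr
  induction n with
  | zero =>
    rw [pow_zero, (modByMonic_eq_self_iff hμ).2]
    · exact one_mem_wdegLE _ _
    · rw [degree_one]
      exact natDegree_pos_iff_degree_pos.1 hr
  | succ n ih =>
    set g := (X ^ n : k[X][X]) %ₘ μ with hg
    have hgd : g.natDegree < μ.natDegree := natDegree_modByMonic_lt _ hμ hμ1
    have e1 : (X ^ (n + 1) : k[X][X]) %ₘ μ = (X * g) %ₘ μ := by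
      rw [pow_succ', ← modByMonicHom_apply, ← modByMonicHom_apply, ← sub_eq_zero, ← map_sub,
        modByMonicHom_apply, modByMonic_eq_zero_iff_dvd hμ, ← mul_sub]
      refine Dvd.dvd.mul_left ⟨X ^ n /ₘ μ, ?_⟩ _
      linear_combination -modByMonic_add_div (X ^ n) μ
    set e := μ.natDegree - 1 with he
    have hre : μ.natDegree = e + 1 := by omega
    have e2 : (X * g) %ₘ μ = X * g - C (g.coeff e) * μ := by
      refine (div_modByMonic_unique (C (g.coeff e)) _ hμ ⟨by ring, ?_⟩).2
      have hle : (X * g - C (g.coeff e) * μ).natDegree ≤ e + 1 := by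
        refine (natDegree_sub_le _ _).trans (max_le ?_ ?_)
        · exact natDegree_mul_le.trans (by rw [natDegree_X]; omega)
        · exact (natDegree_C_mul_le _ _).trans hre.le
      rw [degree_eq_natDegree hμ.ne_zero, hre, degree_lt_iff_coeff_zero]
      intro i hi
      rcases hi.eq_or_lt with rfl | hi
      · have hc : μ.coeff (e + 1) = 1 := by rw [← hre]; exact hμ.coeff_natDegree
        rw [coeff_sub, coeff_X_mul, coeff_C_mul, hc]
        simp
      · exact coeff_eq_zero_of_natDegree_lt (hle.trans_lt hi)
    rw [e1, e2]
    refine sub_mem (wdegLE_mono (by rw [mul_add, mul_one, add_comm])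
      (mul_mem_wdegLE (X_mem_wdegLE w) ih)) ?_
    by_cases h0 : w * e ≤ w * n
    · refine wdegLE_mono ?_ (mul_mem_wdegLE (C_mem_wdegLE (l := w * n - w * e) ?_) hw)
      · rw [hre, mul_add, mul_add]; omega
      · refine natDegree_le_iff_coeff_eq_zero.2 fun j hj => ih e j (by omega)
    · have : g.coeff e = 0 := by
        ext j
        rw [coeff_zero]
        exact ih e j (by omega)
      rw [this]
      simp

theorem modByMonic_mem_wdegLE {μ : k[X][X]} (hμ : μ.Monic) (hr : 0 < μ.natDegree) {w : ℕ}
    (hw : μ ∈ wdegLE k w (w * μ.natDegree)) {l : ℕ} {f : k[X][X]} (hf : f ∈ wdegLE k w l) :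
    f %ₘ μ ∈ wdegLE k w l := by
  rw [f.as_sum_range_C_mul_X_pow, ← modByMonicHom_apply, map_sum]
  refine sum_mem fun i _ => ?_
  rw [← smul_eq_C_mul, map_smul, modByMonicHom_apply, smul_eq_C_mul]
  by_cases h : w * i ≤ l
  · refine wdegLE_mono (by omega) (mul_mem_wdegLE (C_mem_wdegLE (l := l - w * i) ?_)
      (X_pow_modByMonic_mem_wdegLE hμ hr hw i))
    exact natDegree_le_iff_coeff_eq_zero.2 fun j hj => hf i j (by omega)
  · have : f.coeff i = 0 := by
      ext j
      rw [coeff_zero]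
      exact hf i j (by omega)
    rw [this]
    simp

/-- The polynomials in two variables of degree less than `r` in the outer variable and less than
`L` in the inner one, in coordinates. -/
noncomputable def box (k : Type*) [Field k] (r L : ℕ) : (Fin r × Fin L → k) →ₗ[k] k[X][X] :=
  Fintype.linearCombination k fun p : Fin r × Fin L => monomial (p.1 : ℕ) (monomial (p.2 : ℕ) 1)

theorem box_eq_sum {r L : ℕ} (y : Fin r × Fin L → k) :
    box k r L y = ∑ p, monomial (p.1 : ℕ) (monomial (p.2 : ℕ) (y p)) := by
  rw [box, Fintype.linearCombination_apply]
  refine Finset.sum_congr rfl fun p _ => ?_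
  rw [smul_monomial, smul_monomial, smul_eq_mul, mul_one]

theorem coeff_box {r L : ℕ} (y : Fin r × Fin L → k) (p : Fin r × Fin L) :
    ((box k r L y).coeff p.1).coeff p.2 = y p := by
  rw [box_eq_sum, finsetSum_coeff, finsetSum_coeff, Finset.sum_eq_single p]
  · simp
  · intro s _ hs
    rw [coeff_monomial]
    split_ifs with h1
    · rw [coeff_monomial, if_neg]
      exact fun h2 => hs (Prod.ext (Fin.ext h1) (Fin.ext h2))
    · simp
  · simp

theorem box_injective (r L : ℕ) : Function.Injective (box k r L) := fun x y h => by
  funext p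
  rw [← coeff_box x, ← coeff_box y, h]

theorem degree_box_lt {r L : ℕ} (y : Fin r × Fin L → k) : (box k r L y).degree < (r : ℕ) := by
  rw [degree_lt_iff_coeff_zero]
  intro i hi
  rw [box_eq_sum, finsetSum_coeff]
  refine Finset.sum_eq_zero fun p _ => ?_
  rw [coeff_monomial, if_neg (by omega)]

theorem box_mem_wdegLE {r L : ℕ} (w : ℕ) (y : Fin r × Fin L → k) :
    box k r L y ∈ wdegLE k w (w * r + L) := by
  rw [box_eq_sum]
  refine sum_mem fun p _ => ?_
  rw [← C_mul_X_pow_eq_monomial]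
  refine wdegLE_mono ?_ (mul_mem_wdegLE (C_mem_wdegLE (natDegree_monomial_le _))
    (pow_mem_wdegLE (X_mem_wdegLE w) _))
  have := Nat.mul_le_mul_left w p.1.2.le
  have := p.2.2
  rw [mul_comm (p.1 : ℕ) w]
  omega

theorem exists_ne_zero_of_card_lt {ι κ : Type*} [Fintype ι] [Fintype κ]
    (h : Fintype.card κ < Fintype.card ι) (f : (ι → k) →ₗ[k] (κ → k)) : ∃ x ≠ 0, f x = 0 := by
  have := LinearMap.ker_ne_bot_of_finrank_lt (f := f) (by simpa using h)
  obtain ⟨x, hx, h0⟩ := Submodule.exists_mem_ne_zero_of_ne_bot this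
  exact ⟨x, h0, hx⟩

end WeightedDegree

section Orders

variable {k : Type*} [Field k]

/-- The list of coefficients of a polynomial in two variables at given positions. -/
noncomputable def coordMap {κ : Type*} (s : κ → ℕ × ℕ) : k[X][X] →ₗ[k] (κ → k) where
  toFun f p := (f.coeff (s p).1).coeff (s p).2
  map_add' f g := by ext p; simp
  map_smul' c f := by ext p; simp

/-- Reduction modulo `μ`, as a map linear over the base field. -/
noncomputable def reduceMap (μ : k[X][X]) : k[X][X] →ₗ[k] k[X][X] :=
  (modByMonicHom μ).restrictScalars k

variable {μ : k[X][X]} {lam : PowerSeries k}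

theorem aeval_modByMonic_of_root (h0 : aeval lam μ = 0) (f : k[X][X]) :
    aeval lam (f %ₘ μ) = aeval lam f := by
  conv_rhs => rw [← modByMonic_add_div f μ]
  simp [h0]

theorem order_coe_le_natDegree {p : k[X]} (hp : p ≠ 0) :
    (p : PowerSeries k).order ≤ (p.natDegree : ℕ∞) := by
  refine PowerSeries.order_le _ ?_
  rw [Polynomial.coeff_coe]
  exact leadingCoeff_ne_zero.2 hp

theorem order_aeval_le (hμ : μ.Monic) (hr : 0 < μ.natDegree) {w : ℕ}
    (hw : μ ∈ wdegLE k w (w * μ.natDegree)) (h0 : aeval lam μ = 0)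
    (hmin : ∀ c : k[X][X], c.degree < (μ.natDegree : ℕ) → aeval lam c = 0 → c = 0)
    {l : ℕ} {c : k[X][X]} (hc : c ∈ wdegLE k w l) (hcd : c.degree < (μ.natDegree : ℕ))
    (hc0 : c ≠ 0) :
    (aeval lam c).order ≤ ((μ.natDegree * (l + w * μ.natDegree + 1) : ℕ) : ℕ∞) := by
  obtain ⟨e, he⟩ : ∃ e, μ.natDegree = e + 1 := ⟨μ.natDegree - 1, by omega⟩
  set r := μ.natDegree with hrd
  set M := e * (l + w * r + 1) + 1 with hM
  set D := l + (w * r + M) with hD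
  have hμ1 : μ ≠ 1 := by intro h; rw [h] at hrd; simp at hrd; omega
  set f := coordMap (k := k) (fun p : Fin e × Fin (D + 1) => ((p.1 : ℕ) + 1, (p.2 : ℕ))) ∘ₗ
    reduceMap μ ∘ₗ LinearMap.mulLeft k c ∘ₗ box k r M with hf
  obtain ⟨y, hy0, hy⟩ := exists_ne_zero_of_card_lt (by
    simp only [Fintype.card_prod, Fintype.card_fin]
    rw [he, hD, hM]
    nlinarith) f
  have hs0 : box k r M y ≠ 0 := fun h => hy0 (box_injective r M (by rw [h, map_zero]))
  set s := box k r M y with hs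
  set g := (c * s) %ₘ μ with hg
  have hgw : g ∈ wdegLE k w D :=
    modByMonic_mem_wdegLE hμ hr hw (mul_mem_wdegLE hc (box_mem_wdegLE w y))
  have hgd : g.natDegree < e + 1 := he ▸ natDegree_modByMonic_lt _ hμ hμ1
  have hgC : g = C (g.coeff 0) := by
    ext i : 1
    rw [coeff_C]
    split_ifs with hi
    · rw [hi]
    · obtain ⟨i, rfl⟩ := Nat.exists_eq_succ_of_ne_zero hi
      by_cases h1 : i < e
      · ext j
        rw [coeff_zero]
        by_cases h2 : j < D + 1
        · exact congrFun hy (⟨i, h1⟩, ⟨j, h2⟩)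
        · exact hgw _ _ (by omega)
      · exact coeff_eq_zero_of_natDegree_lt (by omega)
  have hev : aeval lam g = aeval lam c * aeval lam s := by
    rw [hg, aeval_modByMonic_of_root h0, map_mul]
  have hne : aeval lam g ≠ 0 := by
    rw [hev]
    exact mul_ne_zero (fun h => hc0 (hmin c hcd h)) fun h => hs0 (hmin s (degree_box_lt y) h)
  have hgv : aeval lam g = (g.coeff 0 : PowerSeries k) := by
    rw [hgC, aeval_C, coeff_C_zero]
    rfl
  have hg0 : g.coeff 0 ≠ 0 := by
    intro h
    rw [hgv, h] at hne
    simp at hne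
  calc (aeval lam c).order ≤ (aeval lam g).order := by
        rw [hev, PowerSeries.order_mul]; exact le_self_add
    _ ≤ ((g.coeff 0).natDegree : ℕ∞) := by rw [hgv]; exact order_coe_le_natDegree hg0
    _ ≤ _ := by
      refine Nat.cast_le.2 ?_
      have : (g.coeff 0).natDegree ≤ D :=
        natDegree_le_iff_coeff_eq_zero.2 fun j hj => hgw 0 j (by omega)
      refine this.trans ?_
      rw [hD, hM]
      nth_rewrite 3 [he]
      nlinarith

/-- There are as many orders of vanishing as the dimension of the space of functions. -/
theorem exists_orders {ι : Type*} [Fintype ι] (f : (ι → k) →ₗ[k] PowerSeries k) {B : ℕ}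
    (hf : ∀ y ≠ 0, (f y).order ≤ (B : ℕ∞)) :
    ∃ O : Finset ℕ, Fintype.card ι ≤ O.card ∧ (∀ o ∈ O, o ≤ B) ∧
      ∃ y : ℕ → ι → k, ∀ o ∈ O, (f (y o)).order = (o : ℕ∞) := by
  classical
  set O := (Finset.range (B + 1)).filter fun o : ℕ => ∃ y, (f y).order = (o : ℕ∞) with hO
  refine ⟨O, ?_, fun o ho => ?_, ?_⟩
  · by_contra! hlt
    set g : (ι → k) →ₗ[k] (O → k) :=
      LinearMap.pi fun o => (PowerSeries.coeff (o : ℕ)) ∘ₗ f with hg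
    obtain ⟨y, hy0, hy⟩ := exists_ne_zero_of_card_lt (by simpa using hlt) g
    have h1 := hf y hy0
    have hne : f y ≠ 0 := by
      intro h
      rw [h, PowerSeries.order_zero] at h1
      simp at h1
    obtain ⟨o, ho⟩ := ENat.ne_top_iff_exists.1 (fun h => hne (PowerSeries.order_eq_top.1 h))
    have hoO : o ∈ O := by
      rw [hO, Finset.mem_filter, Finset.mem_range]
      refine ⟨?_, y, ho.symm⟩
      rw [← ho] at h1
      exact Nat.lt_succ_of_le (Nat.cast_le.1 h1)
    have h2 := congrFun hy ⟨o, hoO⟩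
    have h3 := (PowerSeries.order_eq_nat.1 ho.symm).1
    exact h3 h2
  · rw [hO, Finset.mem_filter, Finset.mem_range] at ho
    omega
  · have : ∀ o : ℕ, ∃ y, o ∈ O → (f y).order = (o : ℕ∞) := fun o => by
      by_cases h : o ∈ O
      · obtain ⟨y, hy⟩ := (Finset.mem_filter.1 h).2
        exact ⟨y, fun _ => hy⟩
      · exact ⟨0, fun h' => absurd h' h⟩
    choose y hy using this
    exact ⟨y, hy⟩

theorem sum_ne_zero_of_order_injOn {ι : Type*} (s : Finset ι) (f : ι → PowerSeries k)
    (hinj : ∀ i ∈ s, ∀ j ∈ s, f i ≠ 0 → f j ≠ 0 → (f i).order = (f j).order → i = j)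
    (hne : ∃ i ∈ s, f i ≠ 0) : ∑ i ∈ s, f i ≠ 0 := by
  classical
  obtain ⟨i₀, hi₀, h0⟩ := hne
  obtain ⟨i, hi, hmin⟩ := (s.filter fun i => f i ≠ 0).exists_min_image (fun i => (f i).order)
    ⟨i₀, by simp [hi₀, h0]⟩
  rw [Finset.mem_filter] at hi
  obtain ⟨o, ho⟩ := ENat.ne_top_iff_exists.1 (fun h => hi.2 (PowerSeries.order_eq_top.1 h))
  intro h
  have h1 := congrArg (PowerSeries.coeff o) h
  rw [map_sum, Finset.sum_eq_single i, map_zero] at h1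
  · exact (PowerSeries.order_eq_nat.1 ho.symm).1 h1
  · intro j hj hji
    by_cases hj0 : f j = 0
    · simp [hj0]
    refine PowerSeries.coeff_of_lt_order _ ?_
    refine lt_of_le_of_ne ?_ ?_
    · rw [ho]; exact hmin j (by simp [hj, hj0])
    · intro h2
      exact hji (hinj j hj i hi.1 hj0 hi.2 (by rw [← h2, ho]))
  · exact fun h => absurd hi.1 h

end Orders

section Stepanov

variable {k : Type*} [Field k] {μ : k[X][X]} {lam : PowerSeries k}

/-- A polynomial of small degree vanishing on a separable fibre vanishes on that fibre. -/
theorem coeff_eval_eq_zero_of_fibre [IsAlgClosed k] {t : k} (hμ : μ.Monic)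
    (hsep : (μ.map (evalRingHom t)).Separable) {g : k[X][X]} (hg : g.natDegree < μ.natDegree)
    (h : ∀ x, evalEval t x μ = 0 → evalEval t x g = 0) (i : ℕ) : (g.coeff i).eval t = 0 := by
  classical
  have hcard : (μ.map (evalRingHom t)).roots.toFinset.card = μ.natDegree := by
    rw [Multiset.toFinset_card_of_nodup (nodup_roots hsep),
      ← (IsAlgClosed.splits (μ.map (evalRingHom t))).natDegree_eq_card_roots, hμ.natDegree_map]
  have h1 : g.map (evalRingHom t) = 0 := by
    refine eq_zero_of_natDegree_lt_card_of_eval_eq_zero' _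
      (μ.map (evalRingHom t)).roots.toFinset (fun x hx => ?_)
      (by rw [hcard]; exact natDegree_map_le.trans_lt hg)
    rw [map_evalRingHom_eval]
    refine h x ?_
    rw [← map_evalRingHom_eval]
    exact (mem_roots'.1 (Multiset.mem_toFinset.1 hx)).2
  have h2 := congrArg (fun f => coeff f i) h1
  simpa using h2

theorem evalEval_box {r L : ℕ} (y : Fin r × Fin L → k) (t x : k) :
    evalEval t x (box k r L y) = ∑ p, y p * t ^ (p.2 : ℕ) * x ^ (p.1 : ℕ) := by
  rw [box_eq_sum, ← coe_evalEvalRingHom, map_sum]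
  refine Finset.sum_congr rfl fun p _ => ?_
  rw [← C_mul_X_pow_eq_monomial, ← C_mul_X_pow_eq_monomial, coe_evalEvalRingHom]
  simp only [evalEval_mul, evalEval_pow, evalEval_C, evalEval_X, eval_mul, eval_C, eval_pow, eval_X]

theorem stepanov_core [IsAlgClosed k] (p : ℕ) [ExpChar k p] (hμ : μ.Monic)
    (hr : 0 < μ.natDegree) {w : ℕ} (hw : μ ∈ wdegLE k w (w * μ.natDegree))
    (h0 : aeval lam μ = 0)
    (hmin : ∀ c : k[X][X], c.degree < (μ.natDegree : ℕ) → aeval lam c = 0 → c = 0)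
    {G : k[X][X]} {g : ℕ} (hG : G ∈ wdegLE k w g) (e : ℕ) {L L' : ℕ}
    (hL : μ.natDegree * (L + 2 * w * μ.natDegree + 1) < p ^ e)
    (hLL : p ^ e * (w * μ.natDegree + L) + (L' + μ.natDegree * g) + 1 <
      (μ.natDegree * L) * L')
    (Z : Finset k) (hZ : ∀ t ∈ Z, t ^ (p ^ e) ^ 2 = t ∧ (μ.map (evalRingHom t)).Separable ∧
      ∀ x, evalEval t x μ = 0 → x ^ (p ^ e) ^ 2 = evalEval t x G) :
    Z.card ≤ (w * μ.natDegree + L) + p ^ e * (w * μ.natDegree + L') := by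
  classical
  set r := μ.natDegree with hrd
  set P := p ^ e with hP
  have hμ1 : μ ≠ 1 := by intro h; rw [h] at hrd; simp at hrd; omega
  set ev : k[X][X] →ₗ[k] PowerSeries k :=
    (aeval lam : k[X][X] →ₐ[k[X]] PowerSeries k).toLinearMap.restrictScalars k with hev
  have hbox0 : ∀ {M : ℕ} (y : Fin r × Fin M → k), aeval lam (box k r M y) = 0 → y = 0 :=
    fun {M} y h => box_injective r M (by rw [map_zero]; exact hmin _ (degree_box_lt y) h)
  obtain ⟨O, hOc, hOB, y, hy⟩ := exists_orders (ev ∘ₗ box k r L)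
    (B := r * (w * r + L + w * r + 1)) fun y hy0 =>
      order_aeval_le hμ hr hw h0 hmin (box_mem_wdegLE w y) (degree_box_lt y)
        fun h => hy0 (box_injective r L (by rw [h, map_zero]))
  have hOP : ∀ o ∈ O, o < P := fun o ho => (hOB o ho).trans_lt (by
    refine lt_of_eq_of_lt ?_ hL
    ring)
  rw [Fintype.card_prod, Fintype.card_fin, Fintype.card_fin] at hOc
  set D := P * (w * r + L) + (L' + r * g) with hD
  set v : O × (Fin r × Fin L') → k[X][X] := fun s =>
    box k r L (y s.1) ^ P * (C (X ^ (s.2.2 : ℕ)) * G ^ (s.2.1 : ℕ)) with hv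
  have hvw : ∀ s, v s ∈ wdegLE k w D := fun s => by
    refine mul_mem_wdegLE (pow_mem_wdegLE (box_mem_wdegLE w _) _) ?_
    refine wdegLE_mono ?_ (mul_mem_wdegLE (C_mem_wdegLE (natDegree_X_pow_le _))
      (pow_mem_wdegLE hG _))
    have := Nat.mul_le_mul_right g s.2.1.2.le
    have := s.2.2.2
    omega
  obtain ⟨Y, hY0, hY⟩ := exists_ne_zero_of_card_lt (by
      simp only [Fintype.card_prod, Fintype.card_fin, Fintype.card_coe]
      calc r * (D + 1) < r * ((r * L) * L') := Nat.mul_lt_mul_of_pos_left hLL hr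
        _ = (r * L) * (r * L') := by ring
        _ ≤ O.card * (r * L') := Nat.mul_le_mul_right _ hOc)
    (coordMap (k := k) (fun s : Fin r × Fin (D + 1) => ((s.1 : ℕ), (s.2 : ℕ))) ∘ₗ
      reduceMap μ ∘ₗ Fintype.linearCombination k v)
  have hred : Fintype.linearCombination k v Y %ₘ μ = 0 := by
    have hgw : Fintype.linearCombination k v Y %ₘ μ ∈ wdegLE k w D := by
      refine modByMonic_mem_wdegLE hμ hr hw ?_
      rw [Fintype.linearCombination_apply]
      exact sum_mem fun s _ => Submodule.smul_mem _ _ (hvw s)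
    have hgd := natDegree_modByMonic_lt (Fintype.linearCombination k v Y) hμ hμ1
    ext i j
    rw [coeff_zero, coeff_zero]
    by_cases h1 : i < r
    · by_cases h2 : j < D + 1
      · exact congrFun hY (⟨i, h1⟩, ⟨j, h2⟩)
      · exact hgw _ _ (by omega)
    · rw [coeff_eq_zero_of_natDegree_lt (lt_of_lt_of_le hgd (not_lt.1 h1)), coeff_zero]
  have hP0 : 0 < P := pow_pos (expChar_pos k p) e
  choose z hz using fun s => IsAlgClosed.exists_pow_nat_eq (Y s) (n := P ^ 2) (by positivity)
  set f : O → k[X][X] := fun o => box k r L (y o) with hf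
  set s : O → k[X][X] := fun o => box k r L' (fun q => z (o, q)) with hs
  set h := ∑ o, f o * s o ^ P with hh
  have hne : aeval lam h ≠ 0 := by
    rw [hh, map_sum]
    have hfo : ∀ o : O, (aeval lam (f o)).order = ((o : ℕ) : ℕ∞) := fun o => hy o o.2
    have hf0 : ∀ o : O, aeval lam (f o) ≠ 0 := fun o h => by
      have := hfo o
      rw [h, PowerSeries.order_zero] at this
      exact ENat.natCast_ne_top _ this.symm
    refine sum_ne_zero_of_order_injOn _ _ (fun a _ b _ ha hb hab => ?_) ?_
    · rw [map_mul, map_pow] at ha hb hab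
      rw [map_mul, map_pow, PowerSeries.order_mul, PowerSeries.order_mul, PowerSeries.order_pow,
        PowerSeries.order_pow, hfo, hfo] at hab
      have hsa : aeval lam (s a) ≠ 0 := fun h => ha (by rw [h, zero_pow hP0.ne', mul_zero])
      have hsb : aeval lam (s b) ≠ 0 := fun h => hb (by rw [h, zero_pow hP0.ne', mul_zero])
      obtain ⟨i, hi⟩ := ENat.ne_top_iff_exists.1 (fun h => hsa (PowerSeries.order_eq_top.1 h))
      obtain ⟨j, hj⟩ := ENat.ne_top_iff_exists.1 (fun h => hsb (PowerSeries.order_eq_top.1 h))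
      rw [← hi, ← hj, nsmul_eq_mul, nsmul_eq_mul] at hab
      have hab' : (a : ℕ) + P * i = (b : ℕ) + P * j := by exact_mod_cast hab
      have := congrArg (· % P) hab'
      simp only [Nat.add_mul_mod_self_left, Nat.mod_eq_of_lt (hOP a a.2),
        Nat.mod_eq_of_lt (hOP b b.2)] at this
      exact Subtype.ext this
    · obtain ⟨⟨o, q⟩, hoq⟩ := Function.ne_iff.1 hY0
      refine ⟨o, Finset.mem_univ _, ?_⟩
      rw [map_mul, map_pow]
      refine mul_ne_zero (hf0 o) (pow_ne_zero _ fun h => hoq ?_)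
      have := congrFun (hbox0 _ h) q
      rw [← hz, this]
      simp [hP0.ne']
  have hvan : ∀ t ∈ Z, ∀ x, evalEval t x μ = 0 → evalEval t x h = 0 := fun t ht x hx => by
    obtain ⟨ht1, -, ht3⟩ := hZ t ht
    have hsum : evalEval t x (Fintype.linearCombination k v Y) = 0 := by
      obtain ⟨u, hu⟩ := (modByMonic_eq_zero_iff_dvd hμ).1 hred
      rw [hu, evalEval_mul, hx, zero_mul]
    have hpow : evalEval t x h ^ P = evalEval t x (Fintype.linearCombination k v Y) := by
      have hPs : ∀ {ι : Type _} (S : Finset ι) (c : ι → k),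
          (∑ i ∈ S, c i) ^ P = ∑ i ∈ S, c i ^ P := fun S c => sum_pow_char_pow p e S c
      have hQs : ∀ {ι : Type _} (S : Finset ι) (c : ι → k),
          (∑ i ∈ S, c i) ^ P ^ 2 = ∑ i ∈ S, c i ^ P ^ 2 := fun S c => by
        rw [hP, ← pow_mul]
        exact sum_pow_char_pow p _ S c
      rw [hh, Fintype.linearCombination_apply, ← coe_evalEvalRingHom, map_sum, map_sum, hPs,
        Fintype.sum_prod_type]
      refine Finset.sum_congr rfl fun o _ => ?_
      rw [map_mul, map_pow, mul_pow, ← pow_mul, ← pow_two, coe_evalEvalRingHom]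
      change _ * evalEval t x (box k r L' fun q => z (o, q)) ^ P ^ 2 = _
      rw [evalEval_box fun q => z (o, q), hQs, Finset.mul_sum]
      refine Finset.sum_congr rfl fun q _ => ?_
      rw [mul_pow, mul_pow, hz, pow_right_comm t, pow_right_comm x, ht1, ht3 x hx, hv]
      simp only [evalEval_smul, evalEval_mul, evalEval_pow, evalEval_C, eval_pow, eval_X,
        smul_eq_mul, hf]
      ring
    rw [hsum] at hpow
    exact eq_zero_of_pow_eq_zero hpow
  set G' := h %ₘ μ with hG'
  have hG'0 : G' ≠ 0 := fun h' => hne (by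
    rw [← aeval_modByMonic_of_root h0, ← hG', h', map_zero])
  have hG'd : G'.natDegree < r := natDegree_modByMonic_lt _ hμ hμ1
  have hG'w : G' ∈ wdegLE k w ((w * r + L) + P * (w * r + L')) := by
    refine modByMonic_mem_wdegLE hμ hr hw (sum_mem fun o _ => ?_)
    exact mul_mem_wdegLE (box_mem_wdegLE w _) (pow_mem_wdegLE (box_mem_wdegLE w _) _)
  have hi : G'.coeff G'.natDegree ≠ 0 := leadingCoeff_ne_zero.2 hG'0
  refine (Finset.card_le_card (t := (G'.coeff G'.natDegree).roots.toFinset) fun t ht => ?_).trans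
    ((Multiset.toFinset_card_le _).trans ((card_roots' _).trans
      (natDegree_le_iff_coeff_eq_zero.2 fun j hj => hG'w _ _ (by omega))))
  rw [Multiset.mem_toFinset, mem_roots hi]
  refine coeff_eval_eq_zero_of_fibre hμ (hZ t ht).2.1 hG'd (fun x hx => ?_) _
  have h1 := modByMonic_add_div h μ
  have h2 := congrArg (evalEval t x) h1
  rwa [evalEval_add, evalEval_mul, hx, zero_mul, add_zero, hvan t ht x hx] at h2

theorem stepanov_bound [IsAlgClosed k] (p : ℕ) [ExpChar k p] (hp : 1 < p) (hμ : μ.Monic)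
    (hr : 0 < μ.natDegree) (h0 : aeval lam μ = 0)
    (hmin : ∀ c : k[X][X], c.degree < (μ.natDegree : ℕ) → aeval lam c = 0 → c = 0)
    (G : k[X][X]) :
    ∃ K : ℕ, ∀ e ≠ 0, ∀ Z : Finset k,
      (∀ t ∈ Z, t ^ (p ^ e) ^ 2 = t ∧ (μ.map (evalRingHom t)).Separable ∧
        ∀ x, evalEval t x μ = 0 → x ^ (p ^ e) ^ 2 = evalEval t x G) →
      μ.natDegree * Z.card ≤ (p ^ e) ^ 2 + K * p ^ e := by
  classical
  obtain ⟨w, hw⟩ := exists_weight hμ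
  obtain ⟨g, hG⟩ := exists_mem_wdegLE w G
  obtain ⟨s, hs⟩ : ∃ s, s = w * μ.natDegree := ⟨_, rfl⟩
  obtain ⟨P0, hP0⟩ : ∃ P0, P0 = μ.natDegree * (2 * s + 3) * (s + 3) + s + 6 +
      μ.natDegree * g := ⟨_, rfl⟩
  refine ⟨μ.natDegree * P0 + (2 * (μ.natDegree * s) + 1 + μ.natDegree * (s + 4)),
    fun e he Z hZ => ?_⟩
  have hP1 : 1 < p ^ e := Nat.one_lt_pow he hp
  obtain ⟨r, hrd⟩ : ∃ r, r = μ.natDegree := ⟨_, rfl⟩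
  obtain ⟨P, hP⟩ : ∃ P, P = p ^ e := ⟨_, rfl⟩
  rw [← hP] at hP1
  by_cases hlt : P < P0
  · have hZc : Z.card ≤ P ^ 2 := by
      have hne : (X ^ P ^ 2 - X : k[X]) ≠ 0 :=
        FiniteField.X_pow_card_sub_X_ne_zero k (Nat.one_lt_pow two_ne_zero hP1)
      refine (Finset.card_le_card (t := (X ^ P ^ 2 - X : k[X]).roots.toFinset) fun t ht => ?_).trans
        ((Multiset.toFinset_card_le _).trans ((card_roots' _).trans
          (FiniteField.X_pow_card_sub_X_natDegree_eq k (Nat.one_lt_pow two_ne_zero hP1)).le))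
      rw [Multiset.mem_toFinset, mem_roots hne]
      simp [hP, (hZ t ht).1]
    rw [← hP, ← hrd]
    calc r * Z.card ≤ r * (P * P) := Nat.mul_le_mul_left _ (by rwa [← pow_two])
      _ ≤ r * (P0 * P) := by gcongr
      _ ≤ _ := by nlinarith [Nat.zero_le (P ^ 2), Nat.zero_le ((2 * (r * s) + 1 + r * (s + 4)) * P)]
  · push Not at hlt
    obtain ⟨u, hu⟩ : ∃ u, u = P / r := ⟨_, rfl⟩
    have hru : r * u ≤ P := hu ▸ Nat.mul_div_le P r
    have hru' : P < r * u + r := by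
      have := Nat.lt_mul_div_succ P (hrd ▸ hr)
      rwa [mul_add, mul_one, ← hu] at this
    rw [← hrd] at hs hP0 hr ⊢
    have hau : 2 * s + 2 ≤ u := by
      have h1 : r * (2 * s + 2) ≤ P := by nlinarith [Nat.zero_le (r * s * s), Nat.zero_le (r * s)]
      rw [hu, Nat.le_div_iff_mul_le hr, mul_comm]
      exact h1
    obtain ⟨L, hL⟩ := Nat.exists_eq_add_of_le hau
    have hbound := stepanov_core p hμ (hrd ▸ hr) hw h0 hmin hG e (L := L) (L' := u + s + 4) (by
      rw [← hrd, ← hP, mul_assoc, ← hs]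
      nlinarith) (by
      rw [← hrd, ← hP, ← hs]
      have h1 : r * L + r * (2 * s + 2) = r * u := by rw [hL]; ring
      have h2 : r * (u + s + 4) ≥ P + (s + 3) := by nlinarith
      have h3 : u ≤ P := by nlinarith
      calc P * (s + L) + (u + s + 4 + r * g) + 1 < L * P + (r * L) * (s + 3) := by
            have h4 : r * L + r * (2 * s + 3) ≥ P := by nlinarith
            have h5 : (r * L + r * (2 * s + 3)) * (s + 3) ≥ P * (s + 3) :=
              Nat.mul_le_mul_right _ h4
            nlinarith
        _ ≤ L * P + L * (r * (s + 3)) := by rw [mul_comm r L, mul_assoc]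
        _ ≤ L * (r * (u + s + 4)) := by
            rw [← mul_add]
            refine Nat.mul_le_mul_left _ ?_
            nlinarith
        _ = r * L * (u + s + 4) := by ring) Z hZ
    rw [← hrd, ← hP, ← hs] at hbound
    rw [← hP]
    calc r * Z.card ≤ r * (s + L + P * (s + (u + s + 4))) := Nat.mul_le_mul_left _ hbound
      _ = r * s + r * L + P * (2 * (r * s)) + P * (r * u) + P * (r * 4) := by ring
      _ ≤ r * s * P + 1 * P + P * (2 * (r * s)) + P * P + P * (r * 4) := by
        have h1 : r * L ≤ 1 * P := by
          rw [one_mul]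
          exact (Nat.mul_le_mul_left r (by omega)).trans hru
        have h2 : r * s ≤ r * s * P := Nat.le_mul_of_pos_right _ (by omega)
        have h3 : P * (r * u) ≤ P * P := Nat.mul_le_mul_left _ hru
        omega
      _ ≤ _ := by nlinarith [Nat.zero_le (r * P0 * P)]

end Stepanov

section Carlitz

variable {F : Type*} [Field F] [Fintype F] {B B' : Type*} [CommRing B] [Algebra F B]
  [CommRing B'] [Algebra F B']

/-- The `F`-linear operator `x ↦ x ^ q + τ x`. -/
noncomputable def carlitzEnd (F : Type*) [Field F] [Fintype F] {B : Type*} [CommRing B]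
    [Algebra F B] (τ : B) : Module.End F B :=
  (FiniteField.frobeniusAlgHom F B).toLinearMap + LinearMap.mulLeft F τ

theorem carlitzEnd_apply (τ x : B) : carlitzEnd F τ x = x ^ Fintype.card F + τ * x := by
  simp [carlitzEnd]

/-- The action of a polynomial on `B` through the Carlitz operator attached to `τ`. -/
noncomputable def carlitz (τ : B) (a : F[X]) : Module.End F B := aeval (carlitzEnd F τ) a

theorem carlitz_mul (τ : B) (a b : F[X]) (x : B) :
    carlitz τ (a * b) x = carlitz τ a (carlitz τ b x) := by simp [carlitz]

theorem carlitz_add (τ : B) (a b : F[X]) (x : B) :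
    carlitz τ (a + b) x = carlitz τ a x + carlitz τ b x := by simp [carlitz]

theorem carlitz_sub (τ : B) (a b : F[X]) (x : B) :
    carlitz τ (a - b) x = carlitz τ a x - carlitz τ b x := by simp [carlitz]

theorem carlitz_one (τ x : B) : carlitz τ (1 : F[X]) x = x := by simp [carlitz]

theorem carlitz_C (τ : B) (c : F) (x : B) : carlitz τ (C c) x = c • x := by
  simp [carlitz, Module.algebraMap_end_apply]

theorem carlitz_X (τ x : B) : carlitz τ (X : F[X]) x = x ^ Fintype.card F + τ * x := by
  simp [carlitz, carlitzEnd_apply]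

theorem map_carlitz (φ : B →+* B') (hφ : ∀ c, φ (algebraMap F B c) = algebraMap F B' c)
    (τ : B) (a : F[X]) (x : B) : φ (carlitz τ a x) = carlitz (φ τ) a (φ x) := by
  induction a using Polynomial.induction_on generalizing x with
  | C c => rw [carlitz_C, carlitz_C, Algebra.smul_def, Algebra.smul_def, map_mul, hφ]
  | add a b ha hb => rw [carlitz_add, carlitz_add, map_add, ha, hb]
  | monomial n c ih =>
    rw [pow_succ, ← mul_assoc, carlitz_mul τ (C c * X ^ n), carlitz_mul (φ τ) (C c * X ^ n), ih,
      carlitz_X, carlitz_X, map_add,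
      map_pow, map_mul]

/-- The generic value of the Carlitz action, as a polynomial. -/
noncomputable def carlitzPoly (τ : B) (a : F[X]) : B[X] := carlitz (C τ) a X

theorem eval_carlitzPoly (τ : B) (a : F[X]) (x : B) :
    (carlitzPoly τ a).eval x = carlitz τ a x := by
  rw [carlitzPoly, ← coe_evalRingHom, map_carlitz]
  · simp
  · intro c; simp [Polynomial.algebraMap_apply]

theorem map_carlitzPoly (φ : B →+* B') (hφ : ∀ c, φ (algebraMap F B c) = algebraMap F B' c)
    (τ : B) (a : F[X]) : (carlitzPoly τ a).map φ = carlitzPoly (φ τ) a := by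
  rw [carlitzPoly, carlitzPoly, ← coe_mapRingHom, map_carlitz]
  · simp
  · intro c; simp [Polynomial.algebraMap_apply, hφ]

theorem carlitzPoly_sum (τ : B) (a : F[X]) :
    carlitzPoly τ a =
      ∑ i ∈ Finset.range (a.natDegree + 1), a.coeff i • carlitzPoly τ (X ^ i : F[X]) := by
  conv_lhs => rw [a.as_sum_range_C_mul_X_pow]
  simp [carlitzPoly, carlitz]

theorem monic_carlitzPoly_X_pow [Nontrivial B] (τ : B) (n : ℕ) :
    (carlitzPoly τ (X ^ n : F[X])).Monic ∧
      (carlitzPoly τ (X ^ n : F[X])).natDegree = Fintype.card F ^ n := by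
  induction n with
  | zero => simp [carlitzPoly, carlitz_one, monic_X]
  | succ n ih =>
    have h : carlitzPoly τ (X ^ (n + 1) : F[X]) =
        carlitzPoly τ (X ^ n : F[X]) ^ Fintype.card F + C τ * carlitzPoly τ (X ^ n : F[X]) := by
      rw [carlitzPoly, pow_succ', carlitz_mul, carlitz_X, carlitzPoly]
    set f := carlitzPoly τ (X ^ n : F[X])
    have hd : (f ^ Fintype.card F).natDegree = Fintype.card F ^ (n + 1) := by
      rw [ih.1.natDegree_pow, ih.2, pow_succ']
    have hlt : (C τ * f).degree < (f ^ Fintype.card F).degree := by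
      rw [degree_eq_natDegree (ih.1.pow _).ne_zero, hd]
      refine (degree_le_of_natDegree_le ((natDegree_C_mul_le τ f).trans ih.2.le)).trans_lt ?_
      exact_mod_cast Nat.pow_lt_pow_right Fintype.one_lt_card (Nat.lt_succ_self n)
    rw [h]
    exact ⟨(ih.1.pow _).add_of_left hlt, by rw [natDegree_add_eq_left_of_degree_lt hlt, hd]⟩

theorem monic_carlitzPoly [Nontrivial B] (τ : B) {a : F[X]} (ha : a.Monic) :
    (carlitzPoly τ a).Monic ∧ (carlitzPoly τ a).natDegree = Fintype.card F ^ a.natDegree := by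
  rw [carlitzPoly_sum, Finset.sum_range_succ, ha.coeff_natDegree, one_smul, add_comm]
  obtain ⟨h1, h2⟩ := monic_carlitzPoly_X_pow (F := F) τ a.natDegree
  have hlt : (∑ i ∈ Finset.range a.natDegree, a.coeff i • carlitzPoly τ (X ^ i : F[X])).degree <
      (carlitzPoly τ (X ^ a.natDegree : F[X])).degree := by
    rw [degree_eq_natDegree h1.ne_zero, h2]
    refine (degree_sum_le _ _).trans_lt
      ((Finset.sup_lt_iff (WithBot.bot_lt_coe _)).2 fun i hi => ?_)
    refine (degree_smul_le _ _).trans_lt ?_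
    obtain ⟨h3, h4⟩ := monic_carlitzPoly_X_pow (F := F) τ i
    rw [degree_eq_natDegree h3.ne_zero, h4]
    exact_mod_cast Nat.pow_lt_pow_right Fintype.one_lt_card (Finset.mem_range.1 hi)
  exact ⟨h1.add_of_left hlt, by rw [natDegree_add_eq_left_of_degree_lt hlt, h2]⟩

theorem derivative_carlitz (τ : B) (a : F[X]) (f : B[X]) :
    derivative (carlitz (C τ) a f) = C (aeval τ a) * derivative f := by
  induction a using Polynomial.induction_on generalizing f with
  | C c =>
    rw [carlitz_C, aeval_C, derivative_smul, Algebra.smul_def, Polynomial.algebraMap_apply]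
  | add a b ha hb => rw [carlitz_add, derivative_add, ha, hb, map_add, C_add, add_mul]
  | monomial n c ih =>
    have h0 : (C ((Fintype.card F : ℕ) : B) : B[X]) = 0 := by
      rw [← map_natCast (algebraMap F B), Nat.cast_card_eq_zero, map_zero, C_0]
    rw [pow_succ, ← mul_assoc, carlitz_mul _ (C c * X ^ n), ih, carlitz_X, derivative_add,
      derivative_pow, derivative_C_mul, h0, map_mul _ (C c * X ^ n), aeval_X, C_mul]
    ring

theorem derivative_carlitzPoly (τ : B) (a : F[X]) :
    derivative (carlitzPoly τ a) = C (aeval τ a) := by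
  rw [carlitzPoly, derivative_carlitz, derivative_X, mul_one]

theorem separable_carlitzPoly {k : Type*} [Field k] [Algebra F k] {τ : k} {a : F[X]}
    (h : aeval τ a ≠ 0) : (carlitzPoly τ a).Separable := by
  rw [separable_def, derivative_carlitzPoly]
  exact ⟨0, C (aeval τ a)⁻¹, by rw [zero_mul, zero_add, ← C_mul, inv_mul_cancel₀ h, C_1]⟩

end Carlitz

section Frobenius

variable {F k : Type*} [Field F] [Fintype F] [Field k] [Algebra F k]

theorem pow_card_pow_injective (n : ℕ) :
    Function.Injective fun x : k => x ^ Fintype.card F ^ n := by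
  induction n with
  | zero => intro x y h; simpa using h
  | succ n ih =>
    intro x y h
    refine ih ?_
    have h1 : FiniteField.frobeniusAlgHom F k (x ^ Fintype.card F ^ n) =
        FiniteField.frobeniusAlgHom F k (y ^ Fintype.card F ^ n) := by
      simpa [FiniteField.frobeniusAlgHom_apply, ← pow_mul, ← pow_succ] using h
    exact (FiniteField.frobeniusAlgHom F k).toRingHom.injective h1

theorem add_pow_card_pow (x y : k) (n : ℕ) :
    (x + y) ^ Fintype.card F ^ n = x ^ Fintype.card F ^ n + y ^ Fintype.card F ^ n := by
  induction n with
  | zero => simp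
  | succ n ih =>
    rw [pow_succ, pow_mul, pow_mul, pow_mul, ih, ← FiniteField.frobeniusAlgHom_apply F k,
      map_add]
    simp [FiniteField.frobeniusAlgHom_apply]

theorem aeval_pow_card_pow (a : F[X]) (x : k) (n : ℕ) :
    aeval (x ^ Fintype.card F ^ n) a = (aeval x a) ^ Fintype.card F ^ n := by
  induction n with
  | zero => simp
  | succ n ih =>
    rw [pow_succ, pow_mul, pow_mul, ← ih, ← FiniteField.frobeniusAlgHom_apply F k,
      ← FiniteField.frobeniusAlgHom_apply F k, aeval_algHom_apply]

/-- The minimal polynomial over a finite field is the product over the Frobenius orbit. -/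
theorem map_minpoly_eq_prod {t : k} (ht : IsIntegral F t) :
    (minpoly F t).map (algebraMap F k) =
      ∏ i ∈ Finset.range (minpoly F t).natDegree, (X - C (t ^ Fintype.card F ^ i)) := by
  set D := (minpoly F t).natDegree with hD
  have hdvd : ∀ n, t ^ Fintype.card F ^ n = t → D ∣ n := fun n h => by
    rw [hD, (minpoly.irreducible ht).natDegree_dvd_iff_dvd_X_pow_card_pow_sub_X, minpoly.dvd_iff,
      Nat.card_eq_fintype_card]
    simp [h]
  have hinj : ∀ i j, i < j → j < D → t ^ Fintype.card F ^ i ≠ t ^ Fintype.card F ^ j := by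
    intro i j hij hj h
    obtain ⟨e, rfl⟩ := Nat.exists_eq_add_of_lt hij
    have h1 : t = t ^ Fintype.card F ^ (e + 1) := by
      refine pow_card_pow_injective (F := F) i ?_
      change t ^ _ = (t ^ _) ^ _
      rw [h, ← pow_mul, ← pow_add]
      congr 2
      omega
    have := Nat.le_of_dvd (by omega) (hdvd _ h1.symm)
    omega
  have hm : ((minpoly F t).map (algebraMap F k)).Monic := (minpoly.monic ht).map _
  refine eq_of_monic_of_dvd_of_natDegree_le (monic_prod_of_monic _ _ fun i _ => monic_X_sub_C _)
    hm ?_ ?_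
  · refine Finset.prod_dvd_of_coprime (fun i hi j hj hij => ?_) fun i _ => ?_
    · refine isCoprime_X_sub_C_of_isUnit_sub (IsUnit.mk0 _ (sub_ne_zero.2 ?_))
      rcases lt_or_gt_of_ne hij with h | h
      · exact hinj i j h (by simpa using hj)
      · exact (hinj j i h (by simpa using hi)).symm
    · rw [dvd_iff_isRoot, IsRoot, eval_map_algebraMap, aeval_pow_card_pow, minpoly.aeval,
        zero_pow (pow_pos Fintype.card_pos _).ne']
  · rw [natDegree_map, natDegree_prod_of_monic _ _ fun i _ => monic_X_sub_C _]
    simp only [natDegree_X_sub_C]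
    simp [hD]

/-- Substituting an operator for the variable, with coefficients acting on the left. -/
noncomputable def leftEval (T : ℕ → k) : k[X] →ₗ[k] k :=
  lsum fun i => LinearMap.mulRight k (T i)

theorem leftEval_monomial (T : ℕ → k) (n : ℕ) (c : k) : leftEval T (monomial n c) = c * T n := by
  rw [leftEval, lsum_apply, sum_monomial_index _ _ (by simp)]
  simp

theorem leftEval_mul_X (T : ℕ → k) (f : k[X]) :
    leftEval T (f * X) = leftEval (fun n => T (n + 1)) f := by
  induction f using Polynomial.induction_on' with
  | add f g hf hg => rw [add_mul, map_add, map_add, hf, hg]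
  | monomial n c => rw [monomial_mul_X, leftEval_monomial, leftEval_monomial]

theorem leftEval_map (t : k) (a : F[X]) (x : k) :
    leftEval (fun n => carlitz t (X ^ n : F[X]) x) (a.map (algebraMap F k)) = carlitz t a x := by
  induction a using Polynomial.induction_on' with
  | add f g hf hg => rw [Polynomial.map_add, map_add, hf, hg, carlitz_add]
  | monomial n c =>
    rw [map_monomial, leftEval_monomial, ← C_mul_X_pow_eq_monomial, carlitz_mul, carlitz_C,
      Algebra.smul_def]

theorem leftEval_prod (t : k) (x : k) (j : ℕ) :
    leftEval (fun n => carlitz t (X ^ n : F[X]) x)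
      (∏ i ∈ Finset.range j, (X - C (t ^ Fintype.card F ^ i))) = x ^ Fintype.card F ^ j := by
  induction j generalizing x with
  | zero =>
    rw [Finset.prod_range_zero, ← monomial_zero_one, leftEval_monomial]
    simp [carlitz_one]
  | succ j ih =>
    rw [Finset.prod_range_succ, mul_sub, map_sub, leftEval_mul_X, mul_comm _ (C _), ← smul_eq_C_mul,
      map_smul, ih]
    have : (fun n => carlitz t (X ^ (n + 1) : F[X]) x) =
        fun n => carlitz t (X ^ n : F[X]) (x ^ Fintype.card F + t * x) := by
      funext n
      rw [pow_succ, carlitz_mul, carlitz_X]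
    rw [this, ih, add_pow_card_pow, mul_pow, smul_eq_mul, ← pow_mul, ← pow_succ']
    ring

theorem carlitz_minpoly {t : k} (ht : IsIntegral F t) (x : k) :
    carlitz t (minpoly F t) x = x ^ Fintype.card F ^ (minpoly F t).natDegree := by
  rw [← leftEval_map, map_minpoly_eq_prod ht, leftEval_prod]

theorem carlitz_minpoly_pow {t : k} (ht : IsIntegral F t) (n : ℕ) (x : k) :
    carlitz t (minpoly F t ^ n) x = x ^ Fintype.card F ^ ((minpoly F t).natDegree * n) := by
  induction n with
  | zero => simp [carlitz_one]
  | succ n ih =>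
    rw [pow_succ', carlitz_mul, ih, carlitz_minpoly ht, ← pow_mul, ← pow_add, mul_add, mul_one]

theorem pow_eq_carlitz {t : k} (ht : IsIntegral F t) {n : ℕ} (hn : (minpoly F t).natDegree ∣ n)
    {a m : F[X]} (ha : m ∣ minpoly F t ^ (n / (minpoly F t).natDegree) - a) {x : k}
    (hx : carlitz t m x = 0) : x ^ Fintype.card F ^ n = carlitz t a x := by
  obtain ⟨b, hb⟩ := ha
  have h1 := carlitz_minpoly_pow ht (n / (minpoly F t).natDegree) x
  rw [Nat.mul_div_cancel' hn] at h1
  rw [← h1, ← sub_eq_zero, ← carlitz_sub, hb, mul_comm, carlitz_mul, hx, map_zero]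

end Frobenius

section Torsion

variable {F k : Type*} [Field F] [Fintype F] [Field k] [Algebra F k]

theorem finite_setOf_carlitz_eq_zero (t : k) {m : F[X]} (hm : m.Monic) :
    {x : k | carlitz t m x = 0}.Finite := by
  have h := (monic_carlitzPoly t hm).1.ne_zero
  refine ((carlitzPoly t m).rootSet_finite k).subset fun x hx => ?_
  rw [mem_rootSet]
  refine ⟨h, ?_⟩
  rw [coe_aeval_eq_eval, eval_carlitzPoly]
  exact hx

theorem ncard_setOf_carlitz_eq_zero_le (t : k) {m : F[X]} (hm : m.Monic) :
    {x : k | carlitz t m x = 0}.ncard ≤ Fintype.card F ^ m.natDegree := by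
  classical
  have h := (monic_carlitzPoly t hm).1.ne_zero
  rw [← (monic_carlitzPoly t hm).2]
  have : {x : k | carlitz t m x = 0} = ((carlitzPoly t m).roots.toFinset : Set k) := by
    ext x
    simp [h, IsRoot, eval_carlitzPoly]
  rw [this, Set.ncard_coe_finset]
  exact (Multiset.toFinset_card_le _).trans (card_roots' _)

theorem ncard_setOf_carlitz_eq_zero [IsAlgClosed k] {t : k} {m : F[X]} (hm : m.Monic)
    (ht : aeval t m ≠ 0) :
    {x : k | carlitz t m x = 0}.ncard = Fintype.card F ^ m.natDegree := by
  classical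
  have h := (monic_carlitzPoly t hm).1.ne_zero
  rw [← (monic_carlitzPoly t hm).2]
  have : {x : k | carlitz t m x = 0} = ((carlitzPoly t m).roots.toFinset : Set k) := by
    ext x
    simp [h, IsRoot, eval_carlitzPoly]
  rw [this, Set.ncard_coe_finset,
    Multiset.toFinset_card_of_nodup (nodup_roots (separable_carlitzPoly ht)),
    (IsAlgClosed.splits (carlitzPoly t m)).natDegree_eq_card_roots]

theorem dvd_of_forall_carlitz_eq_zero [IsAlgClosed k] {t : k} {m : F[X]} (hm : m.Monic)
    (ht : aeval t m ≠ 0) {b : F[X]} (hb : ∀ x : k, carlitz t m x = 0 → carlitz t b x = 0) :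
    m ∣ b := by
  rw [← modByMonic_eq_zero_iff_dvd hm]
  by_contra h0
  have hmon : (C (b %ₘ m).leadingCoeff⁻¹ * (b %ₘ m)).Monic := by
    rw [mul_comm]; exact monic_mul_leadingCoeff_inv h0
  have hdeg : (C (b %ₘ m).leadingCoeff⁻¹ * (b %ₘ m)).natDegree < m.natDegree := by
    rw [natDegree_C_mul (inv_ne_zero (leadingCoeff_ne_zero.2 h0))]
    exact natDegree_lt_natDegree h0 (degree_modByMonic_lt _ hm)
  have hsub : {x : k | carlitz t m x = 0} ⊆
      {x : k | carlitz t (C (b %ₘ m).leadingCoeff⁻¹ * (b %ₘ m)) x = 0} := by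
    intro x hx
    have hx' : carlitz t m x = 0 := hx
    have h1 : carlitz t (b %ₘ m) x = 0 := by
      rw [modByMonic_eq_sub_mul_div, mul_comm, carlitz_sub, carlitz_mul, hx', hb x hx, map_zero,
        sub_zero]
    change carlitz t _ x = 0
    rw [carlitz_mul, h1, map_zero]
  have h2 := Set.ncard_le_ncard hsub (finite_setOf_carlitz_eq_zero t hmon)
  have h3 := h2.trans (ncard_setOf_carlitz_eq_zero_le t hmon)
  rw [ncard_setOf_carlitz_eq_zero hm ht] at h3
  exact absurd h3 (not_le.2 (Nat.pow_lt_pow_right Fintype.one_lt_card hdeg))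

/-- The `m`-torsion of the Carlitz action at a point of good reduction is cyclic. -/
theorem exists_carlitz_eq_zero_iff [IsAlgClosed k] {t : k} {m : F[X]} (hm : m.Monic)
    (ht : aeval t m ≠ 0) : ∃ x : k, ∀ b : F[X], carlitz t b x = 0 ↔ m ∣ b := by
  set of := Module.AEval'.of (carlitzEnd F t)
  have hsmul : ∀ (b : F[X]) (x : k), b • of x = of (carlitz t b x) := fun b x => rfl
  let N := Submodule.torsionBy F[X] (Module.AEval' (carlitzEnd F t)) m
  have hN : ∀ x : k, of x ∈ N ↔ carlitz t m x = 0 := fun x => by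
    rw [Submodule.mem_torsionBy_iff, hsmul, map_eq_zero_iff _ of.injective]
  have hfin : Finite N := by
    have : (N : Set (Module.AEval' (carlitzEnd F t))).Finite := by
      refine ((finite_setOf_carlitz_eq_zero t hm).image of).subset fun y hy => ?_
      obtain ⟨x, rfl⟩ := of.surjective y
      exact ⟨x, (hN x).1 hy, rfl⟩
    exact this
  obtain ⟨⟨y, hy⟩, h⟩ := Module.exists_ker_toSpanSingleton_eq_annihilator F[X] N
  obtain ⟨x, rfl⟩ := of.surjective y
  refine ⟨x, fun b => ⟨fun hb => dvd_of_forall_carlitz_eq_zero hm ht fun z hz => ?_, ?_⟩⟩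
  · have h1 : b ∈ Module.annihilator F[X] N := by
      rw [← h, LinearMap.mem_ker, LinearMap.toSpanSingleton_apply]
      ext
      change b • of x = 0
      rw [hsmul, hb, map_zero]
    have h2 := Module.mem_annihilator.1 h1 ⟨of z, (hN z).2 hz⟩
    have h3 : b • of z = 0 := congrArg Subtype.val h2
    rwa [hsmul, map_eq_zero_iff _ of.injective] at h3
  · rintro ⟨c, rfl⟩
    rw [mul_comm, carlitz_mul, (hN x).1 hy, map_zero]

/-- The chosen point lifts to a power series. -/
theorem exists_powerSeries_carlitz_eq_zero {τ : PowerSeries k} {m : F[X]} (hm : m.Monic) {x : k}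
    (ht : aeval (PowerSeries.constantCoeff (R := k) τ) m ≠ 0)
    (hx : carlitz (PowerSeries.constantCoeff (R := k) τ) m x = 0) :
    ∃ lam : PowerSeries k, PowerSeries.constantCoeff (R := k) lam = x ∧ carlitz τ m lam = 0 := by
  have hφ : ∀ c, PowerSeries.constantCoeff (R := k) (algebraMap F (PowerSeries k) c) =
      algebraMap F k c := fun c => by
    rw [IsScalarTower.algebraMap_apply F k (PowerSeries k)]; simp
  have hI : ∀ f : PowerSeries k, f ∈ Ideal.span {(PowerSeries.X : PowerSeries k)} ↔
      PowerSeries.constantCoeff (R := k) f = 0 := fun f => by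
    rw [Ideal.mem_span_singleton, PowerSeries.X_dvd_iff]
  obtain ⟨lam, h1, h2⟩ := HenselianRing.is_henselian
    (I := Ideal.span {(PowerSeries.X : PowerSeries k)}) (carlitzPoly τ m)
    (monic_carlitzPoly τ hm).1 (PowerSeries.C x) (by
      rw [hI, eval_carlitzPoly, map_carlitz _ hφ, PowerSeries.constantCoeff_C, hx]) (by
      rw [derivative_carlitzPoly, eval_C]
      refine IsUnit.map _ ?_
      rw [PowerSeries.isUnit_iff_constantCoeff, isUnit_iff_ne_zero]
      have : PowerSeries.constantCoeff (R := k) (aeval τ m) =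
          aeval (PowerSeries.constantCoeff (R := k) τ) m := by
        rw [aeval_def, hom_eval₂, aeval_def]
        congr 1
      rwa [this])
  refine ⟨lam, ?_, ?_⟩
  · rw [hI, map_sub, PowerSeries.constantCoeff_C, sub_eq_zero] at h2
    exact h2
  · rw [IsRoot, eval_carlitzPoly] at h1
    exact h1

end Torsion

section Torsion

variable {F k : Type*} [Field F] [Fintype F] [Field k] [Algebra F k]

theorem not_separable_mul {K : Type*} [Field K] {f g h : K[X]} (hfg : f * g ∣ h)
    (hh : h.Separable) {y : K} (hf : f.eval y = 0) : g.eval y ≠ 0 := by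
  intro hg
  obtain ⟨a, b, hab⟩ := (hh.of_dvd hfg).isCoprime
  have := congrArg (eval y) hab
  simp [hf, hg] at this

theorem aeval_carlitzPoly (τ : k[X]) (b : F[X]) (x : PowerSeries k) :
    aeval x (carlitzPoly τ b) = carlitz (algebraMap k[X] (PowerSeries k) τ) b x := by
  rw [aeval_def, eval₂_eq_eval_map, map_carlitzPoly, eval_carlitzPoly]
  intro c
  rw [Polynomial.algebraMap_apply, IsScalarTower.algebraMap_apply F k (PowerSeries k)]
  exact Polynomial.coe_C _

theorem map_carlitzPoly_eval (t0 t : k) (b : F[X]) :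
    (carlitzPoly (X + C t0 : k[X]) b).map (evalRingHom t) = carlitzPoly (t + t0) b := by
  rw [map_carlitzPoly]
  · simp
  · intro c; simp [Polynomial.algebraMap_apply]

theorem evalEval_carlitzPoly (t0 t : k) (b : F[X]) (x : k) :
    evalEval t x (carlitzPoly (X + C t0 : k[X]) b) = carlitz (t + t0) b x := by
  rw [← map_evalRingHom_eval, map_carlitzPoly_eval, eval_carlitzPoly]

theorem evalEval_comp {R : Type*} [CommRing R] (t x : R) (p q : R[X][X]) :
    evalEval t x (p.comp q) = evalEval t (evalEval t x q) p := by
  rw [← map_evalRingHom_eval, ← map_evalRingHom_eval, ← map_evalRingHom_eval, Polynomial.map_comp,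
    eval_comp]

instance isTorsionFree_powerSeries : Module.IsTorsionFree k[X] (PowerSeries k) :=
  Module.isTorsionFree_iff_algebraMap_injective.2 (Polynomial.coe_injective k)

/-- Evaluation at a Frobenius-fixed point commutes with the Frobenius. -/
theorem evalEval_pow_card_pow {μ : k[X][X]} {n : ℕ} {t : k} (ht : t ^ Fintype.card F ^ n = t)
    (hμ : ∀ i j, ((μ.coeff i).coeff j) ^ Fintype.card F ^ n = (μ.coeff i).coeff j) (x : k) :
    evalEval t (x ^ Fintype.card F ^ n) μ = (evalEval t x μ) ^ Fintype.card F ^ n := by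
  let φ : k →+* k :=
    { toFun := fun x => x ^ Fintype.card F ^ n
      map_one' := one_pow _
      map_mul' := fun x y => mul_pow _ _ _
      map_zero' := zero_pow (pow_pos Fintype.card_pos _).ne'
      map_add' := fun x y => add_pow_card_pow (F := F) x y n }
  have h1 : μ.map (mapRingHom φ) = μ := by
    ext i j
    rw [coeff_map, coe_mapRingHom, coeff_map]
    exact hμ i j
  have h2 : φ (evalEval t x μ) = evalEval (φ t) (φ x) (μ.map (mapRingHom φ)) :=
    (map_mapRingHom_evalEval φ μ t x).symm
  rw [h1] at h2
  have h3 : φ t = t := ht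
  rw [h3] at h2
  exact h2.symm

section Minpoly

variable {t0 : k} {m : F[X]} {lam : PowerSeries k}

theorem carlitz_carlitz_eq_zero {τ : PowerSeries k} (hlam : carlitz τ m lam = 0) (b : F[X]) :
    carlitz τ m (carlitz τ b lam) = 0 := by
  rw [← carlitz_mul, mul_comm, carlitz_mul, hlam, map_zero]

theorem isIntegral_of_carlitz_eq_zero (hm : m.Monic)
    (hlam : carlitz (algebraMap k[X] (PowerSeries k) (X + C t0)) m lam = 0) :
    IsIntegral k[X] lam :=
  ⟨carlitzPoly (X + C t0) m, (monic_carlitzPoly _ hm).1, by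
    rw [← aeval_def, aeval_carlitzPoly, hlam]⟩

theorem minpoly_dvd_carlitzPoly (hm : m.Monic)
    (hlam : carlitz (algebraMap k[X] (PowerSeries k) (X + C t0)) m lam = 0) :
    minpoly k[X] lam ∣ carlitzPoly (X + C t0) m :=
  minpoly.isIntegrallyClosed_dvd (isIntegral_of_carlitz_eq_zero hm hlam) (by
    rw [aeval_carlitzPoly, hlam])

theorem separable_map_minpoly (hm : m.Monic)
    (hlam : carlitz (algebraMap k[X] (PowerSeries k) (X + C t0)) m lam = 0) {t : k}
    (ht : aeval (t + t0) m ≠ 0) : ((minpoly k[X] lam).map (evalRingHom t)).Separable := by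
  refine (separable_carlitzPoly ht).of_dvd ?_
  rw [← map_carlitzPoly_eval]
  exact Polynomial.map_dvd _ (minpoly_dvd_carlitzPoly hm hlam)

theorem carlitz_eq_zero_of_evalEval_minpoly (hm : m.Monic)
    (hlam : carlitz (algebraMap k[X] (PowerSeries k) (X + C t0)) m lam = 0) {t x : k}
    (hx : evalEval t x (minpoly k[X] lam) = 0) : carlitz (t + t0) m x = 0 := by
  obtain ⟨g, hg⟩ := minpoly_dvd_carlitzPoly hm hlam
  rw [← evalEval_carlitzPoly, hg, evalEval_mul, hx, zero_mul]

/-- If a Frobenius power acts as `a` at some point of good reduction, then `a` maps the chosen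
torsion point to one of its conjugates. -/
theorem aeval_carlitz_minpoly_eq_zero [IsAlgClosed k] (hm : m.Monic)
    (hlam : carlitz (algebraMap k[X] (PowerSeries k) (X + C t0)) m lam = 0) {n : ℕ} {t : k}
    (ht : t ^ Fintype.card F ^ n = t)
    (hμ : ∀ i j, (((minpoly k[X] lam).coeff i).coeff j) ^ Fintype.card F ^ n =
      ((minpoly k[X] lam).coeff i).coeff j)
    (hsep : aeval (t + t0) m ≠ 0) {a : F[X]}
    (ha : ∀ x : k, carlitz (t + t0) m x = 0 → x ^ Fintype.card F ^ n = carlitz (t + t0) a x) :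
    aeval (carlitz (algebraMap k[X] (PowerSeries k) (X + C t0)) a lam) (minpoly k[X] lam) = 0 := by
  have hzint := isIntegral_of_carlitz_eq_zero hm hlam
  set τ := algebraMap k[X] (PowerSeries k) (X + C t0) with hτ
  have hlam' := carlitz_carlitz_eq_zero hlam a
  have hzint' := isIntegral_of_carlitz_eq_zero hm hlam'
  set lam' := carlitz τ a lam with hl'
  obtain ⟨x, hx⟩ := IsAlgClosed.exists_root ((minpoly k[X] lam).map (evalRingHom t)) (by
    rw [(minpoly.monic hzint).degree_map]
    exact (minpoly.degree_pos hzint).ne')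
  rw [IsRoot, map_evalRingHom_eval] at hx
  have hxa := ha x (carlitz_eq_zero_of_evalEval_minpoly hm hlam hx)
  have h1 : evalEval t (carlitz (t + t0) a x) (minpoly k[X] lam) = 0 := by
    rw [← hxa, evalEval_pow_card_pow ht hμ, hx, zero_pow (pow_pos Fintype.card_pos _).ne']
  have h2 : evalEval t (carlitz (t + t0) a x) (minpoly k[X] lam') = 0 := by
    have : minpoly k[X] lam ∣ (minpoly k[X] lam').comp (carlitzPoly (X + C t0) a) := by
      refine minpoly.isIntegrallyClosed_dvd hzint ?_
      rw [aeval_comp, aeval_carlitzPoly]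
      exact minpoly.aeval _ _
    obtain ⟨g, hg⟩ := this
    have h3 := congrArg (evalEval t x) hg
    rwa [evalEval_mul, hx, zero_mul, evalEval_comp, evalEval_carlitzPoly] at h3
  suffices h : minpoly k[X] lam' = minpoly k[X] lam by rw [← h]; exact minpoly.aeval _ _
  obtain ⟨g, hg⟩ := minpoly_dvd_carlitzPoly hm hlam
  have hp := minpoly.prime_of_isIntegrallyClosed hzint'
  rcases hp.dvd_or_dvd (hg ▸ minpoly_dvd_carlitzPoly hm hlam') with h | h
  · exact eq_of_monic_of_associated (minpoly.monic hzint') (minpoly.monic hzint)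
      ((minpoly.irreducible hzint').associated_of_dvd (minpoly.irreducible hzint) h)
  · exfalso
    refine not_separable_mul (f := (minpoly k[X] lam).map (evalRingHom t))
      (g := (minpoly k[X] lam').map (evalRingHom t)) ?_ (separable_carlitzPoly hsep)
      (by rw [map_evalRingHom_eval]; exact h1) (by rw [map_evalRingHom_eval]; exact h2)
    rw [← map_carlitzPoly_eval, ← Polynomial.map_mul, hg]
    exact Polynomial.map_dvd _ (mul_dvd_mul_left _ h)

end Minpoly

end Torsion

theorem isUnit_mk_iff_isCoprime {R : Type*} [CommRing R] {m f : R} :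
    IsUnit (Ideal.Quotient.mk (Ideal.span {m}) f) ↔ IsCoprime f m := by
  constructor
  · intro h
    obtain ⟨y, hy⟩ := h.exists_right_inv
    obtain ⟨g, rfl⟩ := Ideal.Quotient.mk_surjective y
    rw [← map_mul, ← map_one (Ideal.Quotient.mk (Ideal.span {m})), Ideal.Quotient.eq,
      Ideal.mem_span_singleton] at hy
    obtain ⟨c, hc⟩ := hy
    exact ⟨g, -c, by linear_combination hc⟩
  · rintro ⟨g, c, h⟩
    refine IsUnit.of_mul_eq_one (Ideal.Quotient.mk _ g) ?_
    rw [← map_mul, ← map_one (Ideal.Quotient.mk (Ideal.span {m})), Ideal.Quotient.eq,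
      Ideal.mem_span_singleton]
    exact ⟨-c, by linear_combination h⟩

section Fibres

variable {F k : Type*} [Field F] [Fintype F] [Field k] [Algebra F k] [IsAlgClosed k]
  [Algebra.IsAlgebraic F k] {m : F[X]}

open scoped Classical in
/-- Points fixed by the `n`-th Frobenius power whose Frobenius class modulo `m` is `u`. -/
noncomputable def artinFibre (k : Type*) [Field k] [Algebra F k] (n : ℕ)
    (u : F[X] ⧸ Ideal.span {m}) : Finset k :=
  (fixPts F k n).filter fun t =>
    Ideal.Quotient.mk (Ideal.span {m}) (minpoly F t) ^ (n / (minpoly F t).natDegree) = u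

theorem mem_artinFibre {n : ℕ} {u : F[X] ⧸ Ideal.span {m}} {t : k} :
    t ∈ artinFibre k n u ↔ t ∈ fixPts F k n ∧
      Ideal.Quotient.mk (Ideal.span {m}) (minpoly F t) ^ (n / (minpoly F t).natDegree) = u := by
  simp [artinFibre]

theorem exists_pow_card_pow_eq (F : Type*) [Field F] [Fintype F] [Algebra F k]
    [Algebra.IsAlgebraic F k] (S : Finset k) :
    ∃ N ≠ 0, ∀ z ∈ S, ∀ j ≠ 0, z ^ Fintype.card F ^ (2 * N * j) = z := by
  refine ⟨∏ z ∈ S, (minpoly F z).natDegree, Finset.prod_ne_zero_iff.2 fun z _ =>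
    (minpoly.natDegree_pos (Algebra.IsIntegral.isIntegral z)).ne', fun z hz j hj => ?_⟩
  have h0 : 2 * (∏ z ∈ S, (minpoly F z).natDegree) * j ≠ 0 := by
    refine mul_ne_zero (mul_ne_zero two_ne_zero ?_) hj
    exact Finset.prod_ne_zero_iff.2 fun z _ =>
      (minpoly.natDegree_pos (Algebra.IsIntegral.isIntegral z)).ne'
  rw [← mem_fixPts h0, mem_fixPts_iff_natDegree_dvd h0]
  exact ((Finset.dvd_prod_of_mem _ hz).mul_left 2).mul_right j

theorem natDegree_minpoly_dvd {n : ℕ} (hn : n ≠ 0) {t : k} (ht : t ∈ fixPts F k n) :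
    (minpoly F t).natDegree ∣ n ∧ n / (minpoly F t).natDegree ≠ 0 := by
  have h := (mem_fixPts_iff_natDegree_dvd hn).1 ht
  refine ⟨h, (Nat.div_pos (Nat.le_of_dvd (Nat.pos_of_ne_zero hn) h)
    (minpoly.natDegree_pos (Algebra.IsIntegral.isIntegral t))).ne'⟩

theorem isUnit_artin_iff {n : ℕ} (hn : n ≠ 0) {t : k} (ht : t ∈ fixPts F k n) :
    IsUnit (Ideal.Quotient.mk (Ideal.span {m}) (minpoly F t) ^ (n / (minpoly F t).natDegree)) ↔
      aeval t m ≠ 0 := by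
  have hirr := minpoly.irreducible (Algebra.IsIntegral.isIntegral (R := F) t)
  rw [isUnit_pow_iff (natDegree_minpoly_dvd hn ht).2, isUnit_mk_iff_isCoprime,
    hirr.coprime_iff_not_dvd, minpoly.dvd_iff]

theorem aeval_ne_zero_of_mem_artinFibre {n : ℕ} (hn : n ≠ 0) {t : k}
    {u : F[X] ⧸ Ideal.span {m}} (hu : IsUnit u) (ht : t ∈ artinFibre k n u) : aeval t m ≠ 0 := by
  rw [mem_artinFibre] at ht
  rw [← isUnit_artin_iff hn ht.1, ht.2]
  exact hu

theorem card_filter_aeval_eq_zero_le (hm : m.Monic) (s : Finset k)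
    [DecidablePred fun t : k => aeval t m = 0] :
    (s.filter fun t => aeval t m = 0).card ≤ m.natDegree := by
  classical
  have h0 : m.map (algebraMap F k) ≠ 0 := (hm.map _).ne_zero
  calc _ ≤ (m.map (algebraMap F k)).roots.toFinset.card := by
        refine Finset.card_le_card fun t ht => ?_
        simpa [h0, hm.ne_zero] using (Finset.mem_filter.1 ht).2
    _ ≤ _ := Multiset.toFinset_card_le _
    _ ≤ _ := card_roots' _
    _ = _ := natDegree_map _

theorem exists_aeval_ne_zero (hm : m.Monic) : ∃ t : k, aeval t m ≠ 0 := by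
  obtain ⟨t, ht⟩ := (m.rootSet_finite k).infinite_compl.nonempty
  exact ⟨t, fun h => ht ((mem_rootSet_of_ne hm.ne_zero).2 h)⟩

theorem sum_card_artinFibre [Fintype (F[X] ⧸ Ideal.span {m})] (n : ℕ) :
    ∑ u : F[X] ⧸ Ideal.span {m}, (artinFibre k n u).card = (fixPts F k n).card := by
  classical
  unfold artinFibre
  exact (Finset.card_eq_sum_card_fiberwise fun _ _ => Finset.mem_coe.2 (Finset.mem_univ _)).symm

open scoped Classical in
theorem le_sum_card_artinFibre [Fintype (F[X] ⧸ Ideal.span {m})] (hm : m.Monic) {n : ℕ}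
    (hn : n ≠ 0) :
    Fintype.card F ^ n ≤ (∑ u : F[X] ⧸ Ideal.span {m} with IsUnit u, (artinFibre k n u).card) +
      m.natDegree := by
  rw [← card_fixPts (F := F) (k := k) hn, ← sum_card_artinFibre (m := m),
    ← Finset.sum_filter_add_sum_filter_not Finset.univ (fun u : F[X] ⧸ Ideal.span {m} => IsUnit u)]
  refine Nat.add_le_add_left ?_ _
  rw [← Finset.card_biUnion]
  · refine (Finset.card_le_card fun t ht => ?_).trans
      (card_filter_aeval_eq_zero_le hm (fixPts F k n))
    simp only [Finset.mem_biUnion, Finset.mem_filter, Finset.mem_univ, true_and,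
      mem_artinFibre] at ht
    obtain ⟨u, hu, ht, rfl⟩ := ht
    rw [isUnit_artin_iff hn ht, not_not] at hu
    exact Finset.mem_filter.2 ⟨ht, hu⟩
  · intro u _ v _ huv
    refine Finset.disjoint_left.2 fun t h1 h2 => huv ?_
    rw [mem_artinFibre] at h1 h2
    exact h1.2.symm.trans h2.2

theorem sum_mulChar_artinFibre [Fintype (F[X] ⧸ Ideal.span {m})]
    (χ : MulChar (F[X] ⧸ Ideal.span {m}) ℂ) {n : ℕ} (hn : n ≠ 0) :
    primePowerSum (charFun χ) n =
      ∑ u : F[X] ⧸ Ideal.span {m}, ((artinFibre k n u).card : ℂ) * χ u := by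
  classical
  rw [primePowerSum, ← sum_fixPts_minpoly (k := k)
    (fun P : F[X] => charFun χ P ^ (n / P.natDegree)) hn,
    ← Finset.sum_fiberwise (fixPts F k n) fun t =>
      Ideal.Quotient.mk (Ideal.span {m}) (minpoly F t) ^ (n / (minpoly F t).natDegree)]
  refine Finset.sum_congr rfl fun u _ => ?_
  rw [← nsmul_eq_mul, ← Finset.sum_const]
  unfold artinFibre
  refine Finset.sum_congr (by congr) fun t ht => ?_
  rw [← (Finset.mem_filter.1 ht).2, charFun_apply, map_pow]

/-- Equidistribution of Frobenius classes along a subset of the unit group, with square root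
error, by Stepanov's method. -/
theorem exists_card_artinFibre_le (k : Type*) [Field k] [Algebra F k] [IsAlgClosed k]
    [Algebra.IsAlgebraic F k] (hm : m.Monic) :
    ∃ N ≠ 0, ∃ K r : ℕ, ∃ H : Finset (F[X] ⧸ Ideal.span {m}), 1 ∈ H ∧ H.card ≤ r ∧
      ∀ j ≠ 0, ∀ u : F[X] ⧸ Ideal.span {m}, IsUnit u → (u ∉ H → artinFibre k (2 * N * j) u = ∅) ∧
        r * (artinFibre k (2 * N * j) u).card ≤
          (Fintype.card F ^ (N * j)) ^ 2 + K * Fintype.card F ^ (N * j) := by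
  classical
  have := finite_quotient hm
  have := Fintype.ofFinite (F[X] ⧸ Ideal.span {m})
  obtain ⟨t0, ht0⟩ := exists_aeval_ne_zero (F := F) (k := k) hm
  obtain ⟨x0, hx0⟩ := exists_carlitz_eq_zero_iff hm ht0
  set τ := algebraMap k[X] (PowerSeries k) (X + C t0) with hτ
  have hτ0 : PowerSeries.constantCoeff (R := k) τ = t0 := by
    change PowerSeries.constantCoeff ((X + C t0 : k[X]) : PowerSeries k) = t0
    simp
  obtain ⟨lam, hlam0, hlam⟩ := exists_powerSeries_carlitz_eq_zero (τ := τ) (x := x0) hm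
    (by rwa [hτ0]) (by rw [hτ0, hx0])
  have hann : ∀ b : F[X], carlitz τ b lam = 0 → m ∣ b := fun b hb => by
    rw [← hx0, ← hlam0, ← hτ0, ← map_carlitz, hb, map_zero]
    intro c
    rw [IsScalarTower.algebraMap_apply F k (PowerSeries k)]; simp
  have hzint := isIntegral_of_carlitz_eq_zero hm hlam
  have hmon := minpoly.monic hzint
  set μ := minpoly k[X] lam with hμ
  have hdeg : 0 < μ.natDegree := minpoly.natDegree_pos hzint
  obtain ⟨p, hpF⟩ := CharP.exists F
  obtain ⟨f, hp, hf⟩ := FiniteField.card F p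
  have hpk : CharP k p := charP_of_injective_algebraMap (algebraMap F k).injective p
  have hexp : ExpChar k p := ExpChar.prime hp
  have hmin : ∀ c : k[X][X], c.degree < (μ.natDegree : ℕ) → aeval lam c = 0 → c = 0 := by
    intro c hc hc0
    by_contra h
    have := minpoly.IsIntegrallyClosed.degree_le_of_ne_zero h hc0
    rw [degree_eq_natDegree hmon.ne_zero] at this
    exact absurd hc (not_lt.2 this)
  choose K hK using fun u : F[X] ⧸ Ideal.span {m} =>
    stepanov_bound p hp.one_lt hmon hdeg (minpoly.aeval _ _) hmin
      (carlitzPoly (X + C t0 : k[X]) (Quotient.out u))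
  obtain ⟨N, hN, hfix⟩ := exists_pow_card_pow_eq F
    ({t0} ∪ μ.support.biUnion fun i => (μ.coeff i).support.image fun j => (μ.coeff i).coeff j)
  have hfix0 : ∀ j ≠ 0, t0 ^ Fintype.card F ^ (2 * N * j) = t0 := hfix t0 (by simp)
  have hfixμ : ∀ j ≠ 0, ∀ i l, ((μ.coeff i).coeff l) ^ Fintype.card F ^ (2 * N * j) =
      (μ.coeff i).coeff l := by
    intro j hj i l
    by_cases h : (μ.coeff i).coeff l = 0
    · rw [h, zero_pow (pow_pos Fintype.card_pos _).ne']
    · refine hfix _ (Finset.mem_union_right _ (Finset.mem_biUnion.2 ⟨i, ?_,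
        Finset.mem_image.2 ⟨l, mem_support_iff.2 h, rfl⟩⟩)) j hj
      rw [mem_support_iff]
      intro h0
      rw [h0, coeff_zero] at h
      exact h rfl
  have hmk : ∀ u : F[X] ⧸ Ideal.span {m}, Ideal.Quotient.mk _ (Quotient.out u) = u :=
    fun u => Quotient.out_eq u
  have hact : ∀ j ≠ 0, ∀ u : F[X] ⧸ Ideal.span {m}, ∀ t ∈ artinFibre k (2 * N * j) u,
      ∀ x : k, carlitz t m x = 0 →
      x ^ Fintype.card F ^ (2 * N * j) = carlitz t (Quotient.out u) x := by
    intro j hj u t ht x hx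
    rw [mem_artinFibre] at ht
    have hn : 2 * N * j ≠ 0 := mul_ne_zero (mul_ne_zero two_ne_zero hN) hj
    refine pow_eq_carlitz (Algebra.IsIntegral.isIntegral t) (natDegree_minpoly_dvd hn ht.1).1 ?_ hx
    rw [← Ideal.mem_span_singleton, ← Ideal.Quotient.eq, map_pow, ht.2, hmk]
  refine ⟨N, hN, ∑ u, K u, μ.natDegree,
    Finset.univ.filter fun u => aeval (carlitz τ (Quotient.out u) lam) μ = 0, ?_, ?_, ?_⟩
  · rw [Finset.mem_filter]
    refine ⟨Finset.mem_univ _, ?_⟩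
    have h1 : m ∣ Quotient.out (1 : F[X] ⧸ Ideal.span {m}) - 1 := by
      rw [← Ideal.mem_span_singleton, ← Ideal.Quotient.eq, hmk, map_one]
    obtain ⟨c, hc⟩ := h1
    have h2 : carlitz τ (Quotient.out (1 : F[X] ⧸ Ideal.span {m})) lam = lam := by
      rw [← sub_eq_zero]
      conv_lhs => rw [← carlitz_one (F := F) τ lam, ← carlitz_mul, mul_one, ← carlitz_sub, hc]
      rw [mul_comm, carlitz_mul, hlam, map_zero]
    rw [h2]
    exact minpoly.aeval _ _
  · have hinj : Set.InjOn (fun u : F[X] ⧸ Ideal.span {m} => carlitz τ (Quotient.out u) lam)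
        ((Finset.univ.filter fun u : F[X] ⧸ Ideal.span {m} =>
          aeval (carlitz τ (Quotient.out u) lam) μ = 0 : Finset _) : Set _) := by
      intro u _ v _ huv
      rw [← hmk u, ← hmk v, Ideal.Quotient.eq, Ideal.mem_span_singleton]
      refine hann _ ?_
      rw [carlitz_sub, sub_eq_zero]
      exact huv
    rw [← Finset.card_image_of_injOn hinj]
    have hm0 : μ.map (algebraMap k[X] (PowerSeries k)) ≠ 0 := (hmon.map _).ne_zero
    refine (Finset.card_le_card (t := (μ.map (algebraMap k[X] (PowerSeries k))).roots.toFinset)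
      fun y hy => ?_).trans ((Multiset.toFinset_card_le _).trans ((card_roots' _).trans
        (natDegree_map_le)))
    obtain ⟨u, hu, rfl⟩ := Finset.mem_image.1 hy
    rw [Multiset.mem_toFinset, mem_roots hm0, IsRoot, eval_map_algebraMap]
    exact (Finset.mem_filter.1 hu).2
  · intro j hj u hu
    have hn : 2 * N * j ≠ 0 := mul_ne_zero (mul_ne_zero two_ne_zero hN) hj
    have hshift : ∀ t : k, t ∈ artinFibre k (2 * N * j) u →
        (t - t0) ^ Fintype.card F ^ (2 * N * j) = t - t0 := fun t ht => by
      have h1 := add_pow_card_pow (F := F) (t - t0) t0 (2 * N * j)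
      rw [sub_add_cancel, hfix0 j hj, (mem_fixPts hn).1 (mem_artinFibre.1 ht).1] at h1
      linear_combination -h1
    constructor
    · intro huH
      rw [Finset.eq_empty_iff_forall_notMem]
      intro t ht
      refine huH (Finset.mem_filter.2 ⟨Finset.mem_univ _, ?_⟩)
      refine aeval_carlitz_minpoly_eq_zero (t := t - t0) hm hlam (hshift t ht) (hfixμ j hj) ?_ ?_
      · rw [sub_add_cancel]; exact aeval_ne_zero_of_mem_artinFibre hn hu ht
      · rw [sub_add_cancel]; exact hact j hj u t ht
    · have hQ : Fintype.card F ^ (2 * N * j) = (p ^ ((f : ℕ) * (N * j))) ^ 2 := by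
        rw [hf, ← pow_mul, ← pow_mul]; congr 1; ring
      have hP : Fintype.card F ^ (N * j) = p ^ ((f : ℕ) * (N * j)) := by
        rw [hf, ← pow_mul]
      have h := hK u (f * (N * j)) (mul_ne_zero f.ne_zero (mul_ne_zero hN hj))
        ((artinFibre k (2 * N * j) u).image fun t => t - t0) (by
          intro t1 ht1
          obtain ⟨t, ht, rfl⟩ := Finset.mem_image.1 ht1
          refine ⟨by rw [← hQ]; exact hshift t ht, separable_map_minpoly hm hlam ?_,
            fun x hx => ?_⟩
          · rw [sub_add_cancel]; exact aeval_ne_zero_of_mem_artinFibre hn hu ht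
          · have h1 := carlitz_eq_zero_of_evalEval_minpoly hm hlam hx
            rw [sub_add_cancel] at h1
            rw [← hQ, evalEval_carlitzPoly, sub_add_cancel]
            exact hact j hj u t ht x h1)
      rw [Finset.card_image_of_injective _ (sub_left_injective)] at h
      rw [hP]
      refine h.trans (Nat.add_le_add_left (Nat.mul_le_mul_right _ ?_) _)
      exact Finset.single_le_sum (fun _ _ => Nat.zero_le _) (Finset.mem_univ u)

end Fibres

section RiemannHypothesis

variable {F : Type*} [Field F] [Fintype F] {m : F[X]}

theorem mulChar_norm_le_one {A : Type*} [CommRing A] [Finite A] (χ : MulChar A ℂ) (u : A) :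
    ‖χ u‖ ≤ 1 := by
  by_cases hu : IsUnit u
  · obtain ⟨n, hn, h⟩ : ∃ n ≠ 0, u ^ n = 1 := by
      obtain ⟨v, rfl⟩ := hu
      refine ⟨orderOf v, (orderOf_pos v).ne', ?_⟩
      rw [← Units.val_pow_eq_pow_val, pow_orderOf_eq_one, Units.val_one]
    refine (Complex.norm_eq_one_of_pow_eq_one (n := n) ?_ hn).le
    rw [← map_pow, h, map_one]
  · rw [χ.map_nonunit hu, norm_zero]
    exact zero_le_one

/-- A lower bound for every member of a finite family from an upper bound for all of them. -/
theorem abs_mul_sub_le_of_sum {ι : Type*} {s : Finset ι} {x : ι → ℝ} {r Q E D : ℝ}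
    (hs : (s.card : ℝ) ≤ r) (hE : 0 ≤ E) (hD : 0 ≤ D) (hQ : 0 ≤ Q) (hx : ∀ i ∈ s, r * x i ≤ Q + E)
    (hsum : Q ≤ ∑ i ∈ s, x i + D) {i : ι} (hi : i ∈ s) : |r * x i - Q| ≤ r * (E + D) := by
  classical
  have hc : (1 : ℝ) ≤ s.card := by exact_mod_cast Finset.card_pos.2 ⟨i, hi⟩
  have hr : 1 ≤ r := hc.trans hs
  have h1 : ∑ l ∈ s, r * x l = r * x i + ∑ l ∈ s.erase i, r * x l :=
    (Finset.add_sum_erase s _ hi).symm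
  have h2 : ∑ l ∈ s.erase i, r * x l ≤ (r - 1) * (Q + E) := by
    refine (Finset.sum_le_card_nsmul _ _ (Q + E) fun l hl =>
      hx l (Finset.mem_of_mem_erase hl)).trans
      ?_
    rw [nsmul_eq_mul, Finset.card_erase_of_mem hi, Nat.cast_sub (Finset.card_pos.2 ⟨i, hi⟩)]
    refine mul_le_mul_of_nonneg_right ?_ (by positivity)
    push_cast
    linarith
  rw [← Finset.mul_sum] at h1
  have h3 := mul_le_mul_of_nonneg_left hsum (by linarith : (0 : ℝ) ≤ r)
  have h4 := hx i hi
  have h5 : E ≤ r * E := le_mul_of_one_le_left hE hr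
  have h6 : 0 ≤ r * D := by positivity
  rw [abs_le]
  constructor <;> nlinarith

theorem exists_primePowerSum_bound (hm : m.Monic) (χ : MulChar (F[X] ⧸ Ideal.span {m}) ℂ) :
    ∃ N ≠ 0, ∃ K : ℝ, ∃ c : ℂ, ‖c‖ ≤ 1 ∧ c ≠ -1 ∧ ∀ j ≥ 1,
      ‖primePowerSum (charFun χ) (N * j) - c * (Fintype.card F : ℂ) ^ (N * j)‖ ≤
        K * √(Fintype.card F) ^ (N * j) := by
  classical
  have := finite_quotient hm
  have := Fintype.ofFinite (F[X] ⧸ Ideal.span {m})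
  obtain ⟨N, hN, K, r, H, h1H, hHr, h⟩ := exists_card_artinFibre_le (AlgebraicClosure F) hm
  obtain ⟨H', hH'⟩ : ∃ H', H' = H.filter IsUnit := ⟨_, rfl⟩
  have h1H' : 1 ∈ H' := by rw [hH', Finset.mem_filter]; exact ⟨h1H, isUnit_one⟩
  have hH'r : H'.card ≤ r := (hH' ▸ Finset.card_filter_le _ _ : H'.card ≤ H.card).trans hHr
  have hr : 0 < r := (Finset.card_pos.2 ⟨1, h1H'⟩).trans_le hH'r
  have hr' : (0 : ℝ) < r := by exact_mod_cast hr
  refine ⟨2 * N, mul_ne_zero two_ne_zero hN, r * (K + m.natDegree), (∑ u ∈ H', χ u) / r, ?_, ?_, ?_⟩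
  · rw [norm_div, Complex.norm_natCast, div_le_one hr']
    refine (norm_sum_le _ _).trans ((Finset.sum_le_card_nsmul _ _ 1
      fun u _ => mulChar_norm_le_one χ u).trans ?_)
    rw [nsmul_eq_mul, mul_one]
    exact_mod_cast hH'r
  · intro hc
    rw [div_eq_iff (by exact_mod_cast hr.ne')] at hc
    have h2 := congrArg Complex.re hc
    rw [← Finset.add_sum_erase _ _ h1H', map_one] at h2
    have h3 : ‖∑ u ∈ H'.erase 1, χ u‖ ≤ r - 1 := by
      refine (norm_sum_le _ _).trans ((Finset.sum_le_card_nsmul _ _ 1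
        fun u _ => mulChar_norm_le_one χ u).trans ?_)
      rw [nsmul_eq_mul, mul_one, Finset.card_erase_of_mem h1H',
        Nat.cast_sub (Finset.card_pos.2 ⟨1, h1H'⟩), Nat.cast_one]
      have : (H'.card : ℝ) ≤ r := by exact_mod_cast hH'r
      linarith
    have h4 := (abs_le.1 (Complex.abs_re_le_norm (∑ u ∈ H'.erase 1, χ u))).1
    simp at h2
    simp at h4
    linarith
  · intro j hj
    have hj0 : j ≠ 0 := by omega
    have hn : 2 * N * j ≠ 0 := mul_ne_zero (mul_ne_zero two_ne_zero hN) hj0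
    obtain ⟨P, hP⟩ : ∃ P : ℝ, P = (Fintype.card F : ℝ) ^ (N * j) := ⟨_, rfl⟩
    have hP1 : 1 ≤ P := by
      rw [hP]; exact one_le_pow₀ (by exact_mod_cast Fintype.card_pos)
    have hsqrt : √(Fintype.card F : ℝ) ^ (2 * N * j) = P := by
      rw [mul_assoc, pow_mul, Real.sq_sqrt (Nat.cast_nonneg _), hP]
    have hQ : (Fintype.card F : ℝ) ^ (2 * N * j) = P ^ 2 := by
      rw [hP, ← pow_mul]; congr 1; ring
    have hzero : ∀ u, u ∉ H' → IsUnit u →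
        artinFibre (AlgebraicClosure F) (2 * N * j) u = ∅ := fun u hu hu' =>
      (h j hj0 u hu').1 fun h2 => hu (by rw [hH', Finset.mem_filter]; exact ⟨h2, hu'⟩)
    have hmain : ∀ u ∈ H', |r * ((artinFibre (AlgebraicClosure F) (2 * N * j) u).card : ℝ) -
        P ^ 2| ≤ r * (K * P + m.natDegree) := by
      intro u hu
      refine abs_mul_sub_le_of_sum (s := H') (r := r) (Q := P ^ 2) (E := K * P)
        (D := m.natDegree)
        (x := fun u => ((artinFibre (AlgebraicClosure F) (2 * N * j) u).card : ℝ))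
        (by exact_mod_cast hH'r) (by positivity)
        (by positivity) (by positivity) (fun v hv => ?_) ?_ hu
      · rw [hH', Finset.mem_filter] at hv
        have := (h j hj0 v hv.2).2
        rw [hP]
        exact_mod_cast this
      · have h2 := le_sum_card_artinFibre (k := AlgebraicClosure F) hm hn
        have h3 : ∑ u : F[X] ⧸ Ideal.span {m} with IsUnit u,
            (artinFibre (AlgebraicClosure F) (2 * N * j) u).card =
            ∑ u ∈ H', (artinFibre (AlgebraicClosure F) (2 * N * j) u).card := by
          symm
          refine Finset.sum_subset (fun u hu => ?_) fun u hu hu' => ?_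
          · rw [hH', Finset.mem_filter] at hu
            exact Finset.mem_filter.2 ⟨Finset.mem_univ _, hu.2⟩
          · rw [hzero u hu' (Finset.mem_filter.1 hu).2, Finset.card_empty]
        rw [h3] at h2
        rw [← hQ]
        exact_mod_cast h2
    rw [sum_mulChar_artinFibre (k := AlgebraicClosure F) χ hn, hsqrt]
    have h4 : ∑ u, ((artinFibre (AlgebraicClosure F) (2 * N * j) u).card : ℂ) * χ u =
        ∑ u ∈ H', ((artinFibre (AlgebraicClosure F) (2 * N * j) u).card : ℂ) * χ u := by
      symm
      refine Finset.sum_subset (Finset.subset_univ _) fun u _ hu => ?_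
      by_cases hu' : IsUnit u
      · rw [hzero u hu hu', Finset.card_empty, Nat.cast_zero, zero_mul]
      · rw [χ.map_nonunit hu', mul_zero]
    have hQ' : (Fintype.card F : ℂ) ^ (2 * N * j) = ((P ^ 2 : ℝ) : ℂ) := by
      rw [← hQ]; push_cast; rfl
    have h5 : ∑ u ∈ H', ((artinFibre (AlgebraicClosure F) (2 * N * j) u).card : ℂ) * χ u -
        (∑ u ∈ H', χ u) / r * ((P ^ 2 : ℝ) : ℂ) =
        (∑ u ∈ H', ((r * ((artinFibre (AlgebraicClosure F) (2 * N * j) u).card : ℝ) -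
          P ^ 2 : ℝ) : ℂ)
          * χ u) / r := by
      have hrc : (r : ℂ) ≠ 0 := by exact_mod_cast hr.ne'
      rw [eq_div_iff hrc, sub_mul, Finset.sum_mul, div_mul_eq_mul_div, div_mul_cancel₀ _ hrc,
        Finset.sum_mul, ← Finset.sum_sub_distrib]
      refine Finset.sum_congr rfl fun u _ => ?_
      push_cast
      ring
    rw [h4, hQ', h5, norm_div, Complex.norm_natCast, div_le_iff₀ hr']
    refine (norm_sum_le _ _).trans ((Finset.sum_le_card_nsmul _ _ (r * (K * P + m.natDegree))
        fun u hu => ?_).trans ?_)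
    · rw [norm_mul, Complex.norm_real, Real.norm_eq_abs]
      calc _ ≤ r * (K * P + m.natDegree) * 1 :=
            mul_le_mul (hmain u hu) (mulChar_norm_le_one χ u) (norm_nonneg _) (by positivity)
        _ = _ := mul_one _
    · rw [nsmul_eq_mul]
      have h6 : (m.natDegree : ℝ) ≤ m.natDegree * P :=
        le_mul_of_one_le_right (Nat.cast_nonneg _) hP1
      calc _ ≤ (r : ℝ) * (r * (K * P + m.natDegree * P)) := by
            refine mul_le_mul (by exact_mod_cast hH'r) ?_ (by positivity) (by positivity)
            gcongr
        _ = _ := by ring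

/-- Square root cancellation for nontrivial characters. -/
theorem norm_primePowerSum_le (hm : m.Monic) (hdeg : 0 < m.natDegree)
    {χ : MulChar (F[X] ⧸ Ideal.span {m}) ℂ} (hχ : χ ≠ 1) {n : ℕ} (hn : n ≠ 0) :
    ‖primePowerSum (charFun χ) n‖ ≤ (m.natDegree - 1) * √(Fintype.card F) ^ n := by
  obtain ⟨s, hs, hsum⟩ := exists_primePowerSum_eq hm hdeg hχ
  obtain ⟨N, hN, K, c, hc, hc1, h⟩ := exists_primePowerSum_bound hm χ
  have hroot : ∀ z ∈ s, ‖z‖ ≤ √(Fintype.card F : ℝ) := fun z hz => by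
    refine norm_le_sqrt_of_power_sum s (by exact_mod_cast Fintype.one_lt_card)
      (Nat.one_le_iff_ne_zero.2 hN) K hc hc1 (fun j hj => ?_) hz
    have h1 := h j hj
    obtain ⟨l, hl⟩ := Nat.exists_eq_succ_of_ne_zero (mul_ne_zero hN (by omega : j ≠ 0))
    rw [hl, Nat.succ_eq_add_one, hsum] at h1
    rw [hl]
    simpa using h1
  obtain ⟨l, rfl⟩ := Nat.exists_eq_succ_of_ne_zero hn
  rw [Nat.succ_eq_add_one, hsum, norm_neg]
  have h2 : ‖(s.map fun z => z ^ (l + 1)).sum‖ ≤ s.card * √(Fintype.card F : ℝ) ^ (l + 1) := by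
    clear hsum hs
    induction s using Multiset.induction_on with
    | empty => simp
    | cons a s ih =>
      rw [Multiset.map_cons, Multiset.sum_cons, Multiset.card_cons]
      refine (norm_add_le _ _).trans ?_
      have h3 : ‖a ^ (l + 1)‖ ≤ √(Fintype.card F : ℝ) ^ (l + 1) := by
        rw [norm_pow]
        exact pow_le_pow_left₀ (norm_nonneg _) (hroot a (Multiset.mem_cons_self a s)) _
      have h4 := ih fun z hz => hroot z (Multiset.mem_cons_of_mem hz)
      push_cast
      linarith
  refine h2.trans (mul_le_mul_of_nonneg_right ?_ (by positivity))
  have : ((s.card + 1 : ℕ) : ℝ) ≤ m.natDegree := by exact_mod_cast hs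
  push_cast at this
  linarith

end RiemannHypothesis

section Equidistribution

variable {F : Type*} [Field F] [Fintype F] {m : F[X]}

theorem sum_mulChar_eq {A : Type*} [CommRing A] [Finite A] [Fintype (MulChar A ℂ)] (x : A)
    [Decidable (x = 1)] :
    ∑ χ : MulChar A ℂ, χ x = if x = 1 then (Nat.card Aˣ : ℂ) else 0 := by
  split_ifs with h
  · subst h
    simp [← MulChar.card_eq_card_units_of_hasEnoughRootsOfUnity A ℂ, Nat.card_eq_fintype_card]
  · obtain ⟨ψ, hψ⟩ := MulChar.exists_apply_ne_one_of_hasEnoughRootsOfUnity A ℂ h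
    have h1 : ∑ χ : MulChar A ℂ, χ x = ψ x * ∑ χ : MulChar A ℂ, χ x := by
      rw [Finset.mul_sum]
      refine (Fintype.sum_equiv (Equiv.mulLeft ψ) _ _ fun χ => ?_).symm
      simp [MulChar.mul_apply]
    have h2 : (ψ x - 1) * ∑ χ : MulChar A ℂ, χ x = 0 := by linear_combination -h1
    exact (mul_eq_zero.1 h2).resolve_left (sub_ne_zero.2 hψ)

theorem card_units_pos {A : Type*} [CommRing A] [Finite A] : 0 < Nat.card Aˣ := Nat.card_pos

theorem abs_card_artinFibre_sub_le (hm : m.Monic) (hdeg : 0 < m.natDegree) {n : ℕ} (hn : n ≠ 0)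
    {v : F[X] ⧸ Ideal.span {m}} (hv : IsUnit v) :
    |((artinFibre (AlgebraicClosure F) n v).card : ℝ) -
        (Fintype.card F : ℝ) ^ n / Nat.card (F[X] ⧸ Ideal.span {m})ˣ| ≤
      m.natDegree * √(Fintype.card F) ^ n := by
  classical
  have := finite_quotient hm
  have := Fintype.ofFinite (F[X] ⧸ Ideal.span {m})
  have := Fintype.ofFinite (MulChar (F[X] ⧸ Ideal.span {m}) ℂ)
  set φ := Nat.card (F[X] ⧸ Ideal.span {m})ˣ with hφ
  have hφ0 : 0 < φ := card_units_pos
  have hφ1 : (1 : ℝ) ≤ φ := by exact_mod_cast hφ0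
  have hd1 : (1 : ℝ) ≤ m.natDegree := by exact_mod_cast hdeg
  set y := √(Fintype.card F : ℝ) ^ n with hy
  have hy1 : 1 ≤ y := one_le_pow₀ (by
    rw [Real.one_le_sqrt]; exact_mod_cast Fintype.card_pos)
  set z : (F[X] ⧸ Ideal.span {m}) → ℂ :=
    fun w => ((artinFibre (AlgebraicClosure F) n w).card : ℂ) with hz
  obtain ⟨v', hv'⟩ := hv.exists_left_inv
  have h1 : ∑ χ : MulChar (F[X] ⧸ Ideal.span {m}) ℂ, χ v' * primePowerSum (charFun χ) n =
      φ * z v := by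
    simp only [sum_mulChar_artinFibre (k := AlgebraicClosure F) _ hn, Finset.mul_sum]
    rw [Finset.sum_comm]
    have h2 : ∀ w : F[X] ⧸ Ideal.span {m}, ∑ χ : MulChar (F[X] ⧸ Ideal.span {m}) ℂ,
        χ v' * (z w * χ w) = if w = v then φ * z v else 0 := by
      intro w
      have h3 : ∀ χ : MulChar (F[X] ⧸ Ideal.span {m}) ℂ,
          χ v' * (z w * χ w) = z w * χ (v' * w) := fun χ => by rw [map_mul]; ring
      rw [Finset.sum_congr rfl fun χ _ => h3 χ, ← Finset.mul_sum, sum_mulChar_eq]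
      have h4 : v' * w = 1 ↔ w = v := by
        constructor
        · intro h
          calc w = (v' * v) * w := by rw [hv', one_mul]
            _ = (v' * w) * v := by ring
            _ = v := by rw [h, one_mul]
        · rintro rfl; exact hv'
      simp only [h4]
      split_ifs with h
      · rw [h, mul_comm]
      · rw [mul_zero]
    rw [Finset.sum_congr rfl fun w _ => h2 w, Finset.sum_ite_eq' Finset.univ v,
      if_pos (Finset.mem_univ _)]
  rw [← Finset.add_sum_erase _ _ (Finset.mem_univ 1)] at h1
  have hv1 : IsUnit v' := IsUnit.of_mul_eq_one v hv'
  have h5 : ‖∑ χ ∈ Finset.univ.erase (1 : MulChar (F[X] ⧸ Ideal.span {m}) ℂ),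
      χ v' * primePowerSum (charFun χ) n‖ ≤ (φ - 1) * ((m.natDegree - 1) * y) := by
    refine (norm_sum_le _ _).trans ((Finset.sum_le_card_nsmul _ _ ((m.natDegree - 1) * y)
      fun χ hχ => ?_).trans (le_of_eq ?_))
    · rw [norm_mul]
      exact (mul_le_of_le_one_left (norm_nonneg _) (mulChar_norm_le_one χ v')).trans
        (norm_primePowerSum_le hm hdeg (Finset.ne_of_mem_erase hχ) hn)
    · rw [nsmul_eq_mul, Finset.card_erase_of_mem (Finset.mem_univ _), Finset.card_univ,
        ← Nat.card_eq_fintype_card, MulChar.card_eq_card_units_of_hasEnoughRootsOfUnity,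
        Nat.cast_sub (by exact hφ0), Nat.cast_one]
  obtain ⟨T, hT⟩ : ∃ T : ℕ, T = ∑ u : F[X] ⧸ Ideal.span {m} with IsUnit u,
      (artinFibre (AlgebraicClosure F) n u).card := ⟨_, rfl⟩
  have h6 : primePowerSum (charFun (1 : MulChar (F[X] ⧸ Ideal.span {m}) ℂ)) n = (T : ℂ) := by
    rw [sum_mulChar_artinFibre (k := AlgebraicClosure F) _ hn, hT, Nat.cast_sum,
      Finset.sum_filter]
    refine Finset.sum_congr rfl fun u _ => ?_
    split_ifs with hu
    · rw [MulChar.one_apply hu, mul_one]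
    · rw [MulChar.map_nonunit _ hu, mul_zero]
  rw [MulChar.one_apply hv1, one_mul, h6] at h1
  have h7 : (T : ℝ) ≤ (Fintype.card F : ℝ) ^ n := by
    have h8 := sum_card_artinFibre (k := AlgebraicClosure F) (m := m) n
    rw [card_fixPts hn] at h8
    have : T ≤ Fintype.card F ^ n := by
      rw [hT, ← h8]
      exact Finset.sum_le_sum_of_subset (Finset.filter_subset _ _)
    exact_mod_cast this
  have h9 : (Fintype.card F : ℝ) ^ n ≤ T + m.natDegree := by
    have := le_sum_card_artinFibre (k := AlgebraicClosure F) hm hn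
    rw [← hT] at this
    exact_mod_cast this
  have h10 : |φ * ((artinFibre (AlgebraicClosure F) n v).card : ℝ) - T| ≤
      (φ - 1) * ((m.natDegree - 1) * y) := by
    have h11 : (∑ χ ∈ Finset.univ.erase (1 : MulChar (F[X] ⧸ Ideal.span {m}) ℂ),
      χ v' * primePowerSum (charFun χ) n) =
        ((φ * ((artinFibre (AlgebraicClosure F) n v).card : ℝ) - T : ℝ) : ℂ) := by
      push_cast
      linear_combination h1
    rw [h11, Complex.norm_real, Real.norm_eq_abs] at h5
    exact h5
  have hφ' : (0 : ℝ) < φ := by linarith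
  have h12 : |φ * ((artinFibre (AlgebraicClosure F) n v).card : ℝ) - (Fintype.card F : ℝ) ^ n| ≤
      φ * (m.natDegree * y) := by
    rw [abs_le] at h10 ⊢
    constructor <;> nlinarith [mul_nonneg (sub_nonneg.2 hφ1) (sub_nonneg.2 hy1),
      mul_nonneg (sub_nonneg.2 hd1) (sub_nonneg.2 hy1)]
  rw [show ((artinFibre (AlgebraicClosure F) n v).card : ℝ) - (Fintype.card F : ℝ) ^ n / φ =
    (φ * ((artinFibre (AlgebraicClosure F) n v).card : ℝ) - (Fintype.card F : ℝ) ^ n) / φ by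
      field_simp, abs_div, abs_of_pos hφ', div_le_iff₀ hφ']
  linarith

end Equidistribution

section Progression

variable {F : Type*} [Field F] [Fintype F]

open scoped Classical in
/-- The indicator function of the polynomials all of whose monic irreducible factors are congruent
to `a` modulo `m`. -/
noncomputable def progFun (a m : F[X]) : F[X] →* ℝ where
  toFun f := if ∀ P : F[X], P.Monic → Irreducible P → P ∣ f → m ∣ P - a then 1 else 0
  map_one' := if_pos fun P _ hP h => absurd (isUnit_of_dvd_one h) hP.not_isUnit
  map_mul' f g := by
    have h : (∀ P : F[X], P.Monic → Irreducible P → P ∣ f * g → m ∣ P - a) ↔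
        (∀ P : F[X], P.Monic → Irreducible P → P ∣ f → m ∣ P - a) ∧
          ∀ P : F[X], P.Monic → Irreducible P → P ∣ g → m ∣ P - a :=
      ⟨fun h => ⟨fun P h1 h2 h3 => h P h1 h2 (h3.mul_right g),
        fun P h1 h2 h3 => h P h1 h2 (h3.mul_left f)⟩,
        fun h P h1 h2 h3 => (h2.prime.dvd_or_dvd h3).elim (h.1 P h1 h2) (h.2 P h1 h2)⟩
    by_cases hf : ∀ P : F[X], P.Monic → Irreducible P → P ∣ f → m ∣ P - a
    · by_cases hg : ∀ P : F[X], P.Monic → Irreducible P → P ∣ g → m ∣ P - a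
      · rw [if_pos hf, if_pos hg, if_pos (h.2 ⟨hf, hg⟩), mul_one]
      · rw [if_neg hg, if_neg fun h' => hg (h.1 h').2, mul_zero]
    · rw [if_neg hf, if_neg fun h' => hf (h.1 h').1, zero_mul]

theorem monicSum_progFun (a m : F[X]) (n : ℕ) :
    monicSum (progFun a m) n = (Nat.card {f : F[X] // f.Monic ∧ f.natDegree = n ∧
      ∀ P : F[X], P.Monic → Irreducible P → P ∣ f → m ∣ P - a} : ℝ) := by
  classical
  have h : monicSum (progFun a m) n = ∑ f ∈ monics F n,
      if ∀ P : F[X], P.Monic → Irreducible P → P ∣ f → m ∣ P - a then (1 : ℝ) else 0 :=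
    Finset.sum_congr rfl fun f _ => by simp only [progFun, MonoidHom.coe_mk, OneHom.coe_mk]
  rw [h, Finset.sum_boole]
  congr 1
  refine (Nat.subtype_card _ fun f => ?_).symm
  rw [Finset.mem_filter, mem_monics, and_assoc]

theorem progFun_apply_irreducible {a m P : F[X]} (hP : Irreducible P) (hPm : P.Monic)
    [Decidable (m ∣ P - a)] : progFun a m P = if m ∣ P - a then 1 else 0 := by
  simp only [progFun, MonoidHom.coe_mk, OneHom.coe_mk]
  by_cases h : m ∣ P - a
  · rw [if_pos h, if_pos]
    intro Q h1 h2 h3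
    rwa [eq_of_monic_of_associated h1 hPm (h2.associated_of_dvd hP h3)]
  · rw [if_neg h, if_neg fun h' => h (h' P hPm hP dvd_rfl)]

theorem primePowerSum_progFun (a m : F[X]) {n : ℕ} (hn : n ≠ 0)
    [DecidablePred fun P : F[X] => m ∣ P - a] :
    primePowerSum (progFun a m) n =
      ∑ P ∈ primesDvd F n with m ∣ P - a, (P.natDegree : ℝ) := by
  rw [primePowerSum, Finset.sum_filter]
  refine Finset.sum_congr rfl fun P hP => ?_
  obtain ⟨h1, h2, h3⟩ := (mem_primesDvd hn).1 hP
  rw [progFun_apply_irreducible h2 h1]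
  split_ifs
  · rw [one_pow, mul_one]
  · rw [zero_pow, mul_zero]
    exact (Nat.div_pos (Nat.le_of_dvd (Nat.pos_of_ne_zero hn) h3) h2.natDegree_pos).ne'

theorem hasSum_natDegree (a m : F[X]) (n : ℕ) :
    HasSum (fun P : {P : {P : F[X] // P.Monic ∧ Irreducible P ∧ m ∣ P - a} //
      (P : F[X]).natDegree ∣ n + 1} => (((P : {P : F[X] // P.Monic ∧ Irreducible P ∧ m ∣ P - a}) :
        F[X]).natDegree : ℝ)) (primePowerSum (progFun a m) (n + 1)) := by
  classical
  rw [primePowerSum_progFun a m (Nat.add_one_ne_zero n)]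
  rw [← Finset.sum_coe_sort]
  set S := (primesDvd F (n + 1)).filter fun P => m ∣ P - a with hS
  have h : ∀ P : F[X], P ∈ S ↔
      (P.Monic ∧ Irreducible P ∧ m ∣ P - a) ∧ P.natDegree ∣ n + 1 := fun P => by
    rw [hS, Finset.mem_filter, mem_primesDvd (Nat.add_one_ne_zero n)]
    tauto
  obtain ⟨e, he⟩ : ∃ e : {P : {P : F[X] // P.Monic ∧ Irreducible P ∧ m ∣ P - a} //
      (P : F[X]).natDegree ∣ n + 1} ≃ {P : F[X] // P ∈ S}, ∀ P, (e P : F[X]) = P.1.1 :=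
    ⟨(Equiv.subtypeSubtypeEquivSubtypeInter _ fun P : F[X] => P.natDegree ∣ n + 1).trans
      (Equiv.subtypeEquivRight fun P => (h P).symm), fun _ => rfl⟩
  have h1 := (Equiv.hasSum_iff e (f := fun P : {P : F[X] // P ∈ S} => (P.1.natDegree : ℝ))).2
    (hasSum_fintype _)
  refine (congrArg (fun f => HasSum f _) (funext fun P => ?_)).mp h1
  exact congrArg (fun f : F[X] => (f.natDegree : ℝ)) (he P)

/-- Prime powers contribute little to the count of a residue class. -/
theorem abs_primePowerSum_sub_card_le (a m : F[X]) {n : ℕ} (hn : n ≠ 0) :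
    |primePowerSum (progFun a m) n - (artinFibre (AlgebraicClosure F) n
      (Ideal.Quotient.mk (Ideal.span {m}) a)).card| ≤ 2 * √(Fintype.card F) ^ n := by
  classical
  set k := AlgebraicClosure F
  have h1 : primePowerSum (progFun a m) n =
      ∑ t ∈ fixPts F k n, if m ∣ minpoly F t - a then (1 : ℝ) else 0 := by
    rw [sum_fixPts_minpoly (fun P : F[X] => if m ∣ P - a then (1 : ℝ) else 0) hn,
      primePowerSum_progFun a m hn, Finset.sum_filter]
    exact Finset.sum_congr rfl fun P _ => by split_ifs <;> simp
  have h2 : ((artinFibre k n (Ideal.Quotient.mk (Ideal.span {m}) a)).card : ℝ) =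
      ∑ t ∈ fixPts F k n, if Ideal.Quotient.mk (Ideal.span {m}) (minpoly F t) ^
        (n / (minpoly F t).natDegree) = Ideal.Quotient.mk (Ideal.span {m}) a
          then (1 : ℝ) else 0 := by
    rw [artinFibre, Finset.sum_boole]
  obtain ⟨M, hM⟩ : ∃ M, M = n / 2 := ⟨_, rfl⟩
  rw [h1, h2, ← Finset.sum_sub_distrib]
  calc _ ≤ ∑ t ∈ fixPts F k n, if (minpoly F t).natDegree ∈ Finset.Icc 1 M then (1 : ℝ) else 0 := by
        refine (Finset.abs_sum_le_sum_abs _ _).trans (Finset.sum_le_sum fun t ht => ?_)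
        have hD := (natDegree_minpoly_dvd hn ht).1
        have hpos := minpoly.natDegree_pos (Algebra.IsIntegral.isIntegral (R := F) t)
        by_cases hDn : (minpoly F t).natDegree = n
        · have h3 : (m ∣ minpoly F t - a) = (Ideal.Quotient.mk (Ideal.span {m}) (minpoly F t) ^
              (n / (minpoly F t).natDegree) = Ideal.Quotient.mk (Ideal.span {m}) a) := by
            rw [hDn, Nat.div_self (Nat.pos_of_ne_zero hn), pow_one, Ideal.Quotient.eq,
              Ideal.mem_span_singleton]
          simp only [h3, sub_self, abs_zero]
          split_ifs <;> norm_num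
        · have h3 : (minpoly F t).natDegree ∈ Finset.Icc 1 M := by
            rw [Finset.mem_Icc, hM]
            refine ⟨hpos, ?_⟩
            obtain ⟨c, hc⟩ := hD
            have hc2 : 2 ≤ c := by
              rcases c with _ | _ | c
              · simp at hc; exact absurd hc hn
              · simp at hc; exact absurd hc.symm hDn
              · omega
            rw [Nat.le_div_iff_mul_le two_pos, hc]
            exact Nat.mul_le_mul_left _ hc2
          rw [if_pos h3]
          split_ifs <;> norm_num
    _ ≤ ((Finset.Icc 1 M).biUnion fun j => fixPts F k j).card := by
        rw [Finset.sum_boole]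
        refine Nat.cast_le.2 (Finset.card_le_card fun t ht => ?_)
        have h3 := (Finset.mem_filter.1 ht).2
        have h4 : (minpoly F t).natDegree ≠ 0 := by
          have := (Finset.mem_Icc.1 h3).1; omega
        exact Finset.mem_biUnion.2 ⟨_, h3, (mem_fixPts_iff_natDegree_dvd h4).2 dvd_rfl⟩
    _ ≤ ((∑ j ∈ Finset.Icc 1 M, Fintype.card F ^ j : ℕ) : ℝ) := by
        refine Nat.cast_le.2 (Finset.card_biUnion_le.trans (Finset.sum_le_sum fun j hj => ?_))
        rw [card_fixPts (by have := (Finset.mem_Icc.1 hj).1; omega)]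
    _ ≤ ((2 * Fintype.card F ^ M : ℕ) : ℝ) := by
        refine Nat.cast_le.2 ?_
        clear hM
        have hq : 2 ≤ Fintype.card F := Fintype.one_lt_card
        induction M with
        | zero => simp
        | succ M ih =>
          rw [Finset.sum_Icc_succ_top (by omega), pow_succ]
          nlinarith [Nat.mul_le_mul_left (Fintype.card F ^ M) hq]
    _ ≤ 2 * √(Fintype.card F) ^ n := by
        push_cast
        refine mul_le_mul_of_nonneg_left ?_ two_pos.le
        rw [← Real.sq_sqrt (Nat.cast_nonneg (Fintype.card F) : (0 : ℝ) ≤ Fintype.card F),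
          ← pow_mul, Real.sqrt_sq (Real.sqrt_nonneg _)]
        refine pow_le_pow_right₀ ?_ (by omega)
        rw [Real.one_le_sqrt]
        exact_mod_cast Fintype.card_pos

theorem abs_primePowerSum_progFun_sub_le {a m : F[X]} (hcop : IsCoprime a m) (hm : m.Monic)
    (hdeg : 0 < m.natDegree) {n : ℕ} (hn : n ≠ 0) :
    |primePowerSum (progFun a m) n / (Fintype.card F : ℝ) ^ n -
        1 / Nat.card (F[X] ⧸ Ideal.span {m})ˣ| ≤
      (m.natDegree + 2) * (1 / √(Fintype.card F)) ^ n := by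
  have h1 := abs_primePowerSum_sub_card_le a m hn
  have h2 := abs_card_artinFibre_sub_le hm hdeg hn (isUnit_mk_iff_isCoprime.2 hcop)
  have h3 := (abs_sub_le _ _ _).trans (add_le_add h1 h2)
  have hq : (0 : ℝ) < Fintype.card F := by exact_mod_cast Fintype.card_pos
  have hQ : (0 : ℝ) < (Fintype.card F : ℝ) ^ n := by positivity
  have hs : (Fintype.card F : ℝ) ^ n = √(Fintype.card F) ^ n * √(Fintype.card F) ^ n := by
    rw [← mul_pow, Real.mul_self_sqrt hq.le]
  have hs0 : 0 < √(Fintype.card F : ℝ) ^ n := pow_pos (Real.sqrt_pos.2 hq) _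
  have h4 : primePowerSum (progFun a m) n / (Fintype.card F : ℝ) ^ n -
      1 / Nat.card (F[X] ⧸ Ideal.span {m})ˣ =
      (primePowerSum (progFun a m) n - (Fintype.card F : ℝ) ^ n /
        Nat.card (F[X] ⧸ Ideal.span {m})ˣ) / (Fintype.card F : ℝ) ^ n := by
    field_simp
  rw [h4, abs_div, abs_of_pos hQ, div_le_iff₀ hQ]
  refine h3.trans (le_of_eq ?_)
  rw [one_div, inv_pow]
  conv_rhs => rw [hs]
  field_simp
  ring

end Progression

theorem risingBinom_eq_rbinom (θ : ℝ) (n : ℕ) :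
    risingBinom θ n = rbinom ((n : ℝ) + θ - 1) n := by
  rw [risingBinom, rbinom, Finset.prod_div_distrib, ← Finset.prod_range_add_one_eq_factorial,
    ← Finset.prod_range_reflect]
  congr 1
  · refine Finset.prod_congr rfl fun i hi => ?_
    have h : 1 + i ≤ n := by have := Finset.mem_range.1 hi; omega
    rw [Nat.sub_sub, Nat.cast_sub h]
    push_cast
    ring
  · push_cast
    rfl

theorem LogRec.rescale {g : ℕ → ℝ} {x : ℕ → ℝ} (h : LogRec g (PowerSeries.mk x)) (q : ℝ) :
    LogRec (fun k => g k / q ^ k) (PowerSeries.mk fun n => x n / q ^ n) := by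
  refine ⟨by simpa using h.1, fun n => ?_⟩
  have h1 := h.2 n
  simp only [PowerSeries.coeff_mk] at h1 ⊢
  rw [← mul_div_assoc, h1, Finset.sum_div]
  refine Finset.sum_congr rfl fun p hp => ?_
  rw [div_mul_div_comm, ← pow_add,
    show p.1 + 1 + p.2 = n + 1 by rw [← Finset.HasAntidiagonal.mem_antidiagonal.1 hp]; ring]

theorem card_units_quotient_le {F : Type*} [Field F] [Fintype F] {m : F[X]} (hm : m.Monic) :
    Nat.card (F[X] ⧸ Ideal.span {m})ˣ ≤ Fintype.card F ^ m.natDegree := by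
  have := finite_quotient hm
  have h1 : Nat.card (degreeLT F m.natDegree) = Fintype.card F ^ m.natDegree := by
    rw [Nat.card_congr (degreeLTEquiv F m.natDegree).toEquiv, Nat.card_fun]
    simp
  have : Finite (degreeLT F m.natDegree) :=
    Finite.of_equiv _ (degreeLTEquiv F m.natDegree).toEquiv.symm
  rw [← h1]
  refine (Nat.card_le_card_of_injective _ Units.val_injective).trans
    (Nat.card_le_card_of_surjective
      (fun f : degreeLT F m.natDegree => Ideal.Quotient.mk (Ideal.span {m}) (f : F[X])) fun x => ?_)
  obtain ⟨f, rfl⟩ := Ideal.Quotient.mk_surjective x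
  refine ⟨⟨f %ₘ m, mem_degreeLT.2 ?_⟩, ?_⟩
  · rw [← degree_eq_natDegree hm.ne_zero]
    exact degree_modByMonic_lt _ hm
  · rw [Ideal.Quotient.eq, Ideal.mem_span_singleton]
    exact ⟨-(f /ₘ m), by linear_combination modByMonic_add_div f m⟩

end FunctionField

/-- Effective asymptotics for polynomials with prime factors in an arithmetic progression.
Let `F` be a finite field with `q` elements, `a, m ∈ F[T]` coprime with `m` monic of positive
degree, and `φ = #(F[T]/(m))ˣ`.  Then the one-sided limit
`C_{a,m} = lim_{u→(1/q)⁻} (1−qu)^{1/φ} ∏_{P ≡ a [m]} (1−u^{deg P})⁻¹` exists, and for every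
`n ≥ 1 + 5(6 deg m + 30) ln(6 deg m + 30)` the count `S(n;a,m)` of monic polynomials of degree
`n` all of whose monic irreducible factors are `≡ a mod m` satisfies
`|S(n;a,m)/(binom(n + 1/φ − 1, n)·qⁿ) − C_{a,m}| ≤ 48·exp(3(deg m+3)/√q)·(deg m+3)/(√q·n)`. -/
theorem semigroup_arith_progression
    (F : Type) [Field F] [Fintype F] (a m : Polynomial F)
    (hcop : IsCoprime a m) (hm : m.Monic) (hdeg : 0 < m.natDegree) :
    ∃ Cam : ℝ,
      Filter.Tendsto
        (fun u : ℝ =>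
          ((1 : ℝ) - (Fintype.card F : ℝ) * u) ^
              ((1 : ℝ) / (Nat.card (Polynomial F ⧸ Ideal.span {m})ˣ : ℝ)) *
            ∏' P : {P : Polynomial F // P.Monic ∧ Irreducible P ∧ m ∣ (P - a)},
              ((1 : ℝ) - u ^ (P : Polynomial F).natDegree)⁻¹)
        (nhdsWithin ((Fintype.card F : ℝ))⁻¹ (Set.Iio ((Fintype.card F : ℝ))⁻¹))
        (nhds Cam) ∧
      ∀ n : ℕ,
        (n : ℝ) ≥ 1 + 5 * (6 * (m.natDegree : ℝ) + 30) * Real.log (6 * (m.natDegree : ℝ) + 30) →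
        |(Nat.card {f : Polynomial F // f.Monic ∧ f.natDegree = n ∧
              ∀ P : Polynomial F, P.Monic → Irreducible P → P ∣ f → m ∣ (P - a)} : ℝ) /
            (rbinom ((n : ℝ) + 1 / (Nat.card (Polynomial F ⧸ Ideal.span {m})ˣ : ℝ) - 1) n *
              (Fintype.card F : ℝ) ^ n) - Cam| ≤
          48 * Real.exp (3 * ((m.natDegree : ℝ) + 3) / Real.sqrt (Fintype.card F)) *
            ((m.natDegree : ℝ) + 3) / (Real.sqrt (Fintype.card F) * n) := by
  have := finite_quotient hm
  have hq : 2 ≤ Fintype.card F := Fintype.one_lt_card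
  have hq2 : (2 : ℝ) ≤ Fintype.card F := by exact_mod_cast hq
  have hs1 : 1 < √(Fintype.card F : ℝ) := by rw [Real.lt_sqrt zero_le_one]; linarith
  have hy0 : 0 < 1 / √(Fintype.card F : ℝ) := by positivity
  have hy1 : 1 / √(Fintype.card F : ℝ) < 1 := by rw [div_lt_one (by positivity)]; exact hs1
  have hφ1 : (1 : ℝ) ≤ Nat.card (Polynomial F ⧸ Ideal.span {m})ˣ := by
    exact_mod_cast card_units_pos (A := Polynomial F ⧸ Ideal.span {m})
  have hφq : (Nat.card (Polynomial F ⧸ Ideal.span {m})ˣ : ℝ) ≤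
      (Fintype.card F : ℝ) ^ m.natDegree := by exact_mod_cast card_units_quotient_le hm
  have he := fun k : ℕ => abs_primePowerSum_progFun_sub_le hcop hm hdeg (Nat.add_one_ne_zero k)
  set φ : ℝ := (Nat.card (Polynomial F ⧸ Ideal.span {m})ˣ : ℝ)
  refine ⟨_, tendsto_one_sub_rpow_mul_tprod
    (fun P : {P : Polynomial F // P.Monic ∧ Irreducible P ∧ m ∣ (P - a)} =>
      (P : Polynomial F).natDegree) (fun P => P.2.2.1.natDegree_pos) _ (hasSum_natDegree a m)
    (by linarith) hy0 hy1 he, fun n hn => ?_⟩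
  have hn1 : 1 ≤ n := by
    have h1 : (1 : ℝ) ≤ n := by
      refine le_trans ?_ hn
      have := Real.log_nonneg (by linarith [(Nat.cast_nonneg m.natDegree : (0 : ℝ) ≤ _)] :
        (1 : ℝ) ≤ 6 * (m.natDegree : ℝ) + 30)
      have : 0 ≤ 5 * (6 * (m.natDegree : ℝ) + 30) * Real.log (6 * (m.natDegree : ℝ) + 30) := by
        positivity
      linarith
    exact_mod_cast h1
  have hrec := (logRec_monicSum (progFun a m)).rescale (Fintype.card F : ℝ)
  have hmain := LogRec.error_bound (θ := 1 / φ) (y := 1 / √(Fintype.card F : ℝ)) (by positivity)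
    (by rw [div_le_one (by linarith)]; exact hφ1) hy0 hy1 (m.natDegree + 1)
    (e := fun k => primePowerSum (progFun a m) k / (Fintype.card F : ℝ) ^ k - 1 / φ)
    (fun k => (he k).trans (le_of_eq (by push_cast; ring)))
    (s := PowerSeries.mk fun n => monicSum (progFun a m) n / (Fintype.card F : ℝ) ^ n)
    (by simpa only [add_sub_cancel] using hrec) hn1
  rw [PowerSeries.coeff_mk, monicSum_progFun, div_div, mul_comm ((Fintype.card F : ℝ) ^ n),
    risingBinom_eq_rbinom] at hmain
  exact hmain.trans (numeric_bound _ _ n hq hdeg φ hφq hn rfl)
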